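/- Suppose m,n → ∞ with m/n → μ ∈ (0,∞), P^{(n)} → P weakly, P^{(n)}_{rs} → P_{rs} ∈ (0,∞) for (r,s) = (1,0), (2,1), and additionally P^{(n)}_{rs} → P_{rs} < ∞ for (r,s) = (3,2) and (4,3). Then ∫ φ d f_{2,n} → ∫ φ d \bar f_2 for every function φ: ℤ_+² → ℝ satisfying |φ(x,y)| ≤ c(1 + x² + y²) for some constant c < ∞. -/

import Mathlib

open MeasureTheory ProbabilityTheory Filter
open scoped ENNReal Topology Classical

noncomputable section

/-- The binomial probability mass function `Bin(x,y)(s)`. -/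
def binP (x : ℕ) (y : ℝ) (s : ℕ) : ℝ := (x.choose s : ℝ) * y ^ s * (1 - y) ^ (x - s)

/-- Convolution of (mass) functions on `ℕ`. -/
def conv (f g : ℕ → ℝ) (s : ℕ) : ℝ := ∑ i ∈ Finset.range (s + 1), f i * g (s - i)

/-- Iterated convolution power: `convPow f j` is the `j`-fold convolution of `f`. -/
def convPow (f : ℕ → ℝ) : ℕ → ℕ → ℝ
  | 0 => fun s => if s = 0 then 1 else 0
  | j + 1 => conv f (convPow f j)

/-- The compound Poisson probability mass function `CPoi(lam, f)`, i.e. the law of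
`H_1 + ⋯ + H_Λ` where `Λ ~ Poi(lam)` and the `H_k` are i.i.d. with mass function `f`,
independent of `Λ`. -/
def cpoi (lam : ℝ) (f : ℕ → ℝ) (s : ℕ) : ℝ :=
  ∑' j : ℕ, Real.exp (-lam) * lam ^ j / (j.factorial : ℝ) * convPow f j s

/-- Convolution of (mass) functions on `ℕ × ℕ`. -/
def conv2 (F G : ℕ → ℕ → ℝ) (s t : ℕ) : ℝ :=
  ∑ i ∈ Finset.range (s + 1), ∑ j ∈ Finset.range (t + 1), F i j * G (s - i) (t - j)

/-- Point mass at `(1,1)`, as a mass function on `ℕ × ℕ`. -/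
def delta11 (s t : ℕ) : ℝ := if s = 1 ∧ t = 1 then 1 else 0

/-- The cross moment `Q_{rs} = E[(X)_r Y^s]` of a layer type distribution `Q`,
where `(x)_r` is the falling factorial. -/
def mom (Q : Measure (ℕ × ℝ)) (r s : ℕ) : ℝ :=
  ∫ p, (p.1.descFactorial r : ℝ) * p.2 ^ s ∂Q

/-- The increment distribution `g(s) = ∫ Bin(x-1,y)(s) x P(dx,dy) / P₁₀`. -/
def gInc (P : Measure (ℕ × ℝ)) (s : ℕ) : ℝ :=
  (∫ p, (p.1 : ℝ) * binP (p.1 - 1) p.2 s ∂P) / mom P 1 0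

/-- The limiting degree distribution `\bar f_1 = CPoi(μ P₁₀, g)`. -/
def barf1 (mu : ℝ) (P : Measure (ℕ × ℝ)) (s : ℕ) : ℝ :=
  cpoi (mu * mom P 1 0) (gInc P) s

/-- The distribution `f₂'` of `(D₁', D₂')`:
`f₂'(s,t) = ∫ Bin(x-2,y)(s) Bin(x-2,y)(t) (x)₂ y P(dx,dy) / P₂₁`. -/
def f2p (P : Measure (ℕ × ℝ)) (s t : ℕ) : ℝ :=
  (∫ p, (p.1.descFactorial 2 : ℝ) * p.2 * binP (p.1 - 2) p.2 s * binP (p.1 - 2) p.2 t ∂P) /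
    mom P 2 1

/-- The limiting bidegree distribution `\bar f₂ = δ₍₁,₁₎ ∗ (\bar f₁ ⊗ \bar f₁) ∗ f₂'`. -/
def barf2 (mu : ℝ) (P : Measure (ℕ × ℝ)) : ℕ → ℕ → ℝ :=
  conv2 (conv2 delta11 fun s t => barf1 mu P s * barf1 mu P t) (f2p P)

instance (n : ℕ) : MeasurableSpace (Finset (Fin n)) := ⊤

/-- Bernoulli distribution on `Bool` with success probability `y` (truncated into `[0,1]`). -/
def bern (y : ℝ) : Measure Bool :=
  (PMF.bernoulli (min (Real.toNNReal y) 1) (min_le_right _ _)).toMeasure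

instance (y : ℝ) : IsProbabilityMeasure (bern y) :=
  PMF.toMeasure.isProbabilityMeasure _

/-- The distribution of the indicator of one potential edge `e` of a layer with node set `V`
and strength `y`: Bernoulli(`y`) if `e` is a non-loop pair inside `V`, and surely absent
otherwise. -/
def edgeFactor (n : ℕ) (V : Finset (Fin n)) (y : ℝ) (e : Sym2 (Fin n)) : Measure Bool :=
  if ¬ e.IsDiag ∧ ∀ v ∈ e, v ∈ V then bern y else Measure.dirac false

instance (n : ℕ) (V : Finset (Fin n)) (y : ℝ) (e : Sym2 (Fin n)) :
    IsProbabilityMeasure (edgeFactor n V y e) := by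
  unfold edgeFactor; split <;> infer_instance

/-- Conditionally on the node set `V` and strength `y`, each non-loop pair of nodes of `V`
is linked independently with probability `y`. -/
def edgeMeasure (n : ℕ) (V : Finset (Fin n)) (y : ℝ) : Measure (Sym2 (Fin n) → Bool) :=
  Measure.pi fun e => edgeFactor n V y e

/-- Uniformly random subset of the `n` nodes of size `x`. -/
def vertexMeasure (n x : ℕ) : Measure (Finset (Fin n)) :=
  if h : (Finset.powersetCard x (Finset.univ : Finset (Fin n))).Nonempty then
    (PMF.uniformOfFinset _ h).toMeasure
  else Measure.dirac ∅

/-- A sampled layer: its type `(x,y)`, its node set, and its edge indicators. -/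
abbrev Layer (n : ℕ) := (ℕ × ℝ) × Finset (Fin n) × (Sym2 (Fin n) → Bool)

/-- The distribution of a single layer with type distribution `Q`: the type `(x,y)` is
sampled from `Q`; conditionally on it, the node set is a uniformly random subset of size
`x` of the `n` nodes, and each pair of nodes of the node set is linked independently with
probability `y`. -/
def layerMeasure (n : ℕ) (Q : Measure (ℕ × ℝ)) : Measure (Layer n) :=
  Q.bind fun xy =>
    (vertexMeasure n xy.1).bind fun V =>
      (edgeMeasure n V xy.2).map fun f => (xy, V, f)

instance (n x : ℕ) : IsProbabilityMeasure (vertexMeasure n x) := by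
  unfold vertexMeasure; split <;> infer_instance

instance (n : ℕ) (V : Finset (Fin n)) (y : ℝ) : IsProbabilityMeasure (edgeMeasure n V y) := by
  unfold edgeMeasure; infer_instance

theorem measure_bind_univ_le {α β : Type*} [MeasurableSpace α] [MeasurableSpace β]
    (Q : Measure α) [IsProbabilityMeasure Q] {f : α → Measure β}
    (hf : ∀ a, f a Set.univ ≤ 1) : Q.bind f Set.univ ≤ 1 := by
  rw [Measure.bind, Measure.join_apply MeasurableSet.univ]
  by_cases hmeas : AEMeasurable f Q
  · rw [lintegral_map' (Measure.measurable_coe MeasurableSet.univ).aemeasurable hmeas]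
    calc ∫⁻ a, f a Set.univ ∂Q ≤ ∫⁻ _, 1 ∂Q := lintegral_mono hf
      _ = 1 := by simp
  · rw [Measure.map_of_not_aemeasurable hmeas]; simp

instance (n : ℕ) (Q : Measure (ℕ × ℝ)) [IsProbabilityMeasure Q] :
    IsFiniteMeasure (layerMeasure n Q) := by
  refine ⟨lt_of_le_of_lt ?_ ENNReal.one_lt_top⟩
  refine measure_bind_univ_le Q fun xy => ?_
  refine measure_bind_univ_le _ fun V => ?_
  have hg : Measurable fun f : Sym2 (Fin n) → Bool => ((xy, V, f) : Layer n) :=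
    measurable_const.prodMk (measurable_const.prodMk measurable_id)
  rw [Measure.map_apply hg MeasurableSet.univ]
  simp

/-- The Bernoulli random graph superposition model `G_n` with `n` nodes and `m` mutually
independent layers, each with type distribution `Q`. -/
def modelMeasure (n m : ℕ) (Q : Measure (ℕ × ℝ)) [IsProbabilityMeasure Q] :
    Measure (Fin m → Layer n) :=
  Measure.pi fun _ => layerMeasure n Q

/-- The edge set `E(G_{n,k})` of one layer. -/
def layerEdges {n : ℕ} (L : Layer n) : Finset (Sym2 (Fin n)) :=
  Finset.univ.filter fun e => L.2.2 e = true ∧ ¬ e.IsDiag ∧ ∀ v ∈ e, v ∈ L.2.1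

/-- The edge set `E(G_n) = ⋃ₖ E(G_{n,k})` of the superposition graph. -/
def graphEdges {n m : ℕ} (ω : Fin m → Layer n) : Finset (Sym2 (Fin n)) :=
  Finset.univ.biUnion fun k => layerEdges (ω k)

/-- The degree `deg_{G_n}(i)` of the node with label `i` (labels start from `0`). -/
def deg {n m : ℕ} (ω : Fin m → Layer n) (i : ℕ) : ℕ :=
  ((graphEdges ω).filter fun e => ∃ v : Fin n, v ∈ e ∧ (v : ℕ) = i).card

/-- The event that the first two nodes (labels `0` and `1`) are adjacent in `G_n`. -/
def adjEvent (n m : ℕ) : Set (Fin m → Layer n) :=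
  {ω | ∃ e ∈ graphEdges ω, (∃ v : Fin n, v ∈ e ∧ (v : ℕ) = 0) ∧ ∃ v : Fin n, v ∈ e ∧ (v : ℕ) = 1}

/-- The model bidegree distribution
`f_{2,n}(s,t) = P(deg(1) = s, deg(2) = t ∣ {1,2} ∈ E(G_n))`. -/
def bidegree (n m : ℕ) (Q : Measure (ℕ × ℝ)) [IsProbabilityMeasure Q] (s t : ℕ) : ℝ :=
  ((modelMeasure n m Q)[|adjEvent n m] {ω | deg ω 0 = s ∧ deg ω 1 = t}).toReal

/-! ### Weighted series in a commutative Banach algebra -/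

/-- A character `χ` of an additive monoid with values in a normed algebra, dominated in norm by a
submultiplicative weight `W`. -/
structure IsWeightedChar {M A : Type*} [AddCommMonoid M] [NormedCommRing A]
    (χ : M → A) (W : M → ℝ) : Prop where
  map_zero : χ 0 = 1
  map_add : ∀ a b, χ (a + b) = χ a * χ b
  norm_le : ∀ a, ‖χ a‖ ≤ W a
  weight_zero : W 0 = 1
  weight_add : ∀ a b, W (a + b) ≤ W a * W b

/-- `U` is the sum of the `W`-summable series `∑ f a • χ a` with nonnegative coefficients. -/
structure Represents {M A : Type*} [NormedCommRing A] [NormedAlgebra ℝ A]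
    (χ : M → A) (W : M → ℝ) (f : M → ℝ) (U : A) : Prop where
  nonneg : ∀ a, 0 ≤ f a
  summable : Summable fun a => f a * W a
  eq_tsum : U = ∑' a, f a • χ a

section Represents

variable {M A : Type*} [NormedCommRing A] [NormedAlgebra ℝ A]
  {χ : M → A} {W : M → ℝ} {f g : M → ℝ} {U V : A}

theorem Represents.summable_norm (h : Represents χ W f U) (hχ : ∀ a, ‖χ a‖ ≤ W a) :
    Summable fun a => ‖f a • χ a‖ := by
  refine Summable.of_nonneg_of_le (fun _ => norm_nonneg _) (fun a => ?_) h.summable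
  rw [norm_smul, Real.norm_of_nonneg (h.nonneg a)]
  exact mul_le_mul_of_nonneg_left (hχ a) (h.nonneg a)

theorem Represents.hasSum [CompleteSpace A] (h : Represents χ W f U) (hχ : ∀ a, ‖χ a‖ ≤ W a) :
    HasSum (fun a => f a • χ a) U := by
  rw [h.eq_tsum]; exact (h.summable_norm hχ).of_norm.hasSum

theorem Represents.const_smul (h : Represents χ W f U) {c : ℝ} (hc : 0 ≤ c) :
    Represents χ W (fun a => c * f a) (c • U) where
  nonneg a := mul_nonneg hc (h.nonneg a)
  summable := by simpa only [mul_assoc] using h.summable.mul_left c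
  eq_tsum := by rw [h.eq_tsum]; simp only [mul_smul]; exact (tsum_const_smul'' c).symm

theorem Represents.single [DecidableEq M] (m : M) :
    Represents χ W (fun a => if a = m then 1 else 0) (χ m) where
  nonneg a := by split_ifs <;> norm_num
  summable := summable_of_ne_finset_zero (s := {m}) fun b hb => by
    simp [Finset.mem_singleton.not.mp hb]
  eq_tsum := by
    rw [tsum_eq_single m]
    · simp
    · intro b hb; simp [hb]

theorem Represents.prodMk {N : Type*} [CompleteSpace A] {χ' : N → A} {W' : N → ℝ} {f' : N → ℝ}
    {W'' : M × N → ℝ}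
    (h : Represents χ W f U) (h' : Represents χ' W' f' V)
    (hχ : ∀ a, ‖χ a‖ ≤ W a) (hχ' : ∀ a, ‖χ' a‖ ≤ W' a)
    (hW0 : ∀ p, 0 ≤ W'' p) (hW : ∀ p, W'' p ≤ W p.1 * W' p.2) :
    Represents (fun p : M × N => χ p.1 * χ' p.2) W'' (fun p => f p.1 * f' p.2) (U * V) where
  nonneg p := mul_nonneg (h.nonneg _) (h'.nonneg _)
  summable := by
    have hWn : ∀ a, 0 ≤ W a := fun a => (norm_nonneg _).trans (hχ a)
    have hWn' : ∀ a, 0 ≤ W' a := fun a => (norm_nonneg _).trans (hχ' a)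
    refine Summable.of_nonneg_of_le
      (fun p => mul_nonneg (mul_nonneg (h.nonneg _) (h'.nonneg _)) (hW0 p)) (fun p => ?_)
      (Summable.mul_of_nonneg (f := fun a => f a * W a) (g := fun a => f' a * W' a)
        h.summable h'.summable (fun a => mul_nonneg (h.nonneg a) (hWn a))
        (fun a => mul_nonneg (h'.nonneg a) (hWn' a)))
    calc f p.1 * f' p.2 * W'' p ≤ f p.1 * f' p.2 * (W p.1 * W' p.2) :=
          mul_le_mul_of_nonneg_left (hW p) (mul_nonneg (h.nonneg _) (h'.nonneg _))
      _ = _ := by ring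
  eq_tsum := by
    rw [h.eq_tsum, h'.eq_tsum,
      tsum_mul_tsum_of_summable_norm (f := fun a => f a • χ a) (g := fun a => f' a • χ' a) (h.summable_norm hχ) (h'.summable_norm hχ')]
    exact tsum_congr fun p => smul_mul_smul_comm _ _ _ _

variable [AddCommMonoid M] [Finset.HasAntidiagonal M] [CompleteSpace A]

theorem Represents.mul (hw : IsWeightedChar χ W) (hf : Represents χ W f U)
    (hg : Represents χ W g V) :
    Represents χ W (fun n => ∑ p ∈ Finset.HasAntidiagonal.antidiagonal n, f p.1 * g p.2) (U * V) ∧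
      ∑' n, (∑ p ∈ Finset.HasAntidiagonal.antidiagonal n, f p.1 * g p.2) * W n ≤
        (∑' n, f n * W n) * ∑' n, g n * W n := by
  have hWn : ∀ a, 0 ≤ W a := fun a => (norm_nonneg _).trans (hw.norm_le a)
  have hprod : Summable fun x : M × M => (f x.1 * W x.1) * (g x.2 * W x.2) :=
    Summable.mul_of_nonneg (f := fun a => f a * W a) (g := fun a => g a * W a)
      hf.summable hg.summable
      (fun a => mul_nonneg (hf.nonneg a) (hWn a)) (fun a => mul_nonneg (hg.nonneg a) (hWn a))
  have hnn : ∀ n, 0 ≤ (∑ p ∈ Finset.HasAntidiagonal.antidiagonal n, f p.1 * g p.2) * W n := fun n =>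
    mul_nonneg (Finset.sum_nonneg fun p _ => mul_nonneg (hf.nonneg _) (hg.nonneg _)) (hWn n)
  have hle : ∀ n, (∑ p ∈ Finset.HasAntidiagonal.antidiagonal n, f p.1 * g p.2) * W n ≤
      ∑ p ∈ Finset.HasAntidiagonal.antidiagonal n, (f p.1 * W p.1) * (g p.2 * W p.2) := by
    intro n
    rw [Finset.sum_mul]
    refine Finset.sum_le_sum fun p hp => ?_
    rw [Finset.HasAntidiagonal.mem_antidiagonal] at hp
    calc f p.1 * g p.2 * W n ≤ f p.1 * g p.2 * (W p.1 * W p.2) := by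
          refine mul_le_mul_of_nonneg_left ?_ (mul_nonneg (hf.nonneg _) (hg.nonneg _))
          rw [← hp]; exact hw.weight_add _ _
      _ = _ := by ring
  have hs : Summable fun n => ∑ p ∈ Finset.HasAntidiagonal.antidiagonal n,
      (f p.1 * W p.1) * (g p.2 * W p.2) := summable_sum_mul_antidiagonal_of_summable_mul
        (f := fun a => f a * W a) (g := fun a => g a * W a) hprod
  have hs' : Summable fun n =>
      (∑ p ∈ Finset.HasAntidiagonal.antidiagonal n, f p.1 * g p.2) * W n := Summable.of_nonneg_of_le hnn hle hs
  have h0 : ∀ n, 0 ≤ ∑ p ∈ Finset.HasAntidiagonal.antidiagonal n, f p.1 * g p.2 := fun n =>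
    Finset.sum_nonneg fun p _ => mul_nonneg (hf.nonneg _) (hg.nonneg _)
  refine ⟨⟨h0, hs', ?_⟩, ?_⟩
  · have hf' := hf.summable_norm hw.norm_le
    have hg' := hg.summable_norm hw.norm_le
    rw [hf.eq_tsum, hg.eq_tsum, Summable.tsum_mul_tsum_eq_tsum_sum_antidiagonal
      (f := fun a => f a • χ a) (g := fun a => g a • χ a) hf'.of_norm hg'.of_norm
      (summable_mul_of_summable_norm (f := fun a => f a • χ a) (g := fun a => g a • χ a) hf' hg')]
    refine tsum_congr fun n => ?_
    rw [Finset.sum_smul]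
    refine Finset.sum_congr rfl fun p hp => ?_
    rw [Finset.HasAntidiagonal.mem_antidiagonal] at hp
    rw [smul_mul_smul_comm, ← hp, hw.map_add]
  · rw [Summable.tsum_mul_tsum_eq_tsum_sum_antidiagonal
      (f := fun a => f a * W a) (g := fun a => g a * W a) hf.summable hg.summable hprod]
    exact hs'.tsum_le_tsum hle hs

end Represents

section Cpoi

variable {A : Type*} [NormedCommRing A] [NormedAlgebra ℝ A] [CompleteSpace A]
  {χ : ℕ → A} {W : ℕ → ℝ}

theorem conv_eq_sum_antidiagonal (f g : ℕ → ℝ) :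
    conv f g = fun n => ∑ p ∈ Finset.HasAntidiagonal.antidiagonal n, f p.1 * g p.2 := by
  funext n
  rw [Finset.Nat.sum_antidiagonal_eq_sum_range_succ fun i j => f i * g j]
  rfl

theorem represents_convPow (hw : IsWeightedChar χ W) {g : ℕ → ℝ} {G : A}
    (hg : Represents χ W g G) (j : ℕ) :
    Represents χ W (convPow g j) (G ^ j) ∧
      ∑' s, convPow g j s * W s ≤ (∑' s, g s * W s) ^ j := by
  have hWn : ∀ a, 0 ≤ W a := fun a => (norm_nonneg _).trans (hw.norm_le a)
  induction j with
  | zero =>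
    refine ⟨?_, ?_⟩
    · have := Represents.single (χ := χ) (W := W) (0 : ℕ)
      rw [hw.map_zero] at this
      rw [pow_zero]
      exact this
    · rw [tsum_eq_single 0]
      · simp [convPow, hw.weight_zero]
      · intro b hb; simp [convPow, hb]
  | succ j ih =>
    obtain ⟨h1, h2⟩ := Represents.mul hw hg ih.1
    rw [show convPow g (j + 1) = conv g (convPow g j) from rfl, conv_eq_sum_antidiagonal]
    refine ⟨by rw [pow_succ']; exact h1, h2.trans ?_⟩
    rw [pow_succ']
    exact mul_le_mul_of_nonneg_left ih.2 (tsum_nonneg fun a => mul_nonneg (hg.nonneg a) (hWn a))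

theorem represents_cpoi (hw : IsWeightedChar χ W) {g : ℕ → ℝ} {G : A}
    (hg : Represents χ W g G) {lam : ℝ} (hlam : 0 ≤ lam) :
    Represents χ W (cpoi lam g) (NormedSpace.exp (lam • (G - 1))) := by
  have hWn : ∀ a, 0 ≤ W a := fun a => (norm_nonneg _).trans (hw.norm_le a)
  set C : ℝ := ∑' s, g s * W s with hC
  have hC0 : 0 ≤ C := tsum_nonneg fun a => mul_nonneg (hg.nonneg a) (hWn a)
  set a : ℕ → ℝ := fun j => Real.exp (-lam) * lam ^ j / (j.factorial : ℝ) with ha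
  have ha0 : ∀ j, 0 ≤ a j := fun j => by positivity
  have haC : Summable fun j => a j * C ^ j := by
    have := (Real.summable_pow_div_factorial (lam * C)).mul_left (Real.exp (-lam))
    refine this.congr fun j => ?_
    rw [ha]; simp only [mul_pow]; ring
  have hpow := represents_convPow hw hg
  have hc0 : ∀ j s, 0 ≤ convPow g j s := fun j => (hpow j).1.nonneg
  have hdouble : Summable fun p : ℕ × ℕ => a p.1 * (convPow g p.1 p.2 * W p.2) := by
    have h0 : ∀ p : ℕ × ℕ, 0 ≤ a p.1 * (convPow g p.1 p.2 * W p.2) := fun p =>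
      mul_nonneg (ha0 _) (mul_nonneg (hc0 _ _) (hWn _))
    rw [summable_prod_of_nonneg h0]
    refine ⟨fun j => Summable.mul_left (a j) (hpow j).1.summable, ?_⟩
    have h1 : (fun j => ∑' s, a j * (convPow g j s * W s)) =
        fun j => a j * ∑' s, convPow g j s * W s := funext fun j => tsum_mul_left
    change Summable fun j => ∑' s, a j * (convPow g j s * W s)
    rw [h1]
    exact Summable.of_nonneg_of_le
      (fun j => mul_nonneg (ha0 j) (tsum_nonneg fun s => mul_nonneg (hc0 _ _) (hWn _)))
      (fun j => mul_le_mul_of_nonneg_left (hpow j).2 (ha0 j)) haC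
  have hcp : ∀ s, cpoi lam g s * W s = ∑' j, a j * (convPow g j s * W s) := by
    intro s
    rw [cpoi, ← tsum_mul_right]
    exact tsum_congr fun j => by rw [ha]; ring
  have hcol : ∀ s, Summable fun j => a j * (convPow g j s * W s) := fun s =>
    hdouble.prod_symm.prod_factor s
  refine ⟨fun s => tsum_nonneg fun j => mul_nonneg (ha0 j) (hc0 j s), ?_, ?_⟩
  · simp only [hcp]
    exact hdouble.prod_symm.prod
  · have hexp : NormedSpace.exp (lam • (G - 1)) = ∑' j, a j • G ^ j := by
      have h1 : lam • (G - 1) = algebraMap ℝ A (-lam) + lam • G := by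
        rw [Algebra.algebraMap_eq_smul_one]; module
      let _ : NormedAlgebra ℚ A := NormedAlgebra.restrictScalars ℚ ℝ A
      rw [h1, NormedSpace.exp_add_of_commute (Commute.all _ _), ← NormedSpace.algebraMap_exp_comm,
        ← Real.exp_eq_exp_ℝ, NormedSpace.exp_eq_tsum ℝ, ← Algebra.smul_def, ← tsum_const_smul'']
      refine tsum_congr fun j => ?_
      rw [smul_pow, smul_smul, smul_smul, ha]
      congr 1
      field_simp
    have hjs : Summable fun p : ℕ × ℕ => a p.1 • convPow g p.1 p.2 • χ p.2 := by
      refine Summable.of_norm (Summable.of_nonneg_of_le (fun _ => norm_nonneg _) (fun p => ?_)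
        hdouble)
      rw [norm_smul, norm_smul, Real.norm_of_nonneg (ha0 _), Real.norm_of_nonneg (hc0 _ _)]
      exact mul_le_mul_of_nonneg_left
        (mul_le_mul_of_nonneg_left (hw.norm_le _) (hc0 _ _)) (ha0 _)
    rw [hexp]
    calc ∑' j, a j • G ^ j = ∑' j, ∑' s, a j • convPow g j s • χ s := by
          refine tsum_congr fun j => ?_
          rw [tsum_const_smul'', ← (hpow j).1.eq_tsum]
      _ = ∑' s, ∑' j, a j • convPow g j s • χ s :=
          Summable.tsum_comm (f := fun s j => a j • convPow g j s • χ s) hjs.prod_symm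
      _ = ∑' s, cpoi lam g s • χ s := by
          refine tsum_congr fun s => ?_
          rw [cpoi]
          by_cases hχ : χ s = 0
          · simp [hχ]
          have hW : 0 < W s := (norm_pos_iff.mpr hχ).trans_le (hw.norm_le s)
          have hsum : Summable fun j => a j * convPow g j s := by
            have := (hcol s).mul_right (W s)⁻¹
            refine this.congr fun j => ?_
            field_simp
          rw [← hsum.tsum_smul_const]
          exact tsum_congr fun j => by rw [smul_smul]

end Cpoi

section Pairs

/-- The antidiagonal of a pair of natural numbers, formed componentwise. -/
instance : Finset.HasAntidiagonal (ℕ × ℕ) where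
  antidiagonal p := (Finset.HasAntidiagonal.antidiagonal p.1 ×ˢ Finset.HasAntidiagonal.antidiagonal p.2).map
    (Equiv.prodProdProdComm ℕ ℕ ℕ ℕ).toEmbedding
  mem_antidiagonal := by
    rintro ⟨s, t⟩ ⟨⟨a, b⟩, ⟨c, d⟩⟩
    simp only [Finset.mem_map_equiv, Equiv.prodProdProdComm_symm, Equiv.prodProdProdComm_apply,
      Finset.mem_product, Finset.HasAntidiagonal.mem_antidiagonal, Prod.mk_add_mk, Prod.mk.injEq]

theorem conv2_eq_sum_antidiagonal (F G : ℕ → ℕ → ℝ) (q : ℕ × ℕ) :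
    conv2 F G q.1 q.2 =
      ∑ p ∈ Finset.HasAntidiagonal.antidiagonal q, F p.1.1 p.1.2 * G p.2.1 p.2.2 := by
  obtain ⟨s, t⟩ := q
  rw [show Finset.HasAntidiagonal.antidiagonal (s, t) = (Finset.HasAntidiagonal.antidiagonal s ×ˢ Finset.HasAntidiagonal.antidiagonal t).map
    (Equiv.prodProdProdComm ℕ ℕ ℕ ℕ).toEmbedding from rfl, Finset.sum_map, Finset.sum_product]
  simp only [Equiv.coe_toEmbedding, Equiv.prodProdProdComm_apply]
  rw [Finset.Nat.sum_antidiagonal_eq_sum_range_succ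
    fun i i' => ∑ y ∈ Finset.HasAntidiagonal.antidiagonal t, F i y.1 * G i' y.2]
  refine Finset.sum_congr rfl fun i _ => ?_
  rw [Finset.Nat.sum_antidiagonal_eq_sum_range_succ fun j k => F i j * G (s - i) k]

end Pairs

/-! ### Powers close to the identity -/

section Power

variable {A : Type*} [NormedCommRing A]

theorem norm_pow_le_pow_of_norm_le (h1 : ‖(1 : A)‖ ≤ 1) {a : A} {M : ℝ} (ha : ‖a‖ ≤ M) (r : ℕ) :
    ‖a ^ r‖ ≤ M ^ r := by
  induction r with
  | zero => simpa using h1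
  | succ r ih =>
    rw [pow_succ, pow_succ]
    exact (norm_mul_le _ _).trans
      (mul_le_mul ih ha (norm_nonneg _) (pow_nonneg ((norm_nonneg _).trans ha) _))

theorem norm_pow_sub_pow_le (h1 : ‖(1 : A)‖ ≤ 1) {a b : A} {M : ℝ} (hM : 1 ≤ M)
    (ha : ‖a‖ ≤ M) (hb : ‖b‖ ≤ M) (r : ℕ) :
    ‖a ^ r - b ^ r‖ ≤ r * M ^ r * ‖a - b‖ := by
  induction r with
  | zero => simp
  | succ r ih =>
    have e : a ^ (r + 1) - b ^ (r + 1) = a ^ r * (a - b) + (a ^ r - b ^ r) * b := by ring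
    have hM0 : (0 : ℝ) ≤ M := by linarith
    have h2 : M ^ r ≤ M ^ (r + 1) := pow_le_pow_right₀ hM (by omega)
    calc ‖a ^ (r + 1) - b ^ (r + 1)‖ ≤ ‖a ^ r‖ * ‖a - b‖ + ‖a ^ r - b ^ r‖ * ‖b‖ := by
          rw [e]
          exact (norm_add_le _ _).trans (add_le_add (norm_mul_le _ _) (norm_mul_le _ _))
      _ ≤ M ^ (r + 1) * ‖a - b‖ + (r * M ^ r * ‖a - b‖) * M := by
          gcongr
          exact (norm_pow_le_pow_of_norm_le h1 ha r).trans h2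
      _ = _ := by push_cast; ring

theorem tendsto_one_add_pow_exp [NormedAlgebra ℝ A] [CompleteSpace A] (h1 : ‖(1 : A)‖ ≤ 1)
    {κ : ℕ → A} {K : A} {r : ℕ → ℕ} {μ : ℝ} (hκ : Tendsto κ atTop (𝓝 K))
    (hr : Tendsto (fun n : ℕ => (r n : ℝ) / n) atTop (𝓝 μ)) :
    Tendsto (fun n : ℕ => (1 + (1 / (n : ℝ)) • κ n) ^ r n) atTop
      (𝓝 (NormedSpace.exp (μ • K))) := by
  let _ : NormedAlgebra ℚ A := NormedAlgebra.restrictScalars ℚ ℝ A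
  set x : ℕ → A := fun n => (1 / (n : ℝ)) • κ n with hx
  have hx0 : Tendsto x atTop (𝓝 0) := by
    simpa [hx] using (tendsto_one_div_atTop_nhds_zero_nat (𝕜 := ℝ)).smul hκ
  have hrx : Tendsto (fun n => (r n : ℝ) * ‖x n‖) atTop (𝓝 (μ * ‖K‖)) := by
    refine (hr.mul hκ.norm).congr fun n => ?_
    simp only [hx, norm_smul, norm_div, norm_one, Real.norm_natCast]
    ring
  have hlo : (fun y : A => NormedSpace.exp y - 1 - y) =o[𝓝 0] fun y => y := by
    have := (hasFDerivAt_exp_zero (𝕂 := ℝ) (𝔸 := A)).isLittleO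
    simpa [NormedSpace.exp_zero] using this
  have hlo' := hlo.comp_tendsto hx0
  have hexp : Tendsto (fun n => NormedSpace.exp (x n) ^ r n) atTop
      (𝓝 (NormedSpace.exp (μ • K))) := by
    have h2 : Tendsto (fun n => NormedSpace.exp (((r n : ℝ) / n) • κ n)) atTop
      (𝓝 (NormedSpace.exp (μ • K))) := (NormedSpace.exp_continuous.tendsto _).comp (hr.smul hκ)
    refine h2.congr fun n => ?_
    rw [← NormedSpace.exp_nsmul, hx, ← Nat.cast_smul_eq_nsmul ℝ, smul_smul, mul_one_div]
  have hdiff : Tendsto (fun n => (1 + x n) ^ r n - NormedSpace.exp (x n) ^ r n) atTop (𝓝 0) := by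
    have hb : ∀ᶠ n in atTop, (r n : ℝ) * ‖x n‖ ≤ μ * ‖K‖ + 1 :=
      hrx.eventually_le_const (by linarith)
    have hone := hlo'.bound (zero_lt_one)
    rw [Metric.tendsto_nhds]
    intro ε hε
    set B := μ * ‖K‖ + 1 with hB
    set δ := ε / (2 * (|B| + 1) * Real.exp (2 * B)) with hδ
    have hδ0 : 0 < δ := by positivity
    filter_upwards [hb, hone, hlo'.bound hδ0] with n h3 h4 h5
    simp only [Function.comp_apply, one_mul] at h4 h5
    rw [dist_zero_right]
    have ha : ‖1 + x n‖ ≤ 1 + 2 * ‖x n‖ := by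
      have := norm_add_le 1 (x n)
      have := norm_nonneg (x n)
      linarith
    have hbn : ‖NormedSpace.exp (x n)‖ ≤ 1 + 2 * ‖x n‖ := by
      have e : NormedSpace.exp (x n) = (NormedSpace.exp (x n) - 1 - x n) + 1 + x n := by abel
      rw [e]
      have := norm_add₃_le (a := (NormedSpace.exp (x n) - 1 - x n)) (b := 1) (c := x n)
      linarith
    have hab : ‖(1 + x n) - NormedSpace.exp (x n)‖ ≤ δ * ‖x n‖ := by
      have e : (1 + x n) - NormedSpace.exp (x n) = -(NormedSpace.exp (x n) - 1 - x n) := by abel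
      rwa [e, norm_neg]
    have hM : (1 + 2 * ‖x n‖) ^ r n ≤ Real.exp (2 * B) := by
      calc (1 + 2 * ‖x n‖) ^ r n ≤ (Real.exp (2 * ‖x n‖)) ^ r n := by
            gcongr
            linarith [Real.add_one_le_exp (2 * ‖x n‖)]
        _ = Real.exp (2 * (r n * ‖x n‖)) := by rw [← Real.exp_nat_mul]; ring_nf
        _ ≤ _ := by gcongr
    calc ‖(1 + x n) ^ r n - NormedSpace.exp (x n) ^ r n‖
        ≤ r n * (1 + 2 * ‖x n‖) ^ r n * ‖(1 + x n) - NormedSpace.exp (x n)‖ :=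
          norm_pow_sub_pow_le h1 (by linarith [norm_nonneg (x n)]) ha hbn _
      _ ≤ r n * Real.exp (2 * B) * (δ * ‖x n‖) := by gcongr
      _ = (r n * ‖x n‖) * (Real.exp (2 * B) * δ) := by ring
      _ ≤ |B| * (Real.exp (2 * B) * δ) := by
          gcongr
          exact h3.trans (le_abs_self B)
      _ = ε / 2 * (|B| / (|B| + 1)) := by rw [hδ]; field_simp
      _ ≤ ε / 2 * 1 := by
          gcongr
          rw [div_le_one (by positivity)]
          linarith
      _ < ε := by linarith
  simpa [hx] using hdiff.add hexp

end Power

/-! ### Binomial mixtures -/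

theorem binP_nonneg (k : ℕ) {y : ℝ} (hy : y ∈ Set.Icc (0 : ℝ) 1) (a : ℕ) : 0 ≤ binP k y a := by
  have h0 := hy.1
  have h1 : 0 ≤ 1 - y := by linarith [hy.2]
  unfold binP; positivity

theorem binP_eq_zero_of_lt {k a : ℕ} (h : k < a) (y : ℝ) : binP k y a = 0 := by
  simp [binP, Nat.choose_eq_zero_of_lt h]

theorem continuous_binP (k a : ℕ) : Continuous fun y => binP k y a := by
  unfold binP; fun_prop

/-- The image of the probability generating function of a Bernoulli variable. -/
def bernElt {A : Type*} [Ring A] [Algebra ℝ A] (s : A) (y : ℝ) : A := (1 - y) • 1 + y • s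

theorem bernElt_pow {A : Type*} [Ring A] [Algebra ℝ A] (s : A) (y : ℝ) (k : ℕ) :
    bernElt s y ^ k = ∑ a ∈ Finset.range (k + 1), binP k y a • s ^ a := by
  have hc : Commute (y • s) ((1 - y) • (1 : A)) :=
    ((Commute.one_right s).smul_right _).smul_left _
  rw [bernElt, add_comm, hc.add_pow]
  refine Finset.sum_congr rfl fun a _ => ?_
  rw [smul_pow, smul_pow, one_pow, smul_mul_smul_comm, mul_one, ← nsmul_eq_mul',
    ← Nat.cast_smul_eq_nsmul ℝ, smul_smul, binP]
  ring_nf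

/-- The expectation of `h` under the binomial distribution. -/
def binE (k : ℕ) (y : ℝ) (h : ℕ → ℝ) : ℝ := ∑ a ∈ Finset.range (k + 1), binP k y a * h a

theorem binE_succ (k : ℕ) (y : ℝ) (h : ℕ → ℝ) :
    binE (k + 1) y h = (1 - y) * binE k y h + y * binE k y fun a => h (a + 1) := by
  let S : Module.End ℝ (ℕ → ℝ) := LinearMap.funLeft ℝ ℝ Nat.succ
  have hS : ∀ (a : ℕ) (h : ℕ → ℝ) (i : ℕ), (S ^ a) h i = h (i + a) := by
    intro a
    induction a with
    | zero => intro h i; simp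
    | succ a ih =>
      intro h i
      rw [pow_succ, Module.End.mul_apply, ih]
      rfl
  have key : ∀ (k : ℕ) (h : ℕ → ℝ), (bernElt S y ^ k) h 0 = binE k y h := by
    intro k h
    rw [bernElt_pow, binE]
    simp [LinearMap.sum_apply, Finset.sum_apply, hS]
  have e : (bernElt S y) h = (1 - y) • h + y • fun a => h (a + 1) := by
    simp only [bernElt, LinearMap.add_apply, LinearMap.smul_apply, Module.End.one_apply]
    rfl
  rw [← key, pow_succ, Module.End.mul_apply, e, map_add, map_smul, map_smul, Pi.add_apply,
    Pi.smul_apply, Pi.smul_apply, key, key, smul_eq_mul, smul_eq_mul]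

theorem binE_one (k : ℕ) (y : ℝ) : binE k y (fun _ => 1) = 1 := by
  induction k with
  | zero => simp [binE, binP]
  | succ k ih => rw [binE_succ, ih]; ring

theorem binE_const (k : ℕ) (y c : ℝ) : binE k y (fun _ => c) = c := by
  have := binE_one k y
  simp only [binE, mul_one] at this ⊢
  rw [← Finset.sum_mul, this, one_mul]

theorem binE_add (k : ℕ) (y : ℝ) (h h' : ℕ → ℝ) :
    binE k y (fun a => h a + h' a) = binE k y h + binE k y h' := by
  simp only [binE, mul_add, Finset.sum_add_distrib]

theorem binE_mono (k : ℕ) {y : ℝ} (hy : y ∈ Set.Icc (0 : ℝ) 1) {h h' : ℕ → ℝ}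
    (hh : ∀ a, h a ≤ h' a) : binE k y h ≤ binE k y h' :=
  Finset.sum_le_sum fun a _ => mul_le_mul_of_nonneg_left (hh a) (binP_nonneg k hy a)

theorem binE_sq_le (k : ℕ) {y : ℝ} (hy : y ∈ Set.Icc (0 : ℝ) 1) (c : ℝ) :
    binE k y (fun a => (c + a) ^ 2) ≤ (c + k * y) ^ 2 + k * y := by
  have h1 : 0 ≤ 1 - y := by linarith [hy.2]
  induction k generalizing c with
  | zero => simp [binE, binP]
  | succ k ih =>
    rw [binE_succ]
    have e : (fun a : ℕ => (c + ((a + 1 : ℕ) : ℝ)) ^ 2) = fun a : ℕ => (c + 1 + a) ^ 2 := by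
      funext a; push_cast; ring
    rw [e]
    have := mul_le_mul_of_nonneg_left (ih c) h1
    have := mul_le_mul_of_nonneg_left (ih (c + 1)) hy.1
    push_cast
    nlinarith [sq_nonneg y]

theorem binE_binE_sq_le (k l : ℕ) {y : ℝ} (hy : y ∈ Set.Icc (0 : ℝ) 1) (c : ℝ) :
    binE k y (fun a => binE l y fun b => (c + a + b) ^ 2) ≤
      (c + (k + l : ℕ) * y) ^ 2 + (k + l : ℕ) * y := by
  calc _ ≤ binE k y (fun a => ((c + l * y) + a) ^ 2 + l * y) := by
        refine binE_mono k hy fun a => (binE_sq_le l hy _).trans (le_of_eq ?_)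
        ring
    _ ≤ _ := by
        rw [binE_add, binE_const]
        have := binE_sq_le k hy (c + l * y)
        push_cast
        nlinarith

section Bivariate

variable {A : Type*} [NormedCommRing A] [NormedAlgebra ℝ A] {s₀ s₁ : A}

theorem norm_convex_comb_le {a b : A} {y α β : ℝ} (hy : y ∈ Set.Icc (0 : ℝ) 1) (ha : ‖a‖ ≤ α)
    (hb : ‖b‖ ≤ β) : ‖(1 - y) • a + y • b‖ ≤ (1 - y) * α + y * β := by
  have h1 : 0 ≤ 1 - y := by linarith [hy.2]
  refine (norm_add_le _ _).trans ?_
  rw [norm_smul, norm_smul, Real.norm_of_nonneg h1, Real.norm_of_nonneg hy.1]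
  exact add_le_add (mul_le_mul_of_nonneg_left ha h1) (mul_le_mul_of_nonneg_left hb hy.1)

theorem norm_mul_bernElt_pow_le (hs : ∀ i j : ℕ, ‖s₀ ^ i * s₁ ^ j‖ ≤ (1 + i + j : ℝ) ^ 2)
    {y : ℝ} (hy : y ∈ Set.Icc (0 : ℝ) 1) (k l i j : ℕ) :
    ‖s₀ ^ i * s₁ ^ j * (bernElt s₀ y ^ k * bernElt s₁ y ^ l)‖ ≤
      (1 + i + j + (k + l : ℕ) * y) ^ 2 + (k + l : ℕ) * y := by
  have step : ∀ (N c : ℝ), (1 - y) * ((c + N * y) ^ 2 + N * y) +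
      y * ((c + 1 + N * y) ^ 2 + N * y) ≤ (c + (N + 1) * y) ^ 2 + (N + 1) * y := fun N c => by
    nlinarith [sq_nonneg y]
  induction k generalizing i with
  | zero =>
    induction l generalizing j with
    | zero => simpa using hs i j
    | succ l ih =>
      have e : s₀ ^ i * s₁ ^ j * (bernElt s₀ y ^ 0 * bernElt s₁ y ^ (l + 1)) =
          (1 - y) • (s₀ ^ i * s₁ ^ j * (bernElt s₀ y ^ 0 * bernElt s₁ y ^ l)) +
            y • (s₀ ^ i * s₁ ^ (j + 1) * (bernElt s₀ y ^ 0 * bernElt s₁ y ^ l)) := by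
        rw [pow_succ (bernElt s₁ y)]
        conv_lhs => enter [2, 2, 2]; rw [bernElt]
        simp only [Algebra.smul_def]
        ring
      rw [e]
      refine (norm_convex_comb_le hy (ih j) (ih (j + 1))).trans (le_trans (le_of_eq ?_)
        ((step (0 + l : ℕ) (1 + i + j)).trans (le_of_eq ?_))) <;> push_cast <;> ring
  | succ k ih =>
    have e : s₀ ^ i * s₁ ^ j * (bernElt s₀ y ^ (k + 1) * bernElt s₁ y ^ l) =
        (1 - y) • (s₀ ^ i * s₁ ^ j * (bernElt s₀ y ^ k * bernElt s₁ y ^ l)) +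
          y • (s₀ ^ (i + 1) * s₁ ^ j * (bernElt s₀ y ^ k * bernElt s₁ y ^ l)) := by
      rw [pow_succ (bernElt s₀ y)]
      conv_lhs => enter [2, 1, 2]; rw [bernElt]
      simp only [Algebra.smul_def]
      ring
    rw [e]
    refine (norm_convex_comb_le hy (ih i) (ih (i + 1))).trans (le_trans (le_of_eq ?_)
      ((step (k + l : ℕ) (1 + i + j)).trans (le_of_eq ?_))) <;> push_cast <;> ring

theorem norm_bernElt_pow_sub_one_le
    (hs : ∀ i j : ℕ, ‖s₀ ^ i * s₁ ^ j‖ ≤ (1 + i + j : ℝ) ^ 2)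
    {y : ℝ} (hy : y ∈ Set.Icc (0 : ℝ) 1) (k l : ℕ) :
    ‖bernElt s₀ y ^ k * bernElt s₁ y ^ l - 1‖ ≤
      ((k + l : ℕ) : ℝ) ^ 2 * y ^ 2 + 5 * (k + l : ℕ) * y := by
  have h1 : ‖(1 : A)‖ ≤ 1 := by simpa using hs 0 0
  have step : ∀ N : ℝ, 0 ≤ N → (1 - y) * (N ^ 2 * y ^ 2 + 5 * N * y) +
      y * ((2 + N * y) ^ 2 + N * y + 1) ≤ (N + 1) ^ 2 * y ^ 2 + 5 * (N + 1) * y := fun N hN => by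
    have := mul_nonneg hN (sq_nonneg y)
    nlinarith [sq_nonneg y]
  induction k with
  | zero =>
    induction l with
    | zero => simp
    | succ l ih =>
      have e : bernElt s₀ y ^ 0 * bernElt s₁ y ^ (l + 1) - 1 =
          (1 - y) • (bernElt s₀ y ^ 0 * bernElt s₁ y ^ l - 1) +
            y • (s₀ ^ 0 * s₁ ^ 1 * (bernElt s₀ y ^ 0 * bernElt s₁ y ^ l) - 1) := by
        rw [pow_succ (bernElt s₁ y)]
        conv_lhs => enter [1, 2, 2]; rw [bernElt]
        simp only [Algebra.smul_def, map_sub, map_one]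
        ring
      rw [e]
      have h2 := (norm_sub_le _ _).trans
        (add_le_add (norm_mul_bernElt_pow_le hs hy 0 l 0 1) h1)
      refine (norm_convex_comb_le hy ih h2).trans (le_trans (le_of_eq ?_)
        ((step (0 + l : ℕ) (by positivity)).trans (le_of_eq ?_))) <;> push_cast <;> ring
  | succ k ih =>
    have e : bernElt s₀ y ^ (k + 1) * bernElt s₁ y ^ l - 1 =
        (1 - y) • (bernElt s₀ y ^ k * bernElt s₁ y ^ l - 1) +
          y • (s₀ ^ 1 * s₁ ^ 0 * (bernElt s₀ y ^ k * bernElt s₁ y ^ l) - 1) := by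
      rw [pow_succ (bernElt s₀ y)]
      conv_lhs => enter [1, 1, 2]; rw [bernElt]
      simp only [Algebra.smul_def, map_sub, map_one]
      ring
    rw [e]
    have h2 := (norm_sub_le _ _).trans
      (add_le_add (norm_mul_bernElt_pow_le hs hy k l 1 0) h1)
    refine (norm_convex_comb_le hy ih h2).trans (le_trans (le_of_eq ?_)
      ((step (k + l : ℕ) (by positivity)).trans (le_of_eq ?_))) <;> push_cast <;> ring

end Bivariate

/-! ### Mixtures of weighted series -/

theorem Represents.integral {M A Ω : Type*} [Countable M] [MeasurableSpace Ω] {ν : Measure Ω}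
    [NormedCommRing A] [NormedAlgebra ℝ A] [CompleteSpace A] {χ : M → A} {W : M → ℝ}
    {c : M → Ω → ℝ} {F : Ω → A} {h : Ω → ℝ} (hχ : ∀ i, ‖χ i‖ ≤ W i) (hW : ∀ i, 1 ≤ W i)
    (hcm : ∀ i, AEStronglyMeasurable (c i) ν) (hh : Integrable h ν)
    (hc : ∀ᵐ p ∂ν, (∀ i, 0 ≤ c i p) ∧ HasSum (fun i => c i p • χ i) (F p) ∧
      ∀ s : Finset M, ∑ i ∈ s, c i p * W i ≤ h p) :
    Represents χ W (fun i => ∫ p, c i p ∂ν) (∫ p, F p ∂ν) := by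
  have hW0 : ∀ i, 0 ≤ W i := fun i => zero_le_one.trans (hW i)
  have hci : ∀ i, Integrable (c i) ν := fun i => by
    refine hh.mono' (hcm i) ?_
    filter_upwards [hc] with p hp
    rw [Real.norm_of_nonneg (hp.1 i)]
    refine le_trans ?_ (hp.2.2 {i})
    rw [Finset.sum_singleton]
    exact le_mul_of_one_le_right (hp.1 i) (hW i)
  have hnn : ∀ i, 0 ≤ ∫ p, c i p ∂ν := fun i => by
    refine integral_nonneg_of_ae ?_
    filter_upwards [hc] with p hp using hp.1 i
  have hsum : Summable fun i => (∫ p, c i p ∂ν) * W i := by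
    refine summable_of_sum_le (c := ∫ p, h p ∂ν) (fun i => mul_nonneg (hnn i) (hW0 i)) fun s => ?_
    simp_rw [← integral_mul_const]
    rw [← integral_finsetSum s fun i _ => (hci i).mul_const _]
    refine integral_mono_ae (integrable_finsetSum s fun i _ => (hci i).mul_const _) hh ?_
    filter_upwards [hc] with p hp using hp.2.2 s
  refine ⟨hnn, hsum, ?_⟩
  have hn : ∀ i, ∫ p, ‖c i p • χ i‖ ∂ν ≤ (∫ p, c i p ∂ν) * W i := fun i => by
    have : ∫ p, ‖c i p • χ i‖ ∂ν = (∫ p, c i p ∂ν) * ‖χ i‖ := by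
      rw [← integral_mul_const]
      refine integral_congr_ae ?_
      filter_upwards [hc] with p hp
      rw [norm_smul, Real.norm_of_nonneg (hp.1 i)]
    rw [this]
    exact mul_le_mul_of_nonneg_left (hχ i) (hnn i)
  have := hasSum_integral_of_summable_integral_norm (F := fun i p => c i p • χ i)
    (fun i => (hci i).smul_const (χ i))
    (Summable.of_nonneg_of_le (fun i => integral_nonneg fun p => norm_nonneg _) hn hsum)
  simp_rw [integral_smul_const] at this
  rw [this.tsum_eq]
  refine integral_congr_ae ?_
  filter_upwards [hc] with p hp using hp.2.1.tsum_eq.symm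

/-- The integrand of the cross moment `mom Q r s`. -/
def momFun (r s : ℕ) (p : ℕ × ℝ) : ℝ := (p.1.descFactorial r : ℝ) * p.2 ^ s

theorem continuous_of_forall_slice {B : Type*} [TopologicalSpace B] {f : ℕ × ℝ → B}
    (hf : ∀ x, Continuous fun y => f (x, y)) : Continuous f :=
  continuous_prod_of_discrete_left.mpr hf

theorem momFun_nonneg (r s : ℕ) {p : ℕ × ℝ} (hp : p.2 ∈ Set.Icc (0 : ℝ) 1) : 0 ≤ momFun r s p :=
  mul_nonneg (Nat.cast_nonneg _) (pow_nonneg hp.1 _)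

theorem cast_sub_mul_self (x j : ℕ) :
    ((x - j : ℕ) : ℝ) * ((x - j : ℕ) : ℝ) =
      ((x - j : ℕ) : ℝ) * ((x - (j + 1) : ℕ) : ℝ) + ((x - j : ℕ) : ℝ) := by
  norm_cast
  rw [← Nat.sub_sub]
  generalize x - j = k
  cases k with
  | zero => rfl
  | succ k => simp [Nat.mul_succ]

/-- The generating function of the degree increment produced by a layer of type `p` at one of its
nodes, weighted by the layer size. -/
def incElt {A : Type*} [Ring A] [Algebra ℝ A] (s : A) (p : ℕ × ℝ) : A :=
  (p.1 : ℝ) • bernElt s p.2 ^ (p.1 - 1)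

/-- The generating function of the pair of degree increments produced by a layer of type `p`
at the two ends of one of its edges, weighted by the expected number of ordered edges. -/
def pairElt {A : Type*} [Ring A] [Algebra ℝ A] (s₀ s₁ : A) (p : ℕ × ℝ) : A :=
  momFun 2 1 p • (bernElt s₀ p.2 ^ (p.1 - 2) * bernElt s₁ p.2 ^ (p.1 - 2))

theorem size_mul_binE_le {x : ℕ} {y : ℝ} (hy : y ∈ Set.Icc (0 : ℝ) 1) :
    (x : ℝ) * ((1 + ((x - 1 : ℕ) : ℝ) * y) ^ 2 + ((x - 1 : ℕ) : ℝ) * y) ≤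
      momFun 1 0 (x, y) + 4 * momFun 2 1 (x, y) + momFun 3 2 (x, y) := by
  have e2 : (x.descFactorial 2 : ℝ) = ((x - 1 : ℕ) : ℝ) * x := by
    rw [Nat.descFactorial_succ, Nat.descFactorial_one]; push_cast; ring
  have e3 : (x.descFactorial 3 : ℝ) = ((x - 2 : ℕ) : ℝ) * (((x - 1 : ℕ) : ℝ) * x) := by
    rw [Nat.descFactorial_succ, Nat.cast_mul, e2]
  simp only [momFun, e2, e3, Nat.descFactorial_one, pow_zero, mul_one, pow_one]
  have := cast_sub_mul_self x 1
  set a : ℝ := ((x - 1 : ℕ) : ℝ) with ha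
  set b : ℝ := ((x - (1 + 1) : ℕ) : ℝ) with hb
  have ha0 : 0 ≤ a := Nat.cast_nonneg _
  have hy2 : y ^ 2 ≤ y := by nlinarith [hy.1, hy.2]
  have h2 : (x : ℝ) * a * y ^ 2 ≤ x * a * y := mul_le_mul_of_nonneg_left hy2 (by positivity)
  calc (x : ℝ) * ((1 + a * y) ^ 2 + a * y) = x + 3 * (x * a * y) + x * (a * a) * y ^ 2 := by ring
    _ = x + 3 * (x * a * y) + x * a * y ^ 2 + b * (a * x) * y ^ 2 := by rw [this]; ring
    _ ≤ _ := by linarith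

theorem pair_mul_le {x : ℕ} {y : ℝ} (hy : y ∈ Set.Icc (0 : ℝ) 1) :
    momFun 2 1 (x, y) * ((3 + ((x - 2 + (x - 2) : ℕ) : ℝ) * y) ^ 2 +
        ((x - 2 + (x - 2) : ℕ) : ℝ) * y) ≤
      9 * momFun 2 1 (x, y) + 18 * momFun 3 2 (x, y) + 4 * momFun 4 3 (x, y) := by
  have e3 : (x.descFactorial 3 : ℝ) = ((x - 2 : ℕ) : ℝ) * x.descFactorial 2 := by
    rw [Nat.descFactorial_succ, Nat.cast_mul]
  have e4 : (x.descFactorial 4 : ℝ) = ((x - 3 : ℕ) : ℝ) * (((x - 2 : ℕ) : ℝ) * x.descFactorial 2) := by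
    rw [Nat.descFactorial_succ, Nat.cast_mul, e3]
  simp only [momFun, e3, e4, pow_one, Nat.cast_add]
  have := cast_sub_mul_self x 2
  set a : ℝ := ((x - 2 : ℕ) : ℝ) with ha
  set b : ℝ := ((x - (2 + 1) : ℕ) : ℝ) with hb
  set d : ℝ := (x.descFactorial 2 : ℝ)
  have ha0 : 0 ≤ a := Nat.cast_nonneg _
  have hd0 : 0 ≤ d := Nat.cast_nonneg _
  have hy2 : y ^ 3 ≤ y ^ 2 := pow_le_pow_of_le_one hy.1 hy.2 (by norm_num)
  have h2 : d * a * y ^ 3 ≤ d * a * y ^ 2 := mul_le_mul_of_nonneg_left hy2 (by positivity)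
  calc d * y * ((3 + (a + a) * y) ^ 2 + (a + a) * y)
      = 9 * (d * y) + 14 * (a * d * y ^ 2) + 4 * d * (a * a) * y ^ 3 := by ring
    _ = 9 * (d * y) + 14 * (a * d * y ^ 2) + 4 * (d * a * y ^ 3) + 4 * (b * (a * d) * y ^ 3) := by
        rw [this]; ring
    _ ≤ _ := by linarith

section Limit

variable {A : Type*} [NormedCommRing A] [NormedAlgebra ℝ A] [CompleteSpace A]
  {P : Measure (ℕ × ℝ)}

theorem aestronglyMeasurable_of_forall_slice {f : ℕ × ℝ → ℝ}
    (hf : ∀ x, Continuous fun y => f (x, y)) : AEStronglyMeasurable f P :=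
  (continuous_of_forall_slice hf).measurable.aestronglyMeasurable

theorem sum_le_sum_range_of_eq_zero {f : ℕ → ℝ} (hf : ∀ a, 0 ≤ f a) {k : ℕ}
    (hk : ∀ a, k < a → f a = 0) (s : Finset ℕ) : ∑ a ∈ s, f a ≤ ∑ a ∈ Finset.range (k + 1), f a := by
  have hz : ∀ a, a ∉ Finset.range (k + 1) → f a = 0 := fun a ha =>
    hk a (Nat.lt_of_succ_le (not_lt.mp (Finset.mem_range.not.mp ha)))
  have h : HasSum f (∑ a ∈ Finset.range (k + 1), f a) := hasSum_sum_of_ne_finset_zero hz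
  exact sum_le_hasSum s (fun a _ => hf a) h

theorem represents_integral_incElt {s : A} (hs : ∀ i : ℕ, ‖s ^ i‖ ≤ (1 + i : ℝ) ^ 2)
    (hP : ∀ᵐ p ∂P, p.2 ∈ Set.Icc (0 : ℝ) 1) (h10 : Integrable (momFun 1 0) P)
    (h21 : Integrable (momFun 2 1) P) (h32 : Integrable (momFun 3 2) P) :
    Represents (fun i : ℕ => s ^ i) (fun i : ℕ => (1 + i : ℝ) ^ 2)
      (fun a => ∫ p, (p.1 : ℝ) * binP (p.1 - 1) p.2 a ∂P) (∫ p, incElt s p ∂P) := by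
  refine Represents.integral (h := fun p => momFun 1 0 p + 4 * momFun 2 1 p + momFun 3 2 p)
    hs (fun i => ?_) (fun i => ?_) ((h10.add (h21.const_mul 4)).add h32) ?_
  · nlinarith [(Nat.cast_nonneg i : (0 : ℝ) ≤ i)]
  · refine aestronglyMeasurable_of_forall_slice fun x => ?_
    have := continuous_binP (x - 1) i
    simp only
    fun_prop
  · filter_upwards [hP] with p hp
    obtain ⟨x, y⟩ := p
    have hnn : ∀ i, 0 ≤ (x : ℝ) * binP (x - 1) y i := fun i =>
      mul_nonneg (Nat.cast_nonneg _) (binP_nonneg _ hp _)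
    refine ⟨hnn, ?_, fun t => ?_⟩
    · have e : incElt s (x, y) =
          ∑ a ∈ Finset.range (x - 1 + 1), ((x : ℝ) * binP (x - 1) y a) • s ^ a := by
        simp only [incElt, bernElt_pow, Finset.smul_sum, smul_smul]
      rw [e]
      refine hasSum_sum_of_ne_finset_zero fun a ha => ?_
      simp only [Finset.mem_range, not_lt] at ha
      rw [binP_eq_zero_of_lt (by omega), mul_zero, zero_smul]
    · refine (sum_le_sum_range_of_eq_zero (k := x - 1)
        (fun a => mul_nonneg (hnn a) (sq_nonneg _)) (fun a ha => ?_) t).trans ?_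
      · rw [binP_eq_zero_of_lt ha]; ring
      · refine le_trans ?_ (size_mul_binE_le hp)
        have := mul_le_mul_of_nonneg_left (binE_sq_le (x - 1) hp 1) (Nat.cast_nonneg x)
        refine le_trans (le_of_eq ?_) this
        simp only [binE, Finset.mul_sum, mul_assoc]

theorem represents_integral_pairElt {s₀ s₁ : A}
    (hs : ∀ i j : ℕ, ‖s₀ ^ i * s₁ ^ j‖ ≤ (1 + i + j : ℝ) ^ 2)
    (hP : ∀ᵐ p ∂P, p.2 ∈ Set.Icc (0 : ℝ) 1)
    (h21 : Integrable (momFun 2 1) P) (h32 : Integrable (momFun 3 2) P)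
    (h43 : Integrable (momFun 4 3) P) :
    Represents (fun i : ℕ × ℕ => s₀ ^ i.1 * s₁ ^ i.2) (fun i : ℕ × ℕ => (1 + i.1 + i.2 : ℝ) ^ 2)
      (fun a => ∫ p, (p.1.descFactorial 2 : ℝ) * p.2 * binP (p.1 - 2) p.2 a.1 *
        binP (p.1 - 2) p.2 a.2 ∂P) (∫ p, pairElt s₀ s₁ p ∂P) := by
  refine Represents.integral
    (h := fun p => 9 * momFun 2 1 p + 18 * momFun 3 2 p + 4 * momFun 4 3 p)
    (fun i => hs _ _) (fun i => ?_) (fun i => ?_)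
    (((h21.const_mul 9).add (h32.const_mul 18)).add (h43.const_mul 4)) ?_
  · nlinarith [(Nat.cast_nonneg i.1 : (0 : ℝ) ≤ i.1), (Nat.cast_nonneg i.2 : (0 : ℝ) ≤ i.2)]
  · refine aestronglyMeasurable_of_forall_slice fun x => ?_
    have := continuous_binP (x - 2) i.1
    have := continuous_binP (x - 2) i.2
    simp only
    fun_prop
  · filter_upwards [hP] with p hp
    obtain ⟨x, y⟩ := p
    set k := x - 2 with hk
    have hd : 0 ≤ (x.descFactorial 2 : ℝ) * y := mul_nonneg (Nat.cast_nonneg _) hp.1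
    have hnn : ∀ i : ℕ × ℕ, 0 ≤ (x.descFactorial 2 : ℝ) * y * binP k y i.1 * binP k y i.2 :=
      fun i => mul_nonneg (mul_nonneg hd (binP_nonneg _ hp _)) (binP_nonneg _ hp _)
    have hz : ∀ i : ℕ × ℕ, i ∉ Finset.range (k + 1) ×ˢ Finset.range (k + 1) →
        binP k y i.1 * binP k y i.2 = 0 := fun i hi => by
      simp only [Finset.mem_product, Finset.mem_range, not_and_or, not_lt] at hi
      rcases hi with hi | hi
      · rw [binP_eq_zero_of_lt (by omega), zero_mul]
      · rw [binP_eq_zero_of_lt (a := i.2) (by omega), mul_zero]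
    refine ⟨hnn, ?_, fun t => ?_⟩
    · have e : pairElt s₀ s₁ (x, y) =
          ∑ a ∈ Finset.range (k + 1) ×ˢ Finset.range (k + 1),
            ((x.descFactorial 2 : ℝ) * y * binP k y a.1 * binP k y a.2) •
              (s₀ ^ a.1 * s₁ ^ a.2) := by
        simp only [pairElt, bernElt_pow, ← hk, Finset.sum_mul_sum, Finset.smul_sum, momFun, pow_one,
          Finset.sum_product, smul_mul_smul_comm, smul_smul, mul_assoc]
      rw [e]
      refine hasSum_sum_of_ne_finset_zero fun a ha => ?_
      rw [mul_assoc, hz a ha, mul_zero, zero_smul]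
    · set f : ℕ × ℕ → ℝ := fun i => (x.descFactorial 2 : ℝ) * y * binP k y i.1 * binP k y i.2 *
        (1 + i.1 + i.2 : ℝ) ^ 2 with hf
      have hf0 : ∀ i, 0 ≤ f i := fun i => mul_nonneg (hnn i) (sq_nonneg _)
      have hfz : ∀ i, i ∉ Finset.range (k + 1) ×ˢ Finset.range (k + 1) → f i = 0 := fun i hi => by
        simp only [hf, mul_assoc _ (binP k y i.1), hz i hi]; ring
      have h1 : ∑ i ∈ t, f i ≤ ∑ i ∈ Finset.range (k + 1) ×ˢ Finset.range (k + 1), f i := by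
        have h : HasSum f (∑ i ∈ Finset.range (k + 1) ×ˢ Finset.range (k + 1), f i) :=
          hasSum_sum_of_ne_finset_zero hfz
        exact sum_le_hasSum t (fun a _ => hf0 a) h
      refine h1.trans (le_trans ?_ (pair_mul_le hp))
      have h2 := mul_le_mul_of_nonneg_left (binE_binE_sq_le k k hp 1) hd
      calc ∑ i ∈ Finset.range (k + 1) ×ˢ Finset.range (k + 1), f i
          = (x.descFactorial 2 : ℝ) * y *
              binE k y (fun a => binE k y fun b => ((1 : ℝ) + a + b) ^ 2) := by
            simp only [hf, binE, Finset.mul_sum, Finset.sum_product, mul_assoc]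
        _ ≤ _ := h2
        _ ≤ _ := by
            simp only [momFun, pow_one]
            refine mul_le_mul_of_nonneg_left ?_ hd
            have : 0 ≤ ((k + k : ℕ) : ℝ) * y := mul_nonneg (Nat.cast_nonneg _) hp.1
            nlinarith

/-- The weighted series of the limiting bidegree distribution. -/
theorem represents_barf2 {s₀ s₁ : A}
    (hs : ∀ i j : ℕ, ‖s₀ ^ i * s₁ ^ j‖ ≤ (1 + i + j : ℝ) ^ 2)
    (hP : ∀ᵐ p ∂P, p.2 ∈ Set.Icc (0 : ℝ) 1) {mu : ℝ} (hmu : 0 ≤ mu)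
    (h10 : Integrable (momFun 1 0) P) (h21 : Integrable (momFun 2 1) P)
    (h32 : Integrable (momFun 3 2) P) (h43 : Integrable (momFun 4 3) P)
    (h10pos : 0 < mom P 1 0) (h21pos : 0 < mom P 2 1) :
    Represents (fun i : ℕ × ℕ => s₀ ^ i.1 * s₁ ^ i.2) (fun i : ℕ × ℕ => (1 + i.1 + i.2 : ℝ) ^ 2)
      (fun i => barf2 mu P i.1 i.2)
      (s₀ * s₁ * (NormedSpace.exp ((mu * mom P 1 0) • ((mom P 1 0)⁻¹ • ∫ p, incElt s₀ p ∂P - 1)) *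
        NormedSpace.exp ((mu * mom P 1 0) • ((mom P 1 0)⁻¹ • ∫ p, incElt s₁ p ∂P - 1))) *
        ((mom P 2 1)⁻¹ • ∫ p, pairElt s₀ s₁ p ∂P)) := by
  have hs0 : ∀ i : ℕ, ‖s₀ ^ i‖ ≤ (1 + i : ℝ) ^ 2 := fun i => by simpa using hs i 0
  have hs1 : ∀ i : ℕ, ‖s₁ ^ i‖ ≤ (1 + i : ℝ) ^ 2 := fun i => by simpa using hs 0 i
  have hlam : 0 ≤ mu * mom P 1 0 := mul_nonneg hmu h10pos.le
  have hchar : ∀ s : A, (∀ i : ℕ, ‖s ^ i‖ ≤ (1 + i : ℝ) ^ 2) →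
      IsWeightedChar (fun i : ℕ => s ^ i) (fun i : ℕ => (1 + i : ℝ) ^ 2) := fun s h =>
    { map_zero := pow_zero s
      map_add := pow_add s
      norm_le := h
      weight_zero := by norm_num
      weight_add := fun a b => by
        rw [← mul_pow]
        push_cast
        have : (0 : ℝ) ≤ a * b := by positivity
        gcongr
        linarith }
  have hchar2 : IsWeightedChar (fun i : ℕ × ℕ => s₀ ^ i.1 * s₁ ^ i.2)
      (fun i : ℕ × ℕ => (1 + i.1 + i.2 : ℝ) ^ 2) :=
    { map_zero := by simp
      map_add := fun a b => by simp only [Prod.fst_add, Prod.snd_add, pow_add]; ring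
      norm_le := fun a => hs _ _
      weight_zero := by norm_num
      weight_add := fun a b => by
        rw [← mul_pow]
        simp only [Prod.fst_add, Prod.snd_add]
        push_cast
        have : (0 : ℝ) ≤ (a.1 + a.2) * (b.1 + b.2) := by positivity
        gcongr
        linarith }
  have hg : ∀ s : A, (∀ i : ℕ, ‖s ^ i‖ ≤ (1 + i : ℝ) ^ 2) →
      Represents (fun i : ℕ => s ^ i) (fun i : ℕ => (1 + i : ℝ) ^ 2) (barf1 mu P)
        (NormedSpace.exp ((mu * mom P 1 0) • ((mom P 1 0)⁻¹ • ∫ p, incElt s p ∂P - 1))) :=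
    fun s h => by
      have h1 := (represents_integral_incElt h hP h10 h21 h32).const_smul
        (inv_nonneg.mpr h10pos.le)
      have e : (fun a => (mom P 1 0)⁻¹ * ∫ p, (p.1 : ℝ) * binP (p.1 - 1) p.2 a ∂P) = gInc P := by
        funext a; rw [gInc, div_eq_inv_mul]
      rw [e] at h1
      exact represents_cpoi (hchar s h) h1 hlam
  have hprod := Represents.prodMk (W'' := fun i : ℕ × ℕ => (1 + i.1 + i.2 : ℝ) ^ 2)
    (hg s₀ hs0) (hg s₁ hs1) hs0 hs1
    (fun p => sq_nonneg _) (fun p => by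
      rw [← mul_pow]
      have : (0 : ℝ) ≤ (p.1 : ℝ) * p.2 := by positivity
      gcongr
      linarith)
  have hdelta := Represents.single (χ := fun i : ℕ × ℕ => s₀ ^ i.1 * s₁ ^ i.2)
    (W := fun i : ℕ × ℕ => (1 + i.1 + i.2 : ℝ) ^ 2) (1, 1)
  have hpair := (represents_integral_pairElt hs hP h21 h32 h43).const_smul
    (inv_nonneg.mpr h21pos.le)
  have := (Represents.mul hchar2 (Represents.mul hchar2 hdelta hprod).1 hpair).1
  convert this using 1
  · funext q
    rw [barf2, conv2_eq_sum_antidiagonal]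
    refine Finset.sum_congr rfl fun p _ => ?_
    rw [conv2_eq_sum_antidiagonal, f2p, div_eq_inv_mul]
    congr 1
    refine Finset.sum_congr rfl fun r _ => ?_
    congr 1
    simp only [delta11, Prod.ext_iff]
  · simp

end Limit

/-! ### Reduction to finite sums -/

/-- The node set and the edge indicators of a layer. -/
abbrev LayerConfig (n : ℕ) := Finset (Fin n) × (Sym2 (Fin n) → Bool)

instance (n : ℕ) : DiscreteMeasurableSpace (Finset (Fin n)) := ⟨fun _ => trivial⟩

/-- The conditional expectation of `h`, evaluated at the configuration of a layer, given that the
type of the layer is `p`. -/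
def configExp {A : Type*} [NormedAddCommGroup A] [NormedSpace ℝ A] (n : ℕ)
    (h : LayerConfig n → A) (p : ℕ × ℝ) : A :=
  ∑ V, (vertexMeasure n p.1).real {V} • ∑ f, (edgeMeasure n V p.2).real {f} • h (V, f)

theorem measurable_edgeMeasure_singleton (n : ℕ) (V : Finset (Fin n))
    (f : Sym2 (Fin n) → Bool) : Measurable fun y => edgeMeasure n V y {f} := by
  have hb : ∀ b : Bool, Measurable fun y => bern y {b} := fun b => by
    have e : (fun y => bern y {b}) = fun y : ℝ =>
        ((bif b then min (Real.toNNReal y) 1 else 1 - min (Real.toNNReal y) 1 : NNReal) :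
          ℝ≥0∞) := by
      funext y
      rw [bern, PMF.toMeasure_apply_singleton _ _ (measurableSet_singleton b),
        PMF.bernoulli_apply]
    rw [e]
    cases b <;> simp only [cond_true, cond_false] <;> fun_prop
  have e : (fun y => edgeMeasure n V y {f}) = fun y => ∏ e, edgeFactor n V y e {f e} := by
    funext y; rw [edgeMeasure, Measure.pi_singleton]
  rw [e]
  refine Finset.measurable_fun_prod _ fun e _ => ?_
  unfold edgeFactor
  split_ifs
  · exact hb _
  · exact measurable_const

/-- The distribution of a layer of type `xy`. -/
def layerKernel (n : ℕ) (xy : ℕ × ℝ) : Measure (Layer n) :=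
  (vertexMeasure n xy.1).bind fun V => (edgeMeasure n V xy.2).map fun f => (xy, V, f)

theorem layerKernel_apply (n : ℕ) (xy : ℕ × ℝ) {S : Set (Layer n)} (hS : MeasurableSet S) :
    layerKernel n xy S = ∑ V, (∑ f, S.indicator 1 ((xy, V, f) : Layer n) * edgeMeasure n V xy.2 {f}) *
      vertexMeasure n xy.1 {V} := by
  rw [layerKernel, Measure.bind_apply hS (Measurable.of_discrete.aemeasurable), lintegral_fintype]
  refine Finset.sum_congr rfl fun V _ => ?_
  have hg : Measurable fun f : Sym2 (Fin n) → Bool => ((xy, V, f) : Layer n) :=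
    measurable_const.prodMk (measurable_const.prodMk measurable_id)
  rw [← lintegral_indicator_one hS, lintegral_map (measurable_one.indicator hS) hg,
    lintegral_fintype]

theorem measurable_layerKernel (n : ℕ) : Measurable (layerKernel n) := by
  refine Measure.measurable_of_measurable_coe _ fun S hS => ?_
  simp_rw [layerKernel_apply n _ hS]
  refine Finset.measurable_fun_sum _ fun V _ => Measurable.mul (Finset.measurable_sum _ fun f _ =>
    Measurable.mul ?_ ?_) ?_
  · exact (measurable_one.indicator hS).comp (measurable_id.prodMk measurable_const)
  · exact (measurable_edgeMeasure_singleton n V f).comp measurable_snd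
  · exact (Measurable.of_discrete (f := fun x => vertexMeasure n x {V})).comp measurable_fst

theorem layerMeasure_eq_bind (n : ℕ) (Q : Measure (ℕ × ℝ)) :
    layerMeasure n Q = Q.bind (layerKernel n) := rfl

instance (n : ℕ) (Q : Measure (ℕ × ℝ)) [IsProbabilityMeasure Q] :
    IsProbabilityMeasure (layerMeasure n Q) := by
  refine ⟨?_⟩
  rw [layerMeasure_eq_bind, Measure.bind_apply MeasurableSet.univ
    (measurable_layerKernel n).aemeasurable]
  have : ∀ xy, layerKernel n xy Set.univ = 1 := fun xy => by
    rw [layerKernel_apply n xy MeasurableSet.univ]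
    simp [sum_measure_singleton]
  simp [this]

instance (n m : ℕ) (Q : Measure (ℕ × ℝ)) [IsProbabilityMeasure Q] :
    IsProbabilityMeasure (modelMeasure n m Q) := by
  unfold modelMeasure; infer_instance

theorem map_snd_layerMeasure_singleton (n : ℕ) (Q : Measure (ℕ × ℝ)) (c : LayerConfig n) :
    (layerMeasure n Q).map Prod.snd {c} =
      ∫⁻ p, vertexMeasure n p.1 {c.1} * edgeMeasure n c.1 p.2 {c.2} ∂Q := by
  have hS : MeasurableSet (Prod.snd ⁻¹' {c} : Set (Layer n)) :=
    measurable_snd (measurableSet_singleton c)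
  rw [Measure.map_apply measurable_snd (measurableSet_singleton c), layerMeasure_eq_bind,
    Measure.bind_apply hS (measurable_layerKernel n).aemeasurable]
  refine lintegral_congr fun p => ?_
  rw [layerKernel_apply n p hS, Finset.sum_eq_single c.1, Finset.sum_eq_single c.2]
  · rw [Set.indicator_of_mem (by simp), Pi.one_apply, one_mul, mul_comm]
  · intro f _ hf
    rw [Set.indicator_of_notMem (by simp [Prod.ext_iff, hf]), zero_mul]
  · simp
  · intro V _ hV
    rw [Finset.sum_eq_zero, zero_mul]
    intro f _
    rw [Set.indicator_of_notMem (by simp [Prod.ext_iff, hV]), zero_mul]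
  · simp

section

variable {A : Type*} [NormedAddCommGroup A] [NormedSpace ℝ A] [CompleteSpace A]

theorem integral_layerMeasure (n : ℕ) (Q : Measure (ℕ × ℝ)) [IsProbabilityMeasure Q]
    (h : LayerConfig n → A) :
    ∫ L, h L.2 ∂layerMeasure n Q = ∫ p, configExp n h p ∂Q := by
  have : IsProbabilityMeasure ((layerMeasure n Q).map Prod.snd) :=
    Measure.isProbabilityMeasure_map measurable_snd.aemeasurable
  have hm : ∀ c : LayerConfig n, Measurable fun p : ℕ × ℝ =>
      vertexMeasure n p.1 {c.1} * edgeMeasure n c.1 p.2 {c.2} := fun c =>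
    ((Measurable.of_discrete (f := fun x => vertexMeasure n x {c.1})).comp measurable_fst).mul
      ((measurable_edgeMeasure_singleton n c.1 c.2).comp measurable_snd)
  have hle : ∀ (c : LayerConfig n) (p : ℕ × ℝ),
      vertexMeasure n p.1 {c.1} * edgeMeasure n c.1 p.2 {c.2} ≤ 1 := fun c p =>
    mul_le_one' prob_le_one prob_le_one
  have hreal : ∀ c : LayerConfig n, ((layerMeasure n Q).map Prod.snd).real {c} =
      ∫ p, (vertexMeasure n p.1).real {c.1} * (edgeMeasure n c.1 p.2).real {c.2} ∂Q := fun c => by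
    rw [measureReal_def, map_snd_layerMeasure_singleton, ← integral_toReal (hm c).aemeasurable
      (ae_of_all _ fun p => (hle c p).trans_lt ENNReal.one_lt_top)]
    simp [measureReal_def]
  have hint : ∀ c : LayerConfig n, Integrable (fun p : ℕ × ℝ =>
      (vertexMeasure n p.1).real {c.1} * (edgeMeasure n c.1 p.2).real {c.2}) Q := fun c => by
    refine Integrable.of_bound (C := 1) ?_ (ae_of_all _ fun p => ?_)
    · have := (hm c).ennreal_toReal
      simp only [ENNReal.toReal_mul] at this
      exact this.aestronglyMeasurable
    · rw [Real.norm_of_nonneg (by positivity)]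
      exact mul_le_one₀ measureReal_le_one measureReal_nonneg measureReal_le_one
  rw [← integral_map (f := h) measurable_snd.aemeasurable
    Integrable.of_finite.aestronglyMeasurable,
    integral_fintype Integrable.of_finite]
  simp_rw [hreal, ← integral_smul_const]
  rw [← integral_finsetSum _ fun c _ => (hint c).smul_const _]
  refine integral_congr_ae (ae_of_all _ fun p => ?_)
  simp only [configExp]
  rw [Fintype.sum_prod_type]
  simp only [Finset.smul_sum, smul_smul]

end

theorem integral_modelMeasure_prod {A : Type*} [NormedCommRing A] [NormedAlgebra ℝ A]
    [CompleteSpace A] (n m : ℕ) (Q : Measure (ℕ × ℝ)) [IsProbabilityMeasure Q]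
    (h : Fin m → LayerConfig n → A) :
    ∫ ω, ∏ i, h i (ω i).2 ∂modelMeasure n m Q = ∏ i, ∫ p, configExp n (h i) p ∂Q := by
  have hp : IsProbabilityMeasure ((layerMeasure n Q).map Prod.snd) :=
    Measure.isProbabilityMeasure_map measurable_snd.aemeasurable
  have hmap : (modelMeasure n m Q).map (fun ω i => (ω i).2) =
      Measure.pi fun _ => (layerMeasure n Q).map Prod.snd :=
    Measure.pi_map_pi (f := fun _ => Prod.snd) fun _ => measurable_snd.aemeasurable
  have hmeas : Measurable fun (ω : Fin m → Layer n) (i : Fin m) => (ω i).2 :=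
    measurable_pi_lambda _ fun i => measurable_snd.comp (measurable_pi_apply i)
  have h1 : ∫ ω, ∏ i, h i (ω i).2 ∂modelMeasure n m Q =
      ∫ c : Fin m → LayerConfig n, ∏ i, h i (c i)
        ∂(Measure.pi fun _ => (layerMeasure n Q).map Prod.snd) := by
    have : IsProbabilityMeasure ((modelMeasure n m Q).map fun ω i => (ω i).2) :=
      Measure.isProbabilityMeasure_map hmeas.aemeasurable
    rw [← hmap, integral_map hmeas.aemeasurable
      Integrable.of_finite.aestronglyMeasurable]
  rw [h1, integral_fintype Integrable.of_finite]
  have h2 : ∀ i, ∫ p, configExp n (h i) p ∂Q =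
      ∑ c, ((layerMeasure n Q).map Prod.snd).real {c} • h i c := fun i => by
    rw [← integral_layerMeasure, ← integral_map (f := h i) measurable_snd.aemeasurable
      Integrable.of_finite.aestronglyMeasurable,
      integral_fintype Integrable.of_finite]
  simp_rw [h2]
  rw [Finset.prod_univ_sum, Fintype.piFinset_univ]
  refine Finset.sum_congr rfl fun c _ => ?_
  rw [measureReal_def, Measure.pi_singleton, ENNReal.toReal_prod]
  simp only [Algebra.smul_def, Finset.prod_mul_distrib, map_prod, measureReal_def]

/-! ### The law of a layer around two nodes -/

theorem bern_real {y : ℝ} (hy : y ∈ Set.Icc (0 : ℝ) 1) (b : Bool) :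
    (bern y).real {b} = bif b then y else 1 - y := by
  have h1 : Real.toNNReal y ≤ 1 := by simpa using hy.2
  rw [measureReal_def, bern, PMF.toMeasure_apply_singleton _ _ (measurableSet_singleton b),
    PMF.bernoulli_apply]
  simp only [min_eq_left h1]
  cases b
  · rw [cond_false, cond_false, ENNReal.coe_toReal, NNReal.coe_sub h1, Real.coe_toNNReal _ hy.1,
      NNReal.coe_one]
  · simp [hy.1]

theorem sum_vertexMeasure_subset {n x : ℕ} (hx : x ≤ n) (T : Finset (Fin n)) :
    ∑ V, (vertexMeasure n x).real {V} * (if T ⊆ V then 1 else 0) =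
      (x.descFactorial T.card : ℝ) / n.descFactorial T.card := by
  have hcard : (Finset.powersetCard x (Finset.univ : Finset (Fin n))).card = n.choose x := by
    simp
  have hpos : 0 < n.choose x := Nat.choose_pos hx
  have hne : (Finset.powersetCard x (Finset.univ : Finset (Fin n))).Nonempty := by
    rw [← Finset.card_pos, hcard]; exact hpos
  have hreal : ∀ V, (vertexMeasure n x).real {V} =
      if V ∈ Finset.powersetCard x Finset.univ then ((n.choose x : ℕ) : ℝ)⁻¹ else 0 := fun V => by
    rw [measureReal_def, vertexMeasure, dif_pos hne,
      PMF.toMeasure_apply_singleton _ _ (measurableSet_singleton V), PMF.uniformOfFinset_apply,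
      hcard]
    split_ifs <;> simp
  have hT : T.card ≤ n := by simpa using T.card_le_univ
  have hsum : ∑ V, (vertexMeasure n x).real {V} * (if T ⊆ V then 1 else 0) =
      ((Finset.powersetCard x Finset.univ).filter fun V => T ⊆ V).card * ((n.choose x : ℕ) : ℝ)⁻¹ := by
    rw [Finset.card_filter, Nat.cast_sum, Finset.sum_mul]
    simp_rw [hreal]
    rw [← Finset.sum_filter_add_sum_filter_not Finset.univ
      (fun V => V ∈ Finset.powersetCard x Finset.univ), Finset.filter_univ_mem]
    rw [Finset.sum_congr rfl (g := fun V => ((if T ⊆ V then 1 else 0 : ℕ) : ℝ) * ((n.choose x : ℕ) : ℝ)⁻¹)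
      fun V hV => ?_, add_eq_left]
    · refine Finset.sum_eq_zero fun V hV => ?_
      rw [if_neg (Finset.mem_filter.mp hV).2, zero_mul]
    · rw [if_pos hV]; push_cast; ring
  rw [hsum]
  by_cases htx : T.card ≤ x
  · rw [Finset.card_filter_powersetCard_subset T _ x (Finset.subset_univ _) htx, Finset.card_univ,
      Fintype.card_fin]
    have h := Nat.choose_mul (n := n) (k := x) (s := T.card) htx
    have hc : (0 : ℝ) < n.choose T.card := by exact_mod_cast Nat.choose_pos hT
    have hp : (0 : ℝ) < n.choose x := by exact_mod_cast hpos
    have hf : (0 : ℝ) < T.card.factorial := by exact_mod_cast Nat.factorial_pos _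
    have h' : (n.choose x : ℝ) * x.choose T.card = n.choose T.card * (n - T.card).choose (x - T.card) := by
      exact_mod_cast h
    rw [Nat.descFactorial_eq_factorial_mul_choose, Nat.descFactorial_eq_factorial_mul_choose]
    push_cast
    field_simp
    linarith
  · push Not at htx
    rw [Nat.descFactorial_of_lt htx, Finset.filter_eq_empty_iff.mpr]
    · simp
    · intro V hV hTV
      have := Finset.card_le_card hTV
      rw [(Finset.mem_powersetCard.mp hV).2] at this
      omega

theorem card_incident_edges {n : ℕ} (V : Finset (Fin n)) {u v : Fin n} (huv : u ≠ v) :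
    (Finset.univ.filter fun e : Sym2 (Fin n) =>
      (¬ e.IsDiag ∧ ∀ w ∈ e, w ∈ V) ∧ u ∈ e ∧ v ∉ e).card =
      if u ∈ V then (V.erase u).card - (if v ∈ V then 1 else 0) else 0 := by
  have himage : u ∈ V → (Finset.univ.filter fun e : Sym2 (Fin n) =>
      (¬ e.IsDiag ∧ ∀ w ∈ e, w ∈ V) ∧ u ∈ e ∧ v ∉ e) =
      ((V.erase u).erase v).image (Sym2.mkEmbedding u) := fun hu => by
    ext e
    simp only [Finset.mem_filter, Finset.mem_univ, true_and, Finset.mem_image, Finset.mem_erase,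
      Sym2.mkEmbedding_apply]
    constructor
    · rintro ⟨⟨hd, hV⟩, ⟨w, rfl⟩, hv⟩
      refine ⟨w, ⟨?_, ?_, hV w (Sym2.mem_mk_right u w)⟩, rfl⟩
      · rintro rfl; exact hv (Sym2.mem_mk_right u w)
      · rintro rfl; exact hd rfl
    · rintro ⟨w, ⟨hwv, hwu, hw⟩, rfl⟩
      refine ⟨⟨fun h => hwu (Sym2.mk_isDiag_iff.mp h).symm, fun a ha => ?_⟩,
        Sym2.mem_mk_left u w, fun h => ?_⟩
      · rcases Sym2.mem_iff.mp ha with rfl | rfl <;> assumption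
      · rcases Sym2.mem_iff.mp h with h | h
        exacts [huv h.symm, hwv h.symm]
  split_ifs with hu hv
  · rw [himage hu, Finset.card_image_of_injective _ (Sym2.mkEmbedding u).injective,
      Finset.card_erase_of_mem (Finset.mem_erase.mpr ⟨huv.symm, hv⟩)]
  · rw [himage hu, Finset.card_image_of_injective _ (Sym2.mkEmbedding u).injective,
      Finset.erase_eq_of_notMem fun h => hv (Finset.mem_of_mem_erase h), Nat.sub_zero]
  · rw [Finset.card_eq_zero, Finset.filter_eq_empty_iff]
    rintro e _ ⟨⟨_, h⟩, hue, _⟩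
    exact hu (h u hue)

/-- The edge set of a layer configuration. -/
def configEdges {n : ℕ} (c : LayerConfig n) : Finset (Sym2 (Fin n)) :=
  Finset.univ.filter fun e => c.2 e = true ∧ ¬ e.IsDiag ∧ ∀ v ∈ e, v ∈ c.1

section Generating

variable {A : Type*} [NormedCommRing A] [NormedAlgebra ℝ A]

/-- The joint generating monomial of the degrees of `u` and `v` in a layer, multiplied by `z` if the
layer does not link `u` and `v`. -/
def degGen {n : ℕ} (s₀ s₁ z : A) (u v : Fin n) (c : LayerConfig n) : A :=
  (if s(u, v) ∈ configEdges c then 1 else z) *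
    (s₀ ^ ((configEdges c).filter fun e => u ∈ e).card *
      s₁ ^ ((configEdges c).filter fun e => v ∈ e).card)

theorem degGen_eq_prod {n : ℕ} (s₀ s₁ z : A) (u v : Fin n) (c : LayerConfig n) :
    degGen s₀ s₁ z u v c = ∏ e, if e ∈ configEdges c then
      (if u ∈ e then s₀ else 1) * (if v ∈ e then s₁ else 1)
      else if e = s(u, v) then z else 1 := by
  have h : ∀ (s : A) (w : Fin n), s ^ ((configEdges c).filter fun e => w ∈ e).card =
      ∏ e, if e ∈ configEdges c then (if w ∈ e then s else 1) else 1 := fun s w => by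
    rw [Finset.prod_ite_mem, Finset.univ_inter, Finset.prod_ite, Finset.prod_const,
      Finset.prod_const_one, mul_one]
  have h' : (if s(u, v) ∈ configEdges c then 1 else z) =
      ∏ e, if e = s(u, v) then (if s(u, v) ∈ configEdges c then 1 else z) else 1 := by
    rw [Finset.prod_ite_eq']; simp
  rw [degGen, h, h, h', ← Finset.prod_mul_distrib, ← Finset.prod_mul_distrib]
  refine Finset.prod_congr rfl fun e _ => ?_
  by_cases he : e = s(u, v)
  · subst he
    by_cases h2 : s(u, v) ∈ configEdges c <;> simp [h2]
  · by_cases h2 : e ∈ configEdges c <;> simp [h2, he]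

theorem sum_edgeMeasure_degGen {n : ℕ} (s₀ s₁ z : A) {u v : Fin n} (huv : u ≠ v)
    (V : Finset (Fin n)) {y : ℝ} (hy : y ∈ Set.Icc (0 : ℝ) 1) :
    ∑ f, (edgeMeasure n V y).real {f} • degGen s₀ s₁ z u v (V, f) =
      (if u ∈ V ∧ v ∈ V then (1 - y) • z + y • (s₀ * s₁) else z) *
        ((if u ∈ V then bernElt s₀ y ^ (V.card - 1 - (if v ∈ V then 1 else 0)) else 1) *
          (if v ∈ V then bernElt s₁ y ^ (V.card - 1 - (if u ∈ V then 1 else 0)) else 1)) := by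
  set act : Sym2 (Fin n) → Prop := fun e => ¬ e.IsDiag ∧ ∀ w ∈ e, w ∈ V with hact
  set t : Sym2 (Fin n) → Bool → A := fun e b => if b = true ∧ act e then
      (if u ∈ e then s₀ else 1) * (if v ∈ e then s₁ else 1)
      else if e = s(u, v) then z else 1 with ht
  have h1 : ∀ f, degGen s₀ s₁ z u v (V, f) = ∏ e, t e (f e) := fun f => by
    rw [degGen_eq_prod]
    refine Finset.prod_congr rfl fun e _ => ?_
    simp only [ht, hact, configEdges, Finset.mem_filter, Finset.mem_univ, true_and]
  have h2 : ∑ f, (edgeMeasure n V y).real {f} • degGen s₀ s₁ z u v (V, f) =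
      ∏ e, ∑ b, (edgeFactor n V y e).real {b} • t e b := by
    rw [Finset.prod_univ_sum, Fintype.piFinset_univ]
    refine Finset.sum_congr rfl fun f _ => ?_
    rw [h1, measureReal_def, edgeMeasure, Measure.pi_singleton, ENNReal.toReal_prod]
    simp only [Algebra.smul_def, Finset.prod_mul_distrib, map_prod, measureReal_def]
  have h3 : ∀ e, ∑ b, (edgeFactor n V y e).real {b} • t e b =
      (if e = s(u, v) then (if u ∈ V ∧ v ∈ V then (1 - y) • z + y • (s₀ * s₁) else z) else 1) *
      ((if act e ∧ u ∈ e ∧ v ∉ e then bernElt s₀ y else 1) *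
        (if act e ∧ v ∈ e ∧ u ∉ e then bernElt s₁ y else 1)) := fun e => by
    rw [Fintype.sum_bool]
    by_cases ha : act e
    · rw [edgeFactor, if_pos ha, bern_real hy, bern_real hy]
      simp only [ht, ha, and_true, cond_true, cond_false, if_true, true_and, Bool.false_eq_true,
        if_false]
      by_cases he : e = s(u, v)
      · subst he
        have hV : u ∈ V ∧ v ∈ V := ⟨ha.2 u (Sym2.mem_mk_left u v), ha.2 v (Sym2.mem_mk_right u v)⟩
        simp [hV, add_comm]
      · have hnot : ¬ (u ∈ e ∧ v ∈ e) := fun h => he ((Sym2.mem_and_mem_iff huv).mp h)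
        by_cases hu : u ∈ e
        · have hv : v ∉ e := fun h => hnot ⟨hu, h⟩
          simp [he, hu, hv, bernElt, add_comm]
        · by_cases hv : v ∈ e
          · simp [he, hu, hv, bernElt, add_comm]
          · simp only [he, hu, hv, if_false, mul_one, false_and]
            rw [← add_smul]; simp
    · rw [edgeFactor, if_neg ha]
      have hf : ∀ b, (Measure.dirac false : Measure Bool).real {b} = if b = false then 1 else 0 := by
        intro b; cases b <;> simp [measureReal_def]
      rw [hf, hf]
      simp only [ht, ha, and_false, if_false, false_and]
      by_cases he : e = s(u, v)
      · subst he
        have hV : ¬ (u ∈ V ∧ v ∈ V) := fun h => ha ⟨by simpa using huv, by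
          intro w hw
          rcases Sym2.mem_iff.mp hw with rfl | rfl
          exacts [h.1, h.2]⟩
        simp [hV]
      · simp [he]
  have hpow : ∀ (w w' : Fin n) (s : A), w ≠ w' →
      ∏ e, (if act e ∧ w ∈ e ∧ w' ∉ e then bernElt s y else 1) =
        if w ∈ V then bernElt s y ^ (V.card - 1 - (if w' ∈ V then 1 else 0)) else 1 :=
    fun w w' s hw => by
      rw [Finset.prod_ite, Finset.prod_const, Finset.prod_const_one, mul_one,
        card_incident_edges V hw]
      by_cases hV : w ∈ V
      · simp only [hV, if_true]
        rw [Finset.card_erase_of_mem hV]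
      · simp [hV]
  rw [h2, Finset.prod_congr rfl fun e _ => h3 e, Finset.prod_mul_distrib, Finset.prod_mul_distrib,
    hpow u v s₀ huv, hpow v u s₁ huv.symm, Finset.prod_ite_eq']
  simp

theorem configExp_degGen {n : ℕ} (s₀ s₁ z : A) {u v : Fin n} (huv : u ≠ v) {p : ℕ × ℝ}
    (hp : p.1 ≤ n ∧ p.2 ∈ Set.Icc (0 : ℝ) 1) :
    configExp n (degGen s₀ s₁ z u v) p =
      ((p.1.descFactorial 2 : ℝ) / n.descFactorial 2) •
          (((1 - p.2) • z + p.2 • (s₀ * s₁)) *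
            (bernElt s₀ p.2 ^ (p.1 - 2) * bernElt s₁ p.2 ^ (p.1 - 2))) +
        z * (((p.1 : ℝ) / n - (p.1.descFactorial 2 : ℝ) / n.descFactorial 2) •
              (bernElt s₀ p.2 ^ (p.1 - 1) + bernElt s₁ p.2 ^ (p.1 - 1)) +
            (1 - 2 * ((p.1 : ℝ) / n) + (p.1.descFactorial 2 : ℝ) / n.descFactorial 2) • 1) := by
  obtain ⟨x, y⟩ := p
  obtain ⟨hx, hy⟩ := hp
  simp only at hx hy ⊢
  have hU := sum_vertexMeasure_subset hx {u}
  have hV := sum_vertexMeasure_subset hx {v}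
  have hUV := sum_vertexMeasure_subset hx {u, v}
  have h0 := sum_vertexMeasure_subset hx ∅
  rw [Finset.card_pair huv] at hUV
  simp only [Finset.singleton_subset_iff, Finset.card_singleton, Nat.descFactorial_one] at hU hV
  simp only [Finset.insert_subset_iff, Finset.singleton_subset_iff] at hUV
  simp only [Finset.empty_subset, if_true, Finset.card_empty, Nat.descFactorial_zero, Nat.cast_one,
    div_one] at h0
  set B₀ := bernElt s₀ y
  set B₁ := bernElt s₁ y
  set J := ((1 - y) • z + y • (s₀ * s₁)) * (B₀ ^ (x - 2) * B₁ ^ (x - 2)) with hJ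
  have hterm : ∀ V, (vertexMeasure n x).real {V} •
      ∑ f, (edgeMeasure n V y).real {f} • degGen s₀ s₁ z u v (V, f) =
      ((vertexMeasure n x).real {V} * if u ∈ V ∧ v ∈ V then 1 else 0) •
          (J - z * B₀ ^ (x - 1) - z * B₁ ^ (x - 1) + z) +
        ((vertexMeasure n x).real {V} * if u ∈ V then 1 else 0) • (z * B₀ ^ (x - 1) - z) +
        ((vertexMeasure n x).real {V} * if v ∈ V then 1 else 0) • (z * B₁ ^ (x - 1) - z) +
        ((vertexMeasure n x).real {V} * 1) • z := fun V => by
    by_cases hcard : V.card = x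
    · rw [sum_edgeMeasure_degGen s₀ s₁ z huv V hy, hcard]
      have hx2 : x - 1 - 1 = x - 2 := rfl
      by_cases hu : u ∈ V <;> by_cases hv : v ∈ V <;>
        simp only [hu, hv, and_true, and_false, if_true, if_false, mul_one, mul_zero, zero_smul,
          one_mul, hx2, Nat.sub_zero, zero_add, add_zero]
      · rw [← hJ]; module
      · module
      · module
    · have hz : (vertexMeasure n x).real {V} = 0 := by
        rw [measureReal_def, vertexMeasure]
        have hne : (Finset.powersetCard x (Finset.univ : Finset (Fin n))).Nonempty := by
          rw [Finset.powersetCard_nonempty]; simpa using hx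
        rw [dif_pos hne, PMF.toMeasure_apply_singleton _ _ (measurableSet_singleton V),
          PMF.uniformOfFinset_apply, if_neg]
        · simp
        · simpa using hcard
      simp [hz]
  rw [configExp]
  simp only
  rw [Finset.sum_congr rfl fun V _ => hterm V, Finset.sum_add_distrib, Finset.sum_add_distrib,
    Finset.sum_add_distrib, ← Finset.sum_smul, ← Finset.sum_smul, ← Finset.sum_smul,
    ← Finset.sum_smul, hU, hV, hUV, h0]
  simp only [Algebra.smul_def, map_sub, map_add, map_mul, map_one, map_ofNat]
  ring

end Generating

/-! ### Convergence of integrals over layer types -/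

/-- Polynomial dependence on the layer strength. -/
def PolySlices {A : Type*} [NormedCommRing A] [NormedAlgebra ℝ A] (F : ℕ × ℝ → A) : Prop :=
  ∀ x, ∃ q : Polynomial A, ∀ y, F (x, y) = q.eval (algebraMap ℝ A y)

section WeakLimit

variable {A : Type*} [NormedCommRing A] [NormedAlgebra ℝ A]

theorem PolySlices.continuous {F : ℕ × ℝ → A} (hF : PolySlices F) : Continuous F := by
  refine continuous_of_forall_slice fun x => ?_
  obtain ⟨q, hq⟩ := hF x
  simp_rw [hq]
  exact q.continuous.comp (continuous_algebraMap ℝ A)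

theorem PolySlices.aestronglyMeasurable {F : ℕ × ℝ → A} (hF : PolySlices F)
    (ν : Measure (ℕ × ℝ)) : AEStronglyMeasurable F ν :=
  hF.continuous.aestronglyMeasurable

theorem polySlices_momFun (r s : ℕ) : PolySlices (momFun r s) := fun x =>
  ⟨Polynomial.C (x.descFactorial r : ℝ) * Polynomial.X ^ s, fun y => by simp [momFun]⟩

theorem PolySlices.add {F G : ℕ × ℝ → A} (hF : PolySlices F) (hG : PolySlices G) :
    PolySlices fun p => F p + G p := fun x => by
  obtain ⟨q, hq⟩ := hF x
  obtain ⟨r, hr⟩ := hG x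
  exact ⟨q + r, fun y => by rw [Polynomial.eval_add, ← hq, ← hr]⟩

variable [CompleteSpace A]

theorem integrable_slice {ν : Measure (ℕ × ℝ)} [IsProbabilityMeasure ν]
    (hν : ∀ᵐ p ∂ν, p.2 ∈ Set.Icc (0 : ℝ) 1) (x j : ℕ) :
    Integrable (fun p : ℕ × ℝ => if p.1 = x then p.2 ^ j else 0) ν := by
  refine Integrable.of_bound (C := 1) ?_ ?_
  · refine (Measurable.ite ?_ (by fun_prop) measurable_const).aestronglyMeasurable
    exact measurable_fst (measurableSet_singleton x)
  · filter_upwards [hν] with p hp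
    split_ifs
    · rw [Real.norm_of_nonneg (pow_nonneg hp.1 _)]
      exact pow_le_one₀ hp.1 hp.2
    · simp

theorem integral_truncated {F : ℕ × ℝ → A} {q : ℕ → Polynomial A}
    (hq : ∀ x y, F (x, y) = (q x).eval (algebraMap ℝ A y)) (K : ℕ)
    {ν : Measure (ℕ × ℝ)} [IsProbabilityMeasure ν] (hν : ∀ᵐ p ∂ν, p.2 ∈ Set.Icc (0 : ℝ) 1) :
    Integrable (fun p : ℕ × ℝ => if p.1 ≤ K then F p else 0) ν ∧
    ∫ p, (if p.1 ≤ K then F p else 0) ∂ν = ∑ x ∈ Finset.range (K + 1),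
      ∑ j ∈ Finset.range ((q x).natDegree + 1),
        (∫ p, (if p.1 = x then p.2 ^ j else 0) ∂ν) • (q x).coeff j := by
  have e : (fun p : ℕ × ℝ => if p.1 ≤ K then F p else 0) = fun p => ∑ x ∈ Finset.range (K + 1),
      ∑ j ∈ Finset.range ((q x).natDegree + 1), (if p.1 = x then p.2 ^ j else 0) • (q x).coeff j := by
    funext ⟨x, y⟩
    simp only
    split_ifs with h
    · rw [Finset.sum_eq_single_of_mem x (Finset.mem_range.mpr (by omega))]
      · rw [hq, Polynomial.eval_eq_sum_range]
        refine Finset.sum_congr rfl fun j _ => ?_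
        rw [if_pos rfl, Algebra.smul_def, map_pow, mul_comm]
      · intro b _ hb
        exact Finset.sum_eq_zero fun j _ => by rw [if_neg (Ne.symm hb), zero_smul]
    · refine (Finset.sum_eq_zero fun b hb => Finset.sum_eq_zero fun j _ => ?_).symm
      rw [if_neg (by have := Finset.mem_range.mp hb; omega), zero_smul]
  have hi : ∀ x ∈ Finset.range (K + 1), ∀ j ∈ Finset.range ((q x).natDegree + 1),
      Integrable (fun p : ℕ × ℝ => (if p.1 = x then p.2 ^ j else 0) • (q x).coeff j) ν :=
    fun x _ j _ => (integrable_slice hν x j).smul_const _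
  rw [e]
  refine ⟨integrable_finsetSum _ fun x hx => integrable_finsetSum _ fun j hj => hi x hx j hj, ?_⟩
  rw [integral_finsetSum _ fun x hx => integrable_finsetSum _ fun j hj => hi x hx j hj]
  refine Finset.sum_congr rfl fun x hx => ?_
  rw [integral_finsetSum _ fun j hj => hi x hx j hj]
  exact Finset.sum_congr rfl fun j _ => integral_smul_const _ _

variable {Pn : ℕ → ProbabilityMeasure (ℕ × ℝ)} {P : ProbabilityMeasure (ℕ × ℝ)}

theorem tendsto_integral_slice (hw : Tendsto Pn atTop (𝓝 P))
    (hn : ∀ n, ∀ᵐ p ∂(Pn n : Measure (ℕ × ℝ)), p.2 ∈ Set.Icc (0 : ℝ) 1)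
    (hP : ∀ᵐ p ∂(P : Measure (ℕ × ℝ)), p.2 ∈ Set.Icc (0 : ℝ) 1) (x j : ℕ) :
    Tendsto (fun n => ∫ p, (if p.1 = x then p.2 ^ j else 0) ∂(Pn n : Measure (ℕ × ℝ))) atTop
      (𝓝 (∫ p, (if p.1 = x then p.2 ^ j else 0) ∂(P : Measure (ℕ × ℝ)))) := by
  have hc : Continuous fun p : ℕ × ℝ => if p.1 = x then (max 0 (min p.2 1)) ^ j else 0 := by
    refine continuous_of_forall_slice fun x' => ?_
    by_cases h : x' = x <;> simp only [h, if_true, if_false] <;> fun_prop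
  let g : BoundedContinuousFunction (ℕ × ℝ) ℝ :=
    BoundedContinuousFunction.ofNormedAddCommGroup _ hc 1 fun p => by
      split_ifs
      · have h0 : 0 ≤ max 0 (min p.2 1) := le_max_left _ _
        rw [Real.norm_of_nonneg (pow_nonneg h0 _)]
        exact pow_le_one₀ h0 (max_le zero_le_one (min_le_right _ _))
      · simp
  have hg : ∀ p : ℕ × ℝ, p.2 ∈ Set.Icc (0 : ℝ) 1 → g p = if p.1 = x then p.2 ^ j else 0 :=
    fun p hp => by
      change (if p.1 = x then (max 0 (min p.2 1)) ^ j else 0) = _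
      rw [min_eq_left hp.2, max_eq_right hp.1]
  have := (ProbabilityMeasure.tendsto_iff_forall_integral_tendsto.mp hw) g
  refine (this.congr fun n => integral_congr_ae ?_).trans (le_of_eq ?_)
  · filter_upwards [hn n] with p hp using hg p hp
  · congr 1
    refine integral_congr_ae ?_
    filter_upwards [hP] with p hp using hg p hp

theorem tendsto_integral_truncated (hw : Tendsto Pn atTop (𝓝 P))
    (hn : ∀ n, ∀ᵐ p ∂(Pn n : Measure (ℕ × ℝ)), p.2 ∈ Set.Icc (0 : ℝ) 1)
    (hP : ∀ᵐ p ∂(P : Measure (ℕ × ℝ)), p.2 ∈ Set.Icc (0 : ℝ) 1)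
    {F : ℕ × ℝ → A} (hF : PolySlices F) (K : ℕ) :
    Tendsto (fun n => ∫ p, (if p.1 ≤ K then F p else 0) ∂(Pn n : Measure (ℕ × ℝ))) atTop
      (𝓝 (∫ p, (if p.1 ≤ K then F p else 0) ∂(P : Measure (ℕ × ℝ)))) := by
  choose q hq using hF
  rw [(integral_truncated hq K hP).2]
  refine Tendsto.congr (fun n => (integral_truncated hq K (hn n)).2.symm) ?_
  exact tendsto_finsetSum _ fun x _ => tendsto_finsetSum _ fun j _ =>
    (tendsto_integral_slice hw hn hP x j).smul_const _

/-- A nonnegative function whose integrals converge along with the layer types. -/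
structure IsMomentBound (Pn : ℕ → ProbabilityMeasure (ℕ × ℝ)) (P : ProbabilityMeasure (ℕ × ℝ))
    (h : ℕ × ℝ → ℝ) : Prop where
  poly : PolySlices h
  nonneg : ∀ p : ℕ × ℝ, p.2 ∈ Set.Icc (0 : ℝ) 1 → 0 ≤ h p
  integrable : ∀ n, Integrable h (Pn n : Measure (ℕ × ℝ))
  integrable_limit : Integrable h (P : Measure (ℕ × ℝ))
  tendsto : Tendsto (fun n => ∫ p, h p ∂(Pn n : Measure (ℕ × ℝ))) atTop
    (𝓝 (∫ p, h p ∂(P : Measure (ℕ × ℝ))))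

theorem PolySlices.const_mul {h : ℕ × ℝ → ℝ} (hF : PolySlices h) (c : ℝ) :
    PolySlices fun p => c * h p := fun x => by
  obtain ⟨q, hq⟩ := hF x
  exact ⟨Polynomial.C c * q, fun y => by rw [Polynomial.eval_mul, Polynomial.eval_C, ← hq]⟩

theorem IsMomentBound.add {h h' : ℕ × ℝ → ℝ} (hh : IsMomentBound Pn P h)
    (hh' : IsMomentBound Pn P h') : IsMomentBound Pn P fun p => h p + h' p where
  poly := hh.poly.add hh'.poly
  nonneg p hp := add_nonneg (hh.nonneg p hp) (hh'.nonneg p hp)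
  integrable n := (hh.integrable n).add (hh'.integrable n)
  integrable_limit := hh.integrable_limit.add hh'.integrable_limit
  tendsto := by
    rw [integral_add hh.integrable_limit hh'.integrable_limit]
    exact (hh.tendsto.add hh'.tendsto).congr fun n =>
      (integral_add (hh.integrable n) (hh'.integrable n)).symm

theorem IsMomentBound.const_mul {h : ℕ × ℝ → ℝ} (hh : IsMomentBound Pn P h) {c : ℝ} (hc : 0 ≤ c) :
    IsMomentBound Pn P fun p => c * h p where
  poly := hh.poly.const_mul c
  nonneg p hp := mul_nonneg hc (hh.nonneg p hp)
  integrable n := (hh.integrable n).const_mul c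
  integrable_limit := hh.integrable_limit.const_mul c
  tendsto := by
    simp_rw [integral_const_mul]
    exact hh.tendsto.const_mul c

theorem exists_tail_le (hw : Tendsto Pn atTop (𝓝 P))
    (hn : ∀ n, ∀ᵐ p ∂(Pn n : Measure (ℕ × ℝ)), p.2 ∈ Set.Icc (0 : ℝ) 1)
    (hP : ∀ᵐ p ∂(P : Measure (ℕ × ℝ)), p.2 ∈ Set.Icc (0 : ℝ) 1)
    {h : ℕ × ℝ → ℝ} (hh : IsMomentBound Pn P h) {ε : ℝ} (hε : 0 < ε) :
    ∃ K : ℕ, (∫ p, (if p.1 ≤ K then 0 else h p) ∂(P : Measure (ℕ × ℝ)) ≤ ε) ∧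
      ∀ᶠ n in atTop, ∫ p, (if p.1 ≤ K then 0 else h p) ∂(Pn n : Measure (ℕ × ℝ)) ≤ ε := by
  choose q hq using hh.poly
  have hsplit : ∀ (ν : Measure (ℕ × ℝ)) [IsProbabilityMeasure ν],
      (∀ᵐ p ∂ν, p.2 ∈ Set.Icc (0 : ℝ) 1) → Integrable h ν → ∀ K : ℕ,
      ∫ p, (if p.1 ≤ K then 0 else h p) ∂ν =
        ∫ p, h p ∂ν - ∫ p, (if p.1 ≤ K then h p else 0) ∂ν := fun ν _ hν hi K => by
    rw [← integral_sub hi (integral_truncated hq K hν).1]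
    refine integral_congr_ae (ae_of_all _ fun p => ?_)
    simp only
    split_ifs <;> simp
  have hdom : Tendsto (fun K : ℕ => ∫ p, (if p.1 ≤ K then 0 else h p) ∂(P : Measure (ℕ × ℝ)))
      atTop (𝓝 0) := by
    have := tendsto_integral_of_dominated_convergence
      (F := fun (K : ℕ) (p : ℕ × ℝ) => if p.1 ≤ K then 0 else h p) (f := fun _ => 0)
      (μ := (P : Measure (ℕ × ℝ))) (fun p => ‖h p‖)
      (fun K => by
        have : (fun p : ℕ × ℝ => if p.1 ≤ K then 0 else h p) =
            fun p => h p - if p.1 ≤ K then h p else 0 := by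
          funext p; split_ifs <;> simp
        rw [this]
        exact (hh.integrable_limit.sub (integral_truncated hq K hP).1).aestronglyMeasurable)
      hh.integrable_limit.norm
      (fun K => ae_of_all _ fun p => by split_ifs <;> simp)
      (ae_of_all _ fun p => tendsto_const_nhds.congr' (by
        filter_upwards [eventually_ge_atTop p.1] with K hK
        rw [if_pos hK]))
    simpa using this
  obtain ⟨K, hK⟩ := (hdom.eventually_lt_const hε).exists
  refine ⟨K, hK.le, ?_⟩
  have ht : Tendsto (fun n => ∫ p, (if p.1 ≤ K then 0 else h p) ∂(Pn n : Measure (ℕ × ℝ))) atTop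
      (𝓝 (∫ p, (if p.1 ≤ K then 0 else h p) ∂(P : Measure (ℕ × ℝ)))) := by
    rw [hsplit _ hP hh.integrable_limit K]
    refine (hh.tendsto.sub (tendsto_integral_truncated hw hn hP hh.poly K)).congr fun n => ?_
    exact (hsplit _ (hn n) (hh.integrable n) K).symm
  exact (ht.eventually_lt_const hK).mono fun n h => h.le

theorem IsMomentBound.integrable_of_norm_le {ν : Measure (ℕ × ℝ)} {h : ℕ × ℝ → ℝ}
    (hν : ∀ᵐ p ∂ν, p.2 ∈ Set.Icc (0 : ℝ) 1) (hi : Integrable h ν) {F : ℕ × ℝ → A}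
    (hF : PolySlices F) (hle : ∀ p : ℕ × ℝ, p.2 ∈ Set.Icc (0 : ℝ) 1 → ‖F p‖ ≤ h p) :
    Integrable F ν :=
  hi.mono' (hF.aestronglyMeasurable ν) (by filter_upwards [hν] with p hp using hle p hp)

theorem integrable_tail {ν : Measure (ℕ × ℝ)} {h : ℕ × ℝ → ℝ} (hi : Integrable h ν) (K : ℕ) :
    Integrable (fun p : ℕ × ℝ => if p.1 ≤ K then 0 else h p) ν := by
  have hs : MeasurableSet {p : ℕ × ℝ | p.1 ≤ K} := measurableSet_le measurable_fst measurable_const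
  refine (hi.indicator hs.compl).congr (ae_of_all _ fun p => ?_)
  by_cases hp : p.1 ≤ K <;> simp [Set.indicator, hp]

theorem tendsto_integral_of_norm_le (hw : Tendsto Pn atTop (𝓝 P))
    (hn : ∀ n, ∀ᵐ p ∂(Pn n : Measure (ℕ × ℝ)), p.2 ∈ Set.Icc (0 : ℝ) 1)
    (hP : ∀ᵐ p ∂(P : Measure (ℕ × ℝ)), p.2 ∈ Set.Icc (0 : ℝ) 1)
    {h : ℕ × ℝ → ℝ} (hh : IsMomentBound Pn P h) {F : ℕ × ℝ → A} (hF : PolySlices F)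
    (hle : ∀ p : ℕ × ℝ, p.2 ∈ Set.Icc (0 : ℝ) 1 → ‖F p‖ ≤ h p) :
    Tendsto (fun n => ∫ p, F p ∂(Pn n : Measure (ℕ × ℝ))) atTop
      (𝓝 (∫ p, F p ∂(P : Measure (ℕ × ℝ)))) := by
  choose q hq using hF
  have hF : PolySlices F := fun x => ⟨q x, hq x⟩
  have hdiff : ∀ (ν : Measure (ℕ × ℝ)) [IsProbabilityMeasure ν],
      (∀ᵐ p ∂ν, p.2 ∈ Set.Icc (0 : ℝ) 1) → Integrable h ν → ∀ K : ℕ,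
      dist (∫ p, F p ∂ν) (∫ p, (if p.1 ≤ K then F p else 0) ∂ν) ≤
        ∫ p, (if p.1 ≤ K then 0 else h p) ∂ν := fun ν _ hν hi K => by
    rw [dist_eq_norm, ← integral_sub (IsMomentBound.integrable_of_norm_le hν hi hF hle)
      (integral_truncated hq K hν).1]
    refine norm_integral_le_of_norm_le (integrable_tail hi K) ?_
    filter_upwards [hν] with p hp
    split_ifs
    · simp
    · simpa using hle p hp
  rw [Metric.tendsto_nhds]
  intro ε hε
  obtain ⟨K, hK, hK'⟩ := exists_tail_le hw hn hP hh (ε := ε / 4) (by linarith)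
  have ht := (Metric.tendsto_nhds.mp (tendsto_integral_truncated hw hn hP hF K)) (ε / 4)
    (by linarith)
  filter_upwards [hK', ht] with n h1 h2
  have h3 := hdiff _ (hn n) (hh.integrable n) K
  have h4 := hdiff _ hP hh.integrable_limit K
  rw [dist_comm] at h4
  have := dist_triangle4 (∫ p, F p ∂(Pn n : Measure (ℕ × ℝ)))
    (∫ p, (if p.1 ≤ K then F p else 0) ∂(Pn n : Measure (ℕ × ℝ)))
    (∫ p, (if p.1 ≤ K then F p else 0) ∂(P : Measure (ℕ × ℝ))) (∫ p, F p ∂(P : Measure (ℕ × ℝ)))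
  linarith

theorem tendsto_integral_zero (hw : Tendsto Pn atTop (𝓝 P))
    (hn : ∀ n, ∀ᵐ p ∂(Pn n : Measure (ℕ × ℝ)), p.2 ∈ Set.Icc (0 : ℝ) 1)
    (hP : ∀ᵐ p ∂(P : Measure (ℕ × ℝ)), p.2 ∈ Set.Icc (0 : ℝ) 1)
    {h : ℕ × ℝ → ℝ} (hh : IsMomentBound Pn P h) {F : ℕ → ℕ × ℝ → A}
    (hle : ∀ n, ∀ᵐ p ∂(Pn n : Measure (ℕ × ℝ)), ‖F n p‖ ≤ h p)
    (hunif : ∀ K : ℕ, ∃ d : ℕ → ℝ, (∀ n, 0 ≤ d n) ∧ Tendsto d atTop (𝓝 0) ∧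
      ∀ n, ∀ᵐ p ∂(Pn n : Measure (ℕ × ℝ)), p.1 ≤ K → ‖F n p‖ ≤ d n) :
    Tendsto (fun n => ∫ p, F n p ∂(Pn n : Measure (ℕ × ℝ))) atTop (𝓝 0) := by
  rw [Metric.tendsto_nhds]
  intro ε hε
  obtain ⟨K, -, hK⟩ := exists_tail_le hw hn hP hh (ε := ε / 4) (by linarith)
  obtain ⟨d, hd0, hd, hF⟩ := hunif K
  filter_upwards [hK, hd.eventually_lt_const (show (0 : ℝ) < ε / 4 by linarith)] with n h1 h2
  rw [dist_zero_right]
  have h3 : ‖∫ p, F n p ∂(Pn n : Measure (ℕ × ℝ))‖ ≤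
      ∫ p, (d n + if p.1 ≤ K then 0 else h p) ∂(Pn n : Measure (ℕ × ℝ)) := by
    refine norm_integral_le_of_norm_le
      ((integrable_const _).add (integrable_tail (hh.integrable n) K)) ?_
    filter_upwards [hle n, hF n] with p h4 h5
    split_ifs with hp
    · simpa using h5 hp
    · linarith [hd0 n]
  rw [integral_add (integrable_const _) (integrable_tail (hh.integrable n) K)] at h3
  simp only [integral_const, probReal_univ, one_smul] at h3
  linarith

end WeakLimit

/-! ### Generating functions of a single layer -/

/-- Layer type distributions converging together with their cross moments. -/
structure LayerLimit (Pn : ℕ → ProbabilityMeasure (ℕ × ℝ)) (P : ProbabilityMeasure (ℕ × ℝ)) :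
    Prop where
  weak : Tendsto Pn atTop (𝓝 P)
  supp : ∀ n, ∀ᵐ p ∂(Pn n : Measure (ℕ × ℝ)), p.1 ≤ n ∧ p.2 ∈ Set.Icc (0 : ℝ) 1
  supp_limit : ∀ᵐ p ∂(P : Measure (ℕ × ℝ)), p.2 ∈ Set.Icc (0 : ℝ) 1
  bound10 : IsMomentBound Pn P (momFun 1 0)
  bound21 : IsMomentBound Pn P (momFun 2 1)
  bound32 : IsMomentBound Pn P (momFun 3 2)
  bound43 : IsMomentBound Pn P (momFun 4 3)
  pos10 : 0 < mom (P : Measure (ℕ × ℝ)) 1 0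
  pos21 : 0 < mom (P : Measure (ℕ × ℝ)) 2 1

theorem LayerLimit.strength {Pn : ℕ → ProbabilityMeasure (ℕ × ℝ)}
    {P : ProbabilityMeasure (ℕ × ℝ)} (hL : LayerLimit Pn P) (n : ℕ) :
    ∀ᵐ p ∂(Pn n : Measure (ℕ × ℝ)), p.2 ∈ Set.Icc (0 : ℝ) 1 := (hL.supp n).mono fun _ h => h.2

section PolySlicesAlgebra

variable {A : Type*} [NormedCommRing A] [NormedAlgebra ℝ A] {F G : ℕ × ℝ → A}

theorem PolySlices.mul (hF : PolySlices F) (hG : PolySlices G) :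
    PolySlices fun p => F p * G p := fun x => by
  obtain ⟨q, hq⟩ := hF x
  obtain ⟨r, hr⟩ := hG x
  exact ⟨q * r, fun y => by rw [Polynomial.eval_mul, ← hq, ← hr]⟩

theorem polySlices_fst (c : ℕ → A) : PolySlices fun p => c p.1 := fun x =>
  ⟨Polynomial.C (c x), fun y => by simp⟩

theorem polySlices_snd : PolySlices fun p : ℕ × ℝ => algebraMap ℝ A p.2 := fun _ =>
  ⟨Polynomial.X, fun y => by simp⟩

theorem PolySlices.smul (hF : PolySlices F) (c : ℕ → ℝ) : PolySlices fun p => c p.1 • F p := by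
  simp_rw [Algebra.smul_def]
  exact (polySlices_fst fun x => algebraMap ℝ A (c x)).mul hF

theorem PolySlices.sub (hF : PolySlices F) (hG : PolySlices G) :
    PolySlices fun p => F p - G p := by
  have := hF.add (hG.smul fun _ => -1)
  simpa [sub_eq_add_neg] using this

theorem PolySlices.pow (hF : PolySlices F) (k : ℕ → ℕ) : PolySlices fun p => F p ^ k p.1 :=
  fun x => by
    obtain ⟨q, hq⟩ := hF x
    exact ⟨q ^ k x, fun y => by rw [Polynomial.eval_pow, ← hq]⟩

theorem polySlices_bernElt (s : A) : PolySlices fun p : ℕ × ℝ => bernElt s p.2 := by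
  have : PolySlices fun p : ℕ × ℝ => (1 : A) + algebraMap ℝ A p.2 * (s - 1) :=
    (polySlices_fst fun _ => 1).add (polySlices_snd.mul (polySlices_fst fun _ => s - 1))
  convert this using 2 with p
  simp only [bernElt, Algebra.smul_def, map_sub, map_one]
  ring

end PolySlicesAlgebra

section LayerGen

variable {A : Type*} [NormedCommRing A] [NormedAlgebra ℝ A]

/-- The generating function of the pair of degrees of two nodes in a layer of type `p`, the
linked pairs being weighted by `1` and the others by `z`. -/
def layerGen (n : ℕ) (s₀ s₁ z : A) (p : ℕ × ℝ) : A :=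
  ((p.1.descFactorial 2 : ℝ) / n.descFactorial 2) •
      (((1 - p.2) • z + p.2 • (s₀ * s₁)) *
        (bernElt s₀ p.2 ^ (p.1 - 2) * bernElt s₁ p.2 ^ (p.1 - 2))) +
    z * (((p.1 : ℝ) / n - (p.1.descFactorial 2 : ℝ) / n.descFactorial 2) •
          (bernElt s₀ p.2 ^ (p.1 - 1) + bernElt s₁ p.2 ^ (p.1 - 1)) +
        (1 - 2 * ((p.1 : ℝ) / n) + (p.1.descFactorial 2 : ℝ) / n.descFactorial 2) • 1)

/-- The excess degree generating function at one node of a layer. -/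
def excessElt (s : A) (p : ℕ × ℝ) : A := (p.1 : ℝ) • (bernElt s p.2 ^ (p.1 - 1) - 1)

/-- The correction caused by layers containing both nodes. -/
def jointElt (s₀ s₁ : A) (p : ℕ × ℝ) : A :=
  ((1 - p.2) • 1 + p.2 • (s₀ * s₁)) *
      (bernElt s₀ p.2 ^ (p.1 - 2) * bernElt s₁ p.2 ^ (p.1 - 2)) + 1 -
    bernElt s₀ p.2 ^ (p.1 - 1) - bernElt s₁ p.2 ^ (p.1 - 1)

theorem layerGen_one {n : ℕ} (hn : n ≠ 0) (s₀ s₁ : A) (p : ℕ × ℝ) :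
    layerGen n s₀ s₁ 1 p = 1 + (1 / (n : ℝ)) • (excessElt s₀ p + excessElt s₁ p +
      (n * ((p.1.descFactorial 2 : ℝ) / n.descFactorial 2)) • jointElt s₀ s₁ p) := by
  have hn' : (n : ℝ) ≠ 0 := by exact_mod_cast hn
  have e : ∀ c : ℝ, 1 / (n : ℝ) * (n * c) = c := fun c => by field_simp
  rw [smul_add, smul_smul, e]
  simp only [layerGen, excessElt, smul_add, smul_smul, one_div_mul_eq_div]
  rw [jointElt]
  generalize ((1 - p.2) • (1 : A) + p.2 • (s₀ * s₁)) *
    (bernElt s₀ p.2 ^ (p.1 - 2) * bernElt s₁ p.2 ^ (p.1 - 2)) = J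
  simp only [one_mul]
  module

theorem layerGen_zero (n : ℕ) (s₀ s₁ : A) (p : ℕ × ℝ) :
    layerGen n s₀ s₁ 0 p = (n.descFactorial 2 : ℝ)⁻¹ • (s₀ * s₁ * pairElt s₀ s₁ p) := by
  simp only [layerGen, pairElt, smul_zero, zero_add, zero_mul, add_zero, momFun, pow_one,
    smul_mul_assoc, mul_smul_comm, smul_smul]
  congr 1
  ring

theorem polySlices_excessElt (s : A) : PolySlices (excessElt s) :=
  (((polySlices_bernElt s).pow fun x => x - 1).sub (polySlices_fst fun _ => 1)).smul fun x => x

theorem polySlices_pairElt (s₀ s₁ : A) : PolySlices (pairElt s₀ s₁) := by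
  have := (polySlices_snd (A := A)).mul
    (((polySlices_bernElt s₀).pow fun x => x - 2).mul ((polySlices_bernElt s₁).pow fun x => x - 2))
  convert this.smul fun x => (x.descFactorial 2 : ℝ) using 2 with p
  simp only [pairElt, momFun, pow_one, Algebra.smul_def, map_mul, mul_assoc]

theorem polySlices_jointElt (s₀ s₁ : A) : PolySlices (jointElt s₀ s₁) := by
  have := (((polySlices_bernElt (s₀ * s₁)).mul
    (((polySlices_bernElt s₀).pow fun x => x - 2).mul
      ((polySlices_bernElt s₁).pow fun x => x - 2))).add (polySlices_fst fun _ => 1)).sub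
    ((polySlices_bernElt s₀).pow fun x => x - 1)
  exact this.sub ((polySlices_bernElt s₁).pow fun x => x - 1)

variable {s₀ s₁ : A}

theorem cast_descFactorial_two (x : ℕ) :
    (x.descFactorial 2 : ℝ) = ((x - 1 : ℕ) : ℝ) * x := by
  rw [Nat.descFactorial_succ, Nat.descFactorial_one]; push_cast; ring

theorem size_mul_excess_le {x : ℕ} {y : ℝ} (hy : y ∈ Set.Icc (0 : ℝ) 1) :
    (x : ℝ) * (((x - 1 : ℕ) : ℝ) ^ 2 * y ^ 2 + 5 * ((x - 1 : ℕ) : ℝ) * y) ≤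
      momFun 3 2 (x, y) + 6 * momFun 2 1 (x, y) := by
  have e3 : (x.descFactorial 3 : ℝ) = ((x - 2 : ℕ) : ℝ) * (((x - 1 : ℕ) : ℝ) * x) := by
    rw [Nat.descFactorial_succ]; push_cast; rw [cast_descFactorial_two]
  have h := cast_sub_mul_self x 1
  simp only [momFun, cast_descFactorial_two, e3, pow_one]
  have hz : (0 : ℝ) ≤ ((x - 1 : ℕ) : ℝ) * x := by positivity
  have h2 : y ^ 2 ≤ y := by nlinarith [hy.1, hy.2]
  have h3 : (x : ℝ) * (((x - 1 : ℕ) : ℝ) ^ 2 * y ^ 2) =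
      ((x - 2 : ℕ) : ℝ) * (((x - 1 : ℕ) : ℝ) * x) * y ^ 2 + ((x - 1 : ℕ) : ℝ) * x * y ^ 2 := by
    rw [sq ((x - 1 : ℕ) : ℝ), h]; ring
  nlinarith [mul_le_mul_of_nonneg_left h2 hz]

theorem norm_bernElt_pow_sub_one_le_left
    (hs : ∀ i j : ℕ, ‖s₀ ^ i * s₁ ^ j‖ ≤ (1 + i + j : ℝ) ^ 2)
    {y : ℝ} (hy : y ∈ Set.Icc (0 : ℝ) 1) (k : ℕ) :
    ‖bernElt s₀ y ^ k - 1‖ ≤ (k : ℝ) ^ 2 * y ^ 2 + 5 * k * y := by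
  simpa using norm_bernElt_pow_sub_one_le hs hy k 0

theorem norm_excessElt_le (hs : ∀ i j : ℕ, ‖s₀ ^ i * s₁ ^ j‖ ≤ (1 + i + j : ℝ) ^ 2)
    {p : ℕ × ℝ} (hp : p.2 ∈ Set.Icc (0 : ℝ) 1) :
    ‖excessElt s₀ p‖ ≤ momFun 3 2 p + 6 * momFun 2 1 p := by
  rw [excessElt, norm_smul, Real.norm_of_nonneg (Nat.cast_nonneg _)]
  exact (mul_le_mul_of_nonneg_left (norm_bernElt_pow_sub_one_le_left hs hp _)
    (Nat.cast_nonneg _)).trans (size_mul_excess_le hp)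

theorem norm_pairElt_le (hs : ∀ i j : ℕ, ‖s₀ ^ i * s₁ ^ j‖ ≤ (1 + i + j : ℝ) ^ 2)
    {p : ℕ × ℝ} (hp : p.2 ∈ Set.Icc (0 : ℝ) 1) :
    ‖pairElt s₀ s₁ p‖ ≤ 9 * momFun 2 1 p + 18 * momFun 3 2 p + 4 * momFun 4 3 p := by
  obtain ⟨x, y⟩ := p
  rw [pairElt, norm_smul, Real.norm_of_nonneg (momFun_nonneg _ _ hp)]
  refine le_trans (mul_le_mul_of_nonneg_left ?_ (momFun_nonneg _ _ hp)) (pair_mul_le hp)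
  refine (le_trans (by simp) (norm_mul_bernElt_pow_le hs hp (x - 2) (x - 2) 0 0)).trans ?_
  have : (0 : ℝ) ≤ ((x - 2 + (x - 2) : ℕ) : ℝ) * y := mul_nonneg (Nat.cast_nonneg _) hp.1
  simp only [Nat.cast_zero, add_zero]
  gcongr
  norm_num

theorem norm_jointElt_le (hs : ∀ i j : ℕ, ‖s₀ ^ i * s₁ ^ j‖ ≤ (1 + i + j : ℝ) ^ 2)
    {p : ℕ × ℝ} (hp : p.2 ∈ Set.Icc (0 : ℝ) 1) :
    ‖jointElt s₀ s₁ p‖ ≤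
      40 * (((p.1 - 1 : ℕ) : ℝ) ^ 2 * p.2 ^ 2 + ((p.1 - 1 : ℕ) : ℝ) * p.2 + p.2) := by
  obtain ⟨x, y⟩ := p
  simp only at hp ⊢
  have hs' : ∀ i j : ℕ, ‖s₁ ^ i * s₀ ^ j‖ ≤ (1 + i + j : ℝ) ^ 2 := fun i j => by
    rw [mul_comm]; exact (hs j i).trans (le_of_eq (by ring))
  set k := x - 2 with hk
  set B₀ := bernElt s₀ y
  set B₁ := bernElt s₁ y
  have h1 := norm_bernElt_pow_sub_one_le hs hp k k
  have h2 := norm_mul_bernElt_pow_le hs hp k k 1 1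
  have h3 := norm_mul_bernElt_pow_le hs hp k k 0 0
  have h4 := norm_bernElt_pow_sub_one_le_left hs hp (x - 1)
  have h5 := norm_bernElt_pow_sub_one_le_left hs' hp (x - 1)
  have e : jointElt s₀ s₁ (x, y) = (B₀ ^ k * B₁ ^ k - 1) +
      y • (s₀ ^ 1 * s₁ ^ 1 * (B₀ ^ k * B₁ ^ k) - s₀ ^ 0 * s₁ ^ 0 * (B₀ ^ k * B₁ ^ k)) -
      (B₀ ^ (x - 1) - 1) - (B₁ ^ (x - 1) - 1) := by
    simp only [jointElt, ← hk, pow_one, pow_zero, Algebra.smul_def, map_sub, map_one]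
    ring
  rw [e]
  have h6 : ‖y • (s₀ ^ 1 * s₁ ^ 1 * (B₀ ^ k * B₁ ^ k) - s₀ ^ 0 * s₁ ^ 0 * (B₀ ^ k * B₁ ^ k))‖ ≤
      y * (((1 + (1 : ℕ) + (1 : ℕ) + (k + k : ℕ) * y) ^ 2 + (k + k : ℕ) * y) +
        ((1 + (0 : ℕ) + (0 : ℕ) + (k + k : ℕ) * y) ^ 2 + (k + k : ℕ) * y)) := by
    rw [norm_smul, Real.norm_of_nonneg hp.1]
    exact mul_le_mul_of_nonneg_left ((norm_sub_le _ _).trans (add_le_add h2 h3)) hp.1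
  refine (norm_sub_le _ _).trans ((add_le_add ((norm_sub_le _ _).trans
    (add_le_add ((norm_add_le _ _).trans (add_le_add h1 h6)) h4)) h5).trans ?_)
  · have hkx : (k : ℝ) ≤ ((x - 1 : ℕ) : ℝ) := by exact_mod_cast (by omega : k ≤ x - 1)
    push_cast
    generalize ((x - 1 : ℕ) : ℝ) = K at *
    have hk0 : (0 : ℝ) ≤ k := Nat.cast_nonneg _
    have hy0 := hp.1
    have a1 : (k : ℝ) * y ≤ K * y := mul_le_mul_of_nonneg_right hkx hy0
    have a2 : (k : ℝ) ^ 2 * y ^ 2 ≤ K ^ 2 * y ^ 2 := by gcongr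
    have a3 : (k : ℝ) ^ 2 * y ^ 2 * y ≤ (k : ℝ) ^ 2 * y ^ 2 :=
      mul_le_of_le_one_right (by positivity) hp.2
    have a4 : (k : ℝ) * y * y ≤ (k : ℝ) * y := mul_le_of_le_one_right (by positivity) hp.2
    nlinarith

variable [CompleteSpace A] {Pn : ℕ → ProbabilityMeasure (ℕ × ℝ)}
  {P : ProbabilityMeasure (ℕ × ℝ)}

theorem LayerLimit.tendsto_integral_excessElt (hL : LayerLimit Pn P)
    (hs : ∀ i j : ℕ, ‖s₀ ^ i * s₁ ^ j‖ ≤ (1 + i + j : ℝ) ^ 2) :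
    Tendsto (fun n => ∫ p, excessElt s₀ p ∂(Pn n : Measure (ℕ × ℝ))) atTop
      (𝓝 (∫ p, excessElt s₀ p ∂(P : Measure (ℕ × ℝ)))) :=
  tendsto_integral_of_norm_le hL.weak hL.strength hL.supp_limit
    (hL.bound32.add (hL.bound21.const_mul (c := 6) (by norm_num))) (polySlices_excessElt s₀)
    fun _ hp => norm_excessElt_le hs hp

theorem LayerLimit.tendsto_integral_pairElt (hL : LayerLimit Pn P)
    (hs : ∀ i j : ℕ, ‖s₀ ^ i * s₁ ^ j‖ ≤ (1 + i + j : ℝ) ^ 2) :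
    Tendsto (fun n => ∫ p, pairElt s₀ s₁ p ∂(Pn n : Measure (ℕ × ℝ))) atTop
      (𝓝 (∫ p, pairElt s₀ s₁ p ∂(P : Measure (ℕ × ℝ)))) :=
  tendsto_integral_of_norm_le hL.weak hL.strength hL.supp_limit
    (((hL.bound21.const_mul (c := 9) (by norm_num)).add
      (hL.bound32.const_mul (c := 18) (by norm_num))).add
      (hL.bound43.const_mul (c := 4) (by norm_num))) (polySlices_pairElt s₀ s₁)
    fun _ hp => norm_pairElt_le hs hp

theorem joint_factor_eq {n : ℕ} (hn : 2 ≤ n) (x : ℕ) :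
    (n : ℝ) * ((x.descFactorial 2 : ℝ) / n.descFactorial 2) =
      (x.descFactorial 2 : ℝ) / ((n - 1 : ℕ) : ℝ) := by
  rw [cast_descFactorial_two n]
  have h1 : ((n - 1 : ℕ) : ℝ) ≠ 0 := by exact_mod_cast (by omega : n - 1 ≠ 0)
  have h2 : (n : ℝ) ≠ 0 := by exact_mod_cast (by omega : n ≠ 0)
  field_simp

theorem norm_joint_le {n : ℕ} {p : ℕ × ℝ}
    (hs : ∀ i j : ℕ, ‖s₀ ^ i * s₁ ^ j‖ ≤ (1 + i + j : ℝ) ^ 2)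
    (hp : p.1 ≤ n ∧ p.2 ∈ Set.Icc (0 : ℝ) 1) :
    ‖((n : ℝ) * ((p.1.descFactorial 2 : ℝ) / n.descFactorial 2)) • jointElt s₀ s₁ p‖ ≤
      40 * (momFun 3 2 p + 3 * momFun 2 1 p) := by
  obtain ⟨x, y⟩ := p
  obtain ⟨hx, hy⟩ := hp
  simp only at hx hy
  have hy0 := hy.1
  have hb : 0 ≤ 40 * (momFun 3 2 (x, y) + 3 * momFun 2 1 (x, y)) := by
    have := momFun_nonneg 3 2 (p := (x, y)) hy
    have := momFun_nonneg 2 1 (p := (x, y)) hy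
    positivity
  rcases Nat.lt_or_ge x 2 with hx2 | hx2
  · rw [Nat.descFactorial_of_lt hx2]
    simpa using hb
  have hn2 : 2 ≤ n := hx2.trans hx
  rw [joint_factor_eq hn2, norm_smul, Real.norm_of_nonneg (by positivity)]
  have h1 : (1 : ℝ) ≤ ((n - 1 : ℕ) : ℝ) := by exact_mod_cast (by omega : 1 ≤ n - 1)
  have h2 : ((x - 1 : ℕ) : ℝ) ≤ ((n - 1 : ℕ) : ℝ) := by exact_mod_cast (by omega : x - 1 ≤ n - 1)
  refine (mul_le_mul_of_nonneg_left (norm_jointElt_le hs hy) (by positivity)).trans ?_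
  simp only
  rw [div_mul_eq_mul_div, div_le_iff₀ (by linarith)]
  have e3 : (x.descFactorial 3 : ℝ) = ((x - 2 : ℕ) : ℝ) * (((x - 1 : ℕ) : ℝ) * x) := by
    rw [Nat.descFactorial_succ]; push_cast; rw [cast_descFactorial_two]
  have h := cast_sub_mul_self x 1
  simp only [momFun, cast_descFactorial_two, e3, pow_one]
  have hz : (0 : ℝ) ≤ ((x - 1 : ℕ) : ℝ) * x * y := by positivity
  have hyy : y * y ≤ y := by nlinarith [hy.2]
  have b1 : ((x - 1 : ℕ) : ℝ) * x * (((x - 1 : ℕ) : ℝ) ^ 2 * y ^ 2) ≤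
      ((x - 2 : ℕ) * (((x - 1 : ℕ) : ℝ) * x) * y ^ 2 + ((x - 1 : ℕ) : ℝ) * x * y) *
        ((n - 1 : ℕ) : ℝ) := by
    have : ((x - 1 : ℕ) : ℝ) * x * (((x - 1 : ℕ) : ℝ) ^ 2 * y ^ 2) =
        ((x - 2 : ℕ) * (((x - 1 : ℕ) : ℝ) * x) * y ^ 2 + ((x - 1 : ℕ) : ℝ) * x * (y * y)) *
          ((x - 1 : ℕ) : ℝ) := by
      rw [sq ((x - 1 : ℕ) : ℝ), h]; ring
    rw [this]
    gcongr
  have b2 := mul_le_mul_of_nonneg_left h2 hz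
  have b3 := mul_le_mul_of_nonneg_left h1 hz
  linarith

theorem LayerLimit.tendsto_integral_joint (hL : LayerLimit Pn P)
    (hs : ∀ i j : ℕ, ‖s₀ ^ i * s₁ ^ j‖ ≤ (1 + i + j : ℝ) ^ 2) :
    Tendsto (fun n : ℕ => ∫ p, ((n : ℝ) * ((p.1.descFactorial 2 : ℝ) / n.descFactorial 2)) •
      jointElt s₀ s₁ p ∂(Pn n : Measure (ℕ × ℝ))) atTop (𝓝 0) := by
  refine tendsto_integral_zero hL.weak hL.strength hL.supp_limit
    ((hL.bound32.add (hL.bound21.const_mul (c := 3) (by norm_num))).const_mul (c := 40)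
      (by norm_num)) (fun n => (hL.supp n).mono fun p hp => norm_joint_le hs hp) fun K => ?_
  refine ⟨fun n => if 2 ≤ n then (K * K * (40 * (K ^ 2 + K + 1)) : ℝ) / ((n - 1 : ℕ) : ℝ) else 0,
    fun n => by simp only; split_ifs <;> positivity, ?_, fun n => ?_⟩
  · have h1 : Tendsto (fun n : ℕ => (K * K * (40 * (K ^ 2 + K + 1)) : ℝ) / ((n - 1 : ℕ) : ℝ))
        atTop (𝓝 0) := (tendsto_const_nhds (x := (K * K * (40 * (K ^ 2 + K + 1)) : ℝ))).div_atTop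
      (tendsto_natCast_atTop_atTop.comp (tendsto_sub_atTop_nat 1))
    refine h1.congr' ?_
    filter_upwards [eventually_ge_atTop 2] with n hn
    rw [if_pos hn]
  · filter_upwards [hL.supp n] with ⟨x, y⟩ ⟨hx, hy⟩ hK
    simp only at hx hy hK ⊢
    split_ifs with hn
    · rw [joint_factor_eq hn, norm_smul, Real.norm_of_nonneg (by positivity), div_mul_eq_mul_div]
      have h1 : ((x - 1 : ℕ) : ℝ) ≤ K := by exact_mod_cast (by omega : x - 1 ≤ K)
      have h2 : (x : ℝ) ≤ K := by exact_mod_cast hK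
      have h3 := norm_jointElt_le (p := (x, y)) hs hy
      simp only at h3
      have hy0 := hy.1
      have hy1 := hy.2
      rw [cast_descFactorial_two]
      gcongr
      refine h3.trans ?_
      have h4 : y ^ 2 ≤ 1 := pow_le_one₀ hy0 hy1
      have h5 : ((x - 1 : ℕ) : ℝ) ^ 2 * y ^ 2 ≤ K ^ 2 * 1 := by gcongr
      have h6 : ((x - 1 : ℕ) : ℝ) * y ≤ K * 1 := by gcongr
      linarith
    · rw [Nat.descFactorial_of_lt (by omega : x < 2)]
      simp

/-- The rescaled deviation of the layer generating function from `1`. -/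
def layerRate (n : ℕ) (s₀ s₁ : A) (p : ℕ × ℝ) : A :=
  excessElt s₀ p + excessElt s₁ p +
    ((n : ℝ) * ((p.1.descFactorial 2 : ℝ) / n.descFactorial 2)) • jointElt s₀ s₁ p

theorem LayerLimit.integral_layerRate (hL : LayerLimit Pn P)
    (hs : ∀ i j : ℕ, ‖s₀ ^ i * s₁ ^ j‖ ≤ (1 + i + j : ℝ) ^ 2) (n : ℕ) :
    Integrable (layerRate n s₀ s₁) (Pn n : Measure (ℕ × ℝ)) ∧
    ∫ p, layerRate n s₀ s₁ p ∂(Pn n : Measure (ℕ × ℝ)) =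
      ∫ p, excessElt s₀ p ∂(Pn n : Measure (ℕ × ℝ)) +
      ∫ p, excessElt s₁ p ∂(Pn n : Measure (ℕ × ℝ)) +
      ∫ p, ((n : ℝ) * ((p.1.descFactorial 2 : ℝ) / n.descFactorial 2)) • jointElt s₀ s₁ p
        ∂(Pn n : Measure (ℕ × ℝ)) := by
  have hs' : ∀ i j : ℕ, ‖s₁ ^ i * s₀ ^ j‖ ≤ (1 + i + j : ℝ) ^ 2 := fun i j => by
    rw [mul_comm]; exact (hs j i).trans (le_of_eq (by ring))
  have hB := hL.bound32.add (hL.bound21.const_mul (c := 6) (by norm_num))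
  have h0 := IsMomentBound.integrable_of_norm_le (hL.strength n) (hB.integrable n)
    (polySlices_excessElt s₀) fun _ hp => norm_excessElt_le hs hp
  have h1 := IsMomentBound.integrable_of_norm_le (hL.strength n) (hB.integrable n)
    (polySlices_excessElt s₁) fun _ hp => norm_excessElt_le hs' hp
  have hB' := (hL.bound32.add (hL.bound21.const_mul (c := 3) (by norm_num))).const_mul (c := 40)
      (by norm_num)
  have h2 : Integrable (fun p : ℕ × ℝ => ((n : ℝ) * ((p.1.descFactorial 2 : ℝ) /
      n.descFactorial 2)) • jointElt s₀ s₁ p) (Pn n : Measure (ℕ × ℝ)) :=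
    (hB'.integrable n).mono'
      (((polySlices_jointElt s₀ s₁).smul fun x =>
        (n : ℝ) * ((x.descFactorial 2 : ℝ) / n.descFactorial 2)).aestronglyMeasurable _)
      ((hL.supp n).mono fun p hp => norm_joint_le hs hp)
  refine ⟨(h0.add h1).add h2, ?_⟩
  rw [← integral_add h0 h1]
  exact integral_add (h0.add h1) h2

theorem LayerLimit.tendsto_layerRate (hL : LayerLimit Pn P)
    (hs : ∀ i j : ℕ, ‖s₀ ^ i * s₁ ^ j‖ ≤ (1 + i + j : ℝ) ^ 2) :
    Tendsto (fun n : ℕ => ∫ p, layerRate n s₀ s₁ p ∂(Pn n : Measure (ℕ × ℝ))) atTop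
      (𝓝 (∫ p, excessElt s₀ p ∂(P : Measure (ℕ × ℝ)) +
        ∫ p, excessElt s₁ p ∂(P : Measure (ℕ × ℝ)))) := by
  have hs' : ∀ i j : ℕ, ‖s₁ ^ i * s₀ ^ j‖ ≤ (1 + i + j : ℝ) ^ 2 := fun i j => by
    rw [mul_comm]; exact (hs j i).trans (le_of_eq (by ring))
  have := ((hL.tendsto_integral_excessElt hs).add (hL.tendsto_integral_excessElt hs')).add
    (hL.tendsto_integral_joint hs)
  rw [add_zero] at this
  exact this.congr fun n => (hL.integral_layerRate hs n).2.symm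

theorem LayerLimit.integral_layerGen_one (hL : LayerLimit Pn P)
    (hs : ∀ i j : ℕ, ‖s₀ ^ i * s₁ ^ j‖ ≤ (1 + i + j : ℝ) ^ 2) {n : ℕ} (hn : n ≠ 0) :
    ∫ p, layerGen n s₀ s₁ 1 p ∂(Pn n : Measure (ℕ × ℝ)) =
      1 + (1 / (n : ℝ)) • ∫ p, layerRate n s₀ s₁ p ∂(Pn n : Measure (ℕ × ℝ)) := by
  have e : layerGen n s₀ s₁ 1 = fun p => 1 + (1 / (n : ℝ)) • layerRate n s₀ s₁ p :=
    funext fun p => layerGen_one hn s₀ s₁ p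
  have hi := (hL.integral_layerRate hs n).1.smul (1 / (n : ℝ))
  rw [e]
  refine (integral_add (integrable_const _) hi).trans ?_
  rw [integral_const, probReal_univ, one_smul]
  exact congrArg _ (integral_smul _ _)

theorem LayerLimit.integral_layerGen_zero (hL : LayerLimit Pn P)
    (hs : ∀ i j : ℕ, ‖s₀ ^ i * s₁ ^ j‖ ≤ (1 + i + j : ℝ) ^ 2) (n : ℕ) :
    ∫ p, layerGen n s₀ s₁ 0 p ∂(Pn n : Measure (ℕ × ℝ)) = (n.descFactorial 2 : ℝ)⁻¹ •
      (s₀ * s₁ * ∫ p, pairElt s₀ s₁ p ∂(Pn n : Measure (ℕ × ℝ))) := by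
  have hB := ((hL.bound21.const_mul (c := 9) (by norm_num)).add
      (hL.bound32.const_mul (c := 18) (by norm_num))).add
      (hL.bound43.const_mul (c := 4) (by norm_num))
  have hi := IsMomentBound.integrable_of_norm_le (hL.strength n) (hB.integrable n)
    (polySlices_pairElt s₀ s₁) fun _ hp => norm_pairElt_le hs hp
  simp_rw [layerGen_zero]
  rw [integral_smul]
  congr 1
  exact (ContinuousLinearMap.mul ℝ A (s₀ * s₁)).integral_comp_comm hi

theorem LayerLimit.integral_excessElt (hL : LayerLimit Pn P)
    (hs : ∀ i j : ℕ, ‖s₀ ^ i * s₁ ^ j‖ ≤ (1 + i + j : ℝ) ^ 2) :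
    ∫ p, excessElt s₀ p ∂(P : Measure (ℕ × ℝ)) =
      mom (P : Measure (ℕ × ℝ)) 1 0 •
        ((mom (P : Measure (ℕ × ℝ)) 1 0)⁻¹ • ∫ p, incElt s₀ p ∂(P : Measure (ℕ × ℝ)) - 1) := by
  have hB := hL.bound32.add (hL.bound21.const_mul (c := 6) (by norm_num))
  have h0 := IsMomentBound.integrable_of_norm_le hL.supp_limit hB.integrable_limit
    (polySlices_excessElt s₀) fun _ hp => norm_excessElt_le hs hp
  have h1 : Integrable (fun p => momFun 1 0 p • (1 : A)) (P : Measure (ℕ × ℝ)) :=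
    hL.bound10.integrable_limit.smul_const _
  have e : incElt s₀ = fun p => excessElt s₀ p + momFun 1 0 p • (1 : A) := by
    funext p
    simp [incElt, excessElt, momFun, smul_sub]
  have hm : ∫ p, momFun 1 0 p ∂(P : Measure (ℕ × ℝ)) = mom (P : Measure (ℕ × ℝ)) 1 0 := rfl
  rw [e, integral_add h0 h1, integral_smul_const, hm, smul_sub, smul_smul,
    mul_inv_cancel₀ hL.pos10.ne', one_smul, add_sub_cancel_right]

/-- Convergence of the generating function of the layerwise degrees, conditionally on a given layer
linking the two nodes. -/
theorem LayerLimit.tendsto_gen (hL : LayerLimit Pn P)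
    (hs : ∀ i j : ℕ, ‖s₀ ^ i * s₁ ^ j‖ ≤ (1 + i + j : ℝ) ^ 2) {mu : ℝ} {m : ℕ → ℕ}
    (hm : Tendsto m atTop atTop)
    (hratio : Tendsto (fun n : ℕ => (m n : ℝ) / n) atTop (𝓝 mu)) :
    Tendsto (fun n : ℕ => (mom (Pn n : Measure (ℕ × ℝ)) 2 1 / n.descFactorial 2)⁻¹ •
        ((∫ p, layerGen n s₀ s₁ 0 p ∂(Pn n : Measure (ℕ × ℝ))) *
          (∫ p, layerGen n s₀ s₁ 1 p ∂(Pn n : Measure (ℕ × ℝ))) ^ (m n - 1))) atTop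
      (𝓝 (s₀ * s₁ * (NormedSpace.exp ((mu * mom (P : Measure (ℕ × ℝ)) 1 0) •
          ((mom (P : Measure (ℕ × ℝ)) 1 0)⁻¹ • ∫ p, incElt s₀ p ∂(P : Measure (ℕ × ℝ)) - 1)) *
        NormedSpace.exp ((mu * mom (P : Measure (ℕ × ℝ)) 1 0) •
          ((mom (P : Measure (ℕ × ℝ)) 1 0)⁻¹ • ∫ p, incElt s₁ p ∂(P : Measure (ℕ × ℝ)) - 1))) *
        ((mom (P : Measure (ℕ × ℝ)) 2 1)⁻¹ • ∫ p, pairElt s₀ s₁ p ∂(P : Measure (ℕ × ℝ))))) := by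
  let _ : NormedAlgebra ℚ A := NormedAlgebra.restrictScalars ℚ ℝ A
  have hs' : ∀ i j : ℕ, ‖s₁ ^ i * s₀ ^ j‖ ≤ (1 + i + j : ℝ) ^ 2 := fun i j => by
    rw [mul_comm]; exact (hs j i).trans (le_of_eq (by ring))
  have hr : Tendsto (fun n : ℕ => ((m n - 1 : ℕ) : ℝ) / n) atTop (𝓝 mu) := by
    have := hratio.sub (tendsto_one_div_atTop_nhds_zero_nat (𝕜 := ℝ))
    rw [sub_zero] at this
    refine this.congr' ?_
    filter_upwards [hm.eventually_ge_atTop 1] with n hn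
    rw [Nat.cast_sub hn]; push_cast; ring
  have hpow := tendsto_one_add_pow_exp (by simpa using hs 0 0) (hL.tendsto_layerRate hs) hr
  rw [smul_add, hL.integral_excessElt hs, hL.integral_excessElt hs', smul_smul, smul_smul,
    NormedSpace.exp_add] at hpow
  have hmom : Tendsto (fun n => (mom (Pn n : Measure (ℕ × ℝ)) 2 1)⁻¹) atTop
      (𝓝 (mom (P : Measure (ℕ × ℝ)) 2 1)⁻¹) := hL.bound21.tendsto.inv₀ hL.pos21.ne'
  have := (((hmom.smul (hL.tendsto_integral_pairElt hs)).const_mul (s₀ * s₁))).mul hpow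
  refine (this.congr' ?_).trans (le_of_eq (congrArg 𝓝 (by ring)))
  filter_upwards [eventually_ge_atTop 2] with n hn
  rw [hL.integral_layerGen_one hs (by omega), hL.integral_layerGen_zero hs]
  have hd : (n.descFactorial 2 : ℝ) ≠ 0 := by
    exact_mod_cast (Nat.descFactorial_eq_zero_iff_lt.not.mpr (by omega))
  simp only [smul_mul_assoc, mul_smul_comm, smul_smul]
  congr 1
  field_simp

end LayerGen

/-! ### A Banach algebra of weighted shifts -/

/-- The quadratic weight. -/
def quadW (a : ℕ × ℕ) : ℝ := (1 + a.1 + a.2 : ℝ) ^ 2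

theorem one_le_quadW (a : ℕ × ℕ) : 1 ≤ quadW a := by
  have h1 : (0 : ℝ) ≤ a.1 := Nat.cast_nonneg _
  have h2 : (0 : ℝ) ≤ a.2 := Nat.cast_nonneg _
  unfold quadW
  nlinarith

theorem quadW_pos (a : ℕ × ℕ) : 0 < quadW a := zero_lt_one.trans_le (one_le_quadW a)

theorem quadW_add_le (a b : ℕ × ℕ) : quadW (a + b) ≤ quadW a * quadW b := by
  unfold quadW
  rw [← mul_pow]
  simp only [Prod.fst_add, Prod.snd_add]
  push_cast
  have : (0 : ℝ) ≤ (a.1 + a.2) * (b.1 + b.2) := by positivity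
  gcongr
  linarith

theorem norm_weightedShift_apply_le (a : ℕ × ℕ) (ψ : BoundedContinuousFunction (ℕ × ℕ) ℝ)
    (x : ℕ × ℕ) : ‖ψ (x + a) * (quadW (x + a) / quadW x)‖ ≤ quadW a * ‖ψ‖ := by
  rw [norm_mul, Real.norm_of_nonneg (div_pos (quadW_pos _) (quadW_pos _)).le, mul_comm]
  refine mul_le_mul ?_ (ψ.norm_coe_le_norm _) (norm_nonneg _) (quadW_pos a).le
  rw [div_le_iff₀ (quadW_pos x), mul_comm]
  exact quadW_add_le x a

/-- Weighted shift operators on bounded functions. -/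
def weightedShift (a : ℕ × ℕ) :
    BoundedContinuousFunction (ℕ × ℕ) ℝ →L[ℝ] BoundedContinuousFunction (ℕ × ℕ) ℝ :=
  LinearMap.mkContinuous
    { toFun := fun ψ => BoundedContinuousFunction.ofNormedAddCommGroup
        (fun x => ψ (x + a) * (quadW (x + a) / quadW x)) continuous_of_discreteTopology
        (quadW a * ‖ψ‖) (norm_weightedShift_apply_le a ψ)
      map_add' := fun ψ χ => by ext x; simp [add_mul]
      map_smul' := fun r ψ => by ext x; simp [mul_assoc] }
    (quadW a)
    fun ψ => BoundedContinuousFunction.norm_ofNormedAddCommGroup_le _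
      (mul_nonneg (quadW_pos a).le (norm_nonneg _)) (norm_weightedShift_apply_le a ψ)

theorem weightedShift_apply (a : ℕ × ℕ) (ψ : BoundedContinuousFunction (ℕ × ℕ) ℝ) (x : ℕ × ℕ) :
    weightedShift a ψ x = ψ (x + a) * (quadW (x + a) / quadW x) := rfl

theorem norm_weightedShift_le (a : ℕ × ℕ) : ‖weightedShift a‖ ≤ quadW a :=
  LinearMap.mkContinuous_norm_le (C := quadW a) _ (quadW_pos a).le fun ψ =>
    BoundedContinuousFunction.norm_ofNormedAddCommGroup_le _
      (mul_nonneg (quadW_pos a).le (norm_nonneg _)) (norm_weightedShift_apply_le a ψ)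

theorem weightedShift_mul (a b : ℕ × ℕ) :
    weightedShift a * weightedShift b = weightedShift (a + b) := by
  refine ContinuousLinearMap.ext fun ψ => BoundedContinuousFunction.ext fun x => ?_
  change weightedShift a (weightedShift b ψ) x = _
  rw [weightedShift_apply, weightedShift_apply, weightedShift_apply, add_assoc]
  have := (quadW_pos x).ne'
  have := (quadW_pos (x + a)).ne'
  field_simp

theorem weightedShift_zero : weightedShift 0 = 1 := by
  refine ContinuousLinearMap.ext fun ψ => BoundedContinuousFunction.ext fun x => ?_
  change _ = ψ x
  rw [weightedShift_apply, add_zero, div_self (quadW_pos x).ne', mul_one]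

theorem weightedShift_pow (a : ℕ × ℕ) (k : ℕ) : weightedShift a ^ k = weightedShift (k • a) := by
  induction k with
  | zero => rw [pow_zero, zero_smul, weightedShift_zero]
  | succ k ih => rw [pow_succ, ih, weightedShift_mul, succ_nsmul]

/-- Two commuting elements of a Banach algebra lie in a commutative closed subalgebra. -/
theorem exists_commutative_subalgebra {B : Type} [NormedRing B] [NormedAlgebra ℝ B]
    [CompleteSpace B] {a b : B} (hab : a * b = b * a) :
    ∃ (A : Type) (_ : NormedCommRing A) (_ : NormedAlgebra ℝ A) (_ : CompleteSpace A)
      (s₀ s₁ : A) (ι : A →L[ℝ] B), (∀ i j : ℕ, ‖s₀ ^ i * s₁ ^ j‖ = ‖a ^ i * b ^ j‖) ∧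
        ∀ i j : ℕ, ι (s₀ ^ i * s₁ ^ j) = a ^ i * b ^ j := by
  have hadj : ∀ x y : Algebra.adjoin ℝ {a, b}, x * y = y * x := by
    have := Algebra.isMulCommutative_adjoin ℝ (s := {a, b}) (by
      rintro x (rfl | rfl) y (rfl | rfl) <;> simp only [hab])
    exact fun x y => mul_comm' x y
  let S := (Algebra.adjoin ℝ {a, b}).topologicalClosure
  let R : NormedCommRing S :=
    { (inferInstance : NormedRing S) with
      mul_comm := (Subalgebra.commRingTopologicalClosure _ hadj).mul_comm }
  have hmem : ∀ s ∈ ({a, b} : Set B), s ∈ S := fun s hs =>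
    Subalgebra.le_topologicalClosure _ (Algebra.subset_adjoin hs)
  have hcomp : CompleteSpace S :=
    (Subalgebra.isClosed_topologicalClosure (Algebra.adjoin ℝ {a, b})).completeSpace_coe
  exact ⟨S, R, inferInstance, hcomp, ⟨a, hmem a (by simp)⟩, ⟨b, hmem b (by simp)⟩,
    S.toSubmodule.subtypeL, fun i j => rfl, fun i j => rfl⟩

/-- Every function of quadratic growth is a continuous linear image of the monomials in two
commuting elements of a Banach algebra, with a quadratic norm bound. -/
theorem exists_shift_algebra {φ : ℕ × ℕ → ℝ} {c : ℝ} (hφ : ∀ p, |φ p| ≤ c * quadW p) :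
    ∃ (A : Type) (_ : NormedCommRing A) (_ : NormedAlgebra ℝ A) (_ : CompleteSpace A) (s₀ s₁ : A)
      (ev : A →L[ℝ] ℝ), (∀ i j : ℕ, ‖s₀ ^ i * s₁ ^ j‖ ≤ (1 + i + j : ℝ) ^ 2) ∧
        ∀ i j : ℕ, ev (s₀ ^ i * s₁ ^ j) = φ (i, j) := by
  obtain ⟨A, hA, hA', hA'', s₀, s₁, ι, hn, hι⟩ := exists_commutative_subalgebra
    (a := weightedShift (1, 0)) (b := weightedShift (0, 1))
    (by simp only [weightedShift_mul, add_comm])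
  let ψ : BoundedContinuousFunction (ℕ × ℕ) ℝ := BoundedContinuousFunction.ofNormedAddCommGroup
    (fun p => φ p / quadW p) continuous_of_discreteTopology c fun p => by
      rw [Real.norm_eq_abs, abs_div, abs_of_pos (quadW_pos p), div_le_iff₀ (quadW_pos p)]
      exact hφ p
  have hpow : ∀ i j : ℕ, weightedShift (1, 0) ^ i * weightedShift (0, 1) ^ j =
      weightedShift (i, j) := fun i j => by
    rw [weightedShift_pow, weightedShift_pow, weightedShift_mul]
    simp
  refine ⟨A, hA, hA', hA'', s₀, s₁, (BoundedContinuousFunction.evalCLM ℝ (0 : ℕ × ℕ)).comp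
    ((ContinuousLinearMap.apply ℝ _ ψ).comp ι), fun i j => ?_, fun i j => ?_⟩
  · rw [hn, hpow]
    exact norm_weightedShift_le (i, j)
  · change (ι (s₀ ^ i * s₁ ^ j)) ψ 0 = _
    rw [hι, hpow, weightedShift_apply, zero_add]
    change φ (i, j) / quadW (i, j) * (quadW (i, j) / quadW 0) = _
    have h0 : quadW 0 = 1 := by simp [quadW]
    rw [h0, div_one, div_mul_cancel₀ _ (quadW_pos _).ne']

/-! ### Layerwise degrees -/

/-- The joint law of the layer configurations. -/
def configLaw (n m : ℕ) (Q : Measure (ℕ × ℝ)) [IsProbabilityMeasure Q] :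
    Measure (Fin m → LayerConfig n) :=
  (modelMeasure n m Q).map fun ω i => (ω i).2

theorem measurable_config (n m : ℕ) :
    Measurable fun (ω : Fin m → Layer n) (i : Fin m) => (ω i).2 :=
  measurable_pi_lambda _ fun i => measurable_snd.comp (measurable_pi_apply i)

instance (n m : ℕ) (Q : Measure (ℕ × ℝ)) [IsProbabilityMeasure Q] :
    IsProbabilityMeasure (configLaw n m Q) :=
  Measure.isProbabilityMeasure_map (measurable_config n m).aemeasurable

theorem integrable_configLaw {E : Type*} [NormedAddCommGroup E] {n m : ℕ} {Q : Measure (ℕ × ℝ)}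
    [IsProbabilityMeasure Q] (F : (Fin m → LayerConfig n) → E) : Integrable F (configLaw n m Q) :=
  Integrable.of_finite

theorem integral_configLaw {E : Type*} [NormedAddCommGroup E] [NormedSpace ℝ E] {n m : ℕ}
    (Q : Measure (ℕ × ℝ)) [IsProbabilityMeasure Q] (F : (Fin m → LayerConfig n) → E) :
    ∫ c, F c ∂configLaw n m Q = ∫ ω, F (fun i => (ω i).2) ∂modelMeasure n m Q := by
  have h : AEStronglyMeasurable F (configLaw n m Q) :=
    (integrable_configLaw F).aestronglyMeasurable
  exact integral_map (measurable_config n m).aemeasurable h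

theorem integral_configLaw_prod {A : Type*} [NormedCommRing A] [NormedAlgebra ℝ A]
    [CompleteSpace A] {n m : ℕ} (Q : Measure (ℕ × ℝ)) [IsProbabilityMeasure Q]
    (h : Fin m → LayerConfig n → A) :
    ∫ c, ∏ i, h i (c i) ∂configLaw n m Q = ∏ i, ∫ p, configExp n (h i) p ∂Q := by
  rw [integral_configLaw, integral_modelMeasure_prod]

/-- The sum over the layers of the degrees of a node. -/
def sumDeg {n m : ℕ} (c : Fin m → LayerConfig n) (u : Fin n) : ℕ :=
  ∑ i, ((configEdges (c i)).filter fun e => u ∈ e).card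

/-- The indicator of an edge of a layer. -/
def edgeInd {n : ℕ} (e : Sym2 (Fin n)) (c : LayerConfig n) : ℝ :=
  if e ∈ configEdges c then 1 else 0

theorem edgeInd_nonneg {n : ℕ} (e : Sym2 (Fin n)) (c : LayerConfig n) : 0 ≤ edgeInd e c := by
  unfold edgeInd; split_ifs <;> norm_num

/-- The function `φ` of the total layerwise degrees of two nodes, weighted by the number of layers
linking them. -/
def linkSum {n m : ℕ} (φ : ℕ × ℕ → ℝ) (u v : Fin n) (c : Fin m → LayerConfig n) : ℝ :=
  (∑ k, edgeInd s(u, v) (c k)) * φ (sumDeg c u, sumDeg c v)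

section Expectation

variable {Pn : ℕ → ProbabilityMeasure (ℕ × ℝ)} {P : ProbabilityMeasure (ℕ × ℝ)}

theorem LayerLimit.integral_configExp_degGen {A : Type*} [NormedCommRing A] [NormedAlgebra ℝ A]
    (hL : LayerLimit Pn P) {n : ℕ} {u v : Fin n} (huv : u ≠ v) (s₀ s₁ z : A) :
    ∫ p, configExp n (degGen s₀ s₁ z u v) p ∂(Pn n : Measure (ℕ × ℝ)) =
      ∫ p, layerGen n s₀ s₁ z p ∂(Pn n : Measure (ℕ × ℝ)) :=
  integral_congr_ae ((hL.supp n).mono fun _ hp => configExp_degGen s₀ s₁ z huv hp)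

theorem prod_degGen {A : Type*} [NormedCommRing A] {n m : ℕ} (s₀ s₁ : A) (u v : Fin n)
    (c : Fin m → LayerConfig n) (k : Fin m) :
    ∏ i, degGen s₀ s₁ (if i = k then 0 else 1) u v (c i) =
      (if s(u, v) ∈ configEdges (c k) then 1 else 0) * (s₀ ^ sumDeg c u * s₁ ^ sumDeg c v) := by
  simp only [degGen, Finset.prod_mul_distrib, Finset.prod_pow_eq_pow_sum, sumDeg]
  congr 1
  rw [Finset.prod_eq_single k]
  · simp
  · intro i _ hi; simp [hi]
  · simp

theorem LayerLimit.integral_edge_monomial {A : Type*} [NormedCommRing A] [NormedAlgebra ℝ A]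
    [CompleteSpace A] (hL : LayerLimit Pn P) {n m : ℕ} {u v : Fin n} (huv : u ≠ v) (s₀ s₁ : A)
    (k : Fin m) :
    ∫ c, (if s(u, v) ∈ configEdges (c k) then (1 : A) else 0) *
        (s₀ ^ sumDeg c u * s₁ ^ sumDeg c v) ∂configLaw n m (Pn n : Measure (ℕ × ℝ)) =
      (∫ p, layerGen n s₀ s₁ 0 p ∂(Pn n : Measure (ℕ × ℝ))) *
        (∫ p, layerGen n s₀ s₁ 1 p ∂(Pn n : Measure (ℕ × ℝ))) ^ (m - 1) := by
  simp_rw [← prod_degGen]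
  rw [integral_configLaw_prod _ fun i => degGen s₀ s₁ (if i = k then 0 else 1) u v]
  simp_rw [hL.integral_configExp_degGen huv]
  rw [← Finset.mul_prod_erase _ _ (Finset.mem_univ k), if_pos rfl,
    Finset.prod_congr rfl (g := fun _ => ∫ p, layerGen n s₀ s₁ 1 p ∂(Pn n : Measure (ℕ × ℝ)))
      fun i hi => by rw [if_neg (Finset.ne_of_mem_erase hi)],
    Finset.prod_const, Finset.card_erase_of_mem (Finset.mem_univ k), Finset.card_univ,
    Fintype.card_fin]

theorem LayerLimit.integral_linkSum {A : Type*} [NormedCommRing A] [NormedAlgebra ℝ A]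
    [CompleteSpace A] (hL : LayerLimit Pn P) {φ : ℕ × ℕ → ℝ} {s₀ s₁ : A} {ev : A →L[ℝ] ℝ}
    (hev : ∀ i j : ℕ, ev (s₀ ^ i * s₁ ^ j) = φ (i, j)) {n m : ℕ} {u v : Fin n} (huv : u ≠ v) :
    ∫ c, linkSum φ u v c ∂configLaw n m (Pn n : Measure (ℕ × ℝ)) =
      m * ev ((∫ p, layerGen n s₀ s₁ 0 p ∂(Pn n : Measure (ℕ × ℝ))) *
        (∫ p, layerGen n s₀ s₁ 1 p ∂(Pn n : Measure (ℕ × ℝ))) ^ (m - 1)) := by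
  simp only [linkSum, Finset.sum_mul]
  rw [integral_finsetSum _ fun _ _ => integrable_configLaw _]
  have h : ∀ k : Fin m, ∫ c, edgeInd s(u, v) (c k) * φ (sumDeg c u, sumDeg c v)
      ∂configLaw n m (Pn n : Measure (ℕ × ℝ)) =
      ev ((∫ p, layerGen n s₀ s₁ 0 p ∂(Pn n : Measure (ℕ × ℝ))) *
        (∫ p, layerGen n s₀ s₁ 1 p ∂(Pn n : Measure (ℕ × ℝ))) ^ (m - 1)) := fun k => by
    rw [← hL.integral_edge_monomial huv s₀ s₁ k,
      ← ContinuousLinearMap.integral_comp_comm ev (integrable_configLaw _)]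
    refine integral_congr_ae (ae_of_all _ fun c => ?_)
    simp only [edgeInd]
    split_ifs
    · rw [one_mul, one_mul, hev]
    · rw [zero_mul, zero_mul, map_zero]
  simp_rw [h]
  simp

/-- The expected number of layers linking two given nodes. -/
def linkRate (Q : Measure (ℕ × ℝ)) (n m : ℕ) : ℝ := m * (mom Q 2 1 / n.descFactorial 2)

theorem LayerLimit.integral_edgeInd (hL : LayerLimit Pn P) {n m : ℕ} {u v : Fin n} (huv : u ≠ v)
    (k : Fin m) : ∫ c, edgeInd s(u, v) (c k) ∂configLaw n m (Pn n : Measure (ℕ × ℝ)) =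
      mom (Pn n : Measure (ℕ × ℝ)) 2 1 / n.descFactorial 2 := by
  have h := hL.integral_edge_monomial huv (1 : ℝ) 1 k
  simp only [one_pow, mul_one] at h
  have hb : ∀ y : ℝ, bernElt (1 : ℝ) y = 1 := fun y => by simp [bernElt]
  have h0 : ∀ p, layerGen n (1 : ℝ) 1 0 p = momFun 2 1 p / n.descFactorial 2 := fun p => by
    simp only [layerGen, hb, momFun, smul_eq_mul]; ring
  have h1 : ∀ p, layerGen n (1 : ℝ) 1 1 p = 1 := fun p => by
    simp only [layerGen, hb, smul_eq_mul]; ring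
  simp_rw [h0, h1] at h
  refine h.trans ?_
  rw [integral_div]
  simp [momFun, mom]

theorem LayerLimit.integral_edgeInd_le (hL : LayerLimit Pn P) {n m : ℕ} (e : Sym2 (Fin n))
    (k : Fin m) : ∫ c, edgeInd e (c k) ∂configLaw n m (Pn n : Measure (ℕ × ℝ)) ≤
      mom (Pn n : Measure (ℕ × ℝ)) 2 1 / n.descFactorial 2 := by
  induction e with | h u v =>
  by_cases huv : u = v
  · have : ∀ c : Fin m → LayerConfig n, edgeInd s(u, v) (c k) = 0 := fun c => by
      simp [edgeInd, configEdges, huv]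
    simp_rw [this, integral_zero]
    exact div_nonneg (integral_nonneg_of_ae ((hL.strength n).mono fun p hp =>
      hL.bound21.nonneg p hp)) (Nat.cast_nonneg _)
  · exact (hL.integral_edgeInd huv k).le

theorem LayerLimit.integral_linkSum_one (hL : LayerLimit Pn P) {n m : ℕ} {u v : Fin n}
    (huv : u ≠ v) :
    ∫ c, linkSum (fun _ => 1) u v c ∂configLaw n m (Pn n : Measure (ℕ × ℝ)) =
      linkRate (Pn n : Measure (ℕ × ℝ)) n m := by
  simp only [linkSum, mul_one]
  rw [integral_finsetSum _ fun _ _ => integrable_configLaw _]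
  simp_rw [hL.integral_edgeInd huv]
  simp [linkRate]

theorem LayerLimit.linkRate_pos (hL : LayerLimit Pn P) {m : ℕ → ℕ} (hm : Tendsto m atTop atTop) :
    ∀ᶠ n in atTop, 0 < linkRate (Pn n : Measure (ℕ × ℝ)) n (m n) := by
  filter_upwards [hm.eventually_gt_atTop 0, eventually_ge_atTop 2,
    hL.bound21.tendsto.eventually (lt_mem_nhds (b := _) hL.pos21)] with n h1 h2 h3
  have hd : 0 < n.descFactorial 2 := Nat.descFactorial_pos.mpr h2
  exact mul_pos (by exact_mod_cast h1) (div_pos h3 (by exact_mod_cast hd))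

theorem LayerLimit.tendsto_linkRate (hL : LayerLimit Pn P) {mu : ℝ} {m : ℕ → ℕ}
    (hratio : Tendsto (fun n : ℕ => (m n : ℝ) / n) atTop (𝓝 mu)) :
    Tendsto (fun n => linkRate (Pn n : Measure (ℕ × ℝ)) n (m n)) atTop (𝓝 0) := by
  have h1 : Tendsto (fun n : ℕ => ((n - 1 : ℕ) : ℝ)⁻¹) atTop (𝓝 0) :=
    (tendsto_natCast_atTop_atTop.comp (tendsto_sub_atTop_nat 1)).inv_tendsto_atTop
  have := (hratio.mul hL.bound21.tendsto).mul h1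
  rw [mul_zero] at this
  refine this.congr fun n => ?_
  rw [linkRate, cast_descFactorial_two]
  have : ∫ p, momFun 2 1 p ∂(Pn n : Measure (ℕ × ℝ)) = mom (Pn n : Measure (ℕ × ℝ)) 2 1 := rfl
  rw [this]
  simp only [div_eq_mul_inv, mul_inv]
  ring

theorem LayerLimit.tendsto_integral_linkSum (hL : LayerLimit Pn P) {mu : ℝ} (hmu : 0 ≤ mu)
    {m : ℕ → ℕ} (hm : Tendsto m atTop atTop)
    (hratio : Tendsto (fun n : ℕ => (m n : ℝ) / n) atTop (𝓝 mu)) {φ : ℕ × ℕ → ℝ} {C : ℝ}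
    (hφ : ∀ p, |φ p| ≤ C * quadW p) :
    (∀ p : ℕ × ℕ, 0 ≤ barf2 mu P p.1 p.2) ∧
    Summable (fun p : ℕ × ℕ => quadW p * barf2 mu P p.1 p.2) ∧
    Tendsto (fun N : ℕ => (linkRate (Pn (N + 2) : Measure (ℕ × ℝ)) (N + 2) (m (N + 2)))⁻¹ *
        ∫ c, linkSum φ 0 1 c ∂configLaw (N + 2) (m (N + 2)) (Pn (N + 2) : Measure (ℕ × ℝ)))
      atTop (𝓝 (∑' p : ℕ × ℕ, φ p * barf2 mu P p.1 p.2)) := by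
  obtain ⟨A, _, _, _, s₀, s₁, ev, hs, hev⟩ := exists_shift_algebra hφ
  have hrep := represents_barf2 hs hL.supp_limit hmu hL.bound10.integrable_limit
    hL.bound21.integrable_limit hL.bound32.integrable_limit hL.bound43.integrable_limit
    hL.pos10 hL.pos21
  refine ⟨hrep.nonneg, hrep.summable.congr fun p => mul_comm _ _, ?_⟩
  have hsum := (hrep.hasSum fun i => hs i.1 i.2).mapL ev
  have hsum' := hsum.tsum_eq
  simp only [map_smul, hev, smul_eq_mul] at hsum'
  have hlim := ((ev.continuous.tendsto _).comp (hL.tendsto_gen hs hm hratio)).comp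
    (tendsto_add_atTop_nat 2)
  rw [← hsum'] at hlim
  simp_rw [mul_comm (φ _)]
  refine hlim.congr' ?_
  filter_upwards [(tendsto_add_atTop_nat 2).eventually (hm.eventually_gt_atTop 0)] with N hN
  rw [hL.integral_linkSum hev (by simp)]
  simp only [Function.comp_apply, map_smul, smul_eq_mul, linkRate, mul_inv]
  have : ((m (N + 2) : ℕ) : ℝ) ≠ 0 := by exact_mod_cast hN.ne'
  field_simp

end Expectation

/-! ### Overlapping layers -/

/-- The union of the edge sets of the layers. -/
def edgeUnion {n m : ℕ} (c : Fin m → LayerConfig n) : Finset (Sym2 (Fin n)) :=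
  Finset.univ.biUnion fun i => configEdges (c i)

/-- The degree of a node in the superposition of the layers. -/
def nodeDeg {n m : ℕ} (c : Fin m → LayerConfig n) (u : Fin n) : ℕ :=
  ((edgeUnion c).filter fun e => u ∈ e).card

/-- The pairs containing at least one of two given nodes. -/
def incidentPairs {n : ℕ} (u v : Fin n) : Finset (Sym2 (Fin n)) :=
  Finset.univ.filter fun e => u ∈ e ∨ v ∈ e

/-- The number of times an edge at `u` or `v` appears in an ordered pair of distinct layers. -/
def overlapCount {n m : ℕ} (u v : Fin n) (c : Fin m → LayerConfig n) : ℝ :=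
  ∑ e ∈ incidentPairs u v, ∑ i, ∑ j ∈ Finset.univ.erase i, edgeInd e (c i) * edgeInd e (c j)

/-- The part of the quadratic weight exceeding the level `K`. -/
def quadTail (K : ℝ) (p : ℕ × ℕ) : ℝ := if K < quadW p then quadW p else 0

theorem quadTail_nonneg (K : ℝ) (p : ℕ × ℕ) : 0 ≤ quadTail K p := by
  unfold quadTail; split_ifs
  exacts [(quadW_pos p).le, le_rfl]

theorem quadTail_le (K : ℝ) (p : ℕ × ℕ) : quadTail K p ≤ quadW p := by
  unfold quadTail; split_ifs
  exacts [le_rfl, (quadW_pos p).le]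

theorem quadW_mono {a b : ℕ × ℕ} (h1 : a.1 ≤ b.1) (h2 : a.2 ≤ b.2) : quadW a ≤ quadW b := by
  have h1' : (a.1 : ℝ) ≤ b.1 := by exact_mod_cast h1
  have h2' : (a.2 : ℝ) ≤ b.2 := by exact_mod_cast h2
  unfold quadW
  gcongr

section Pointwise

variable {n m : ℕ} {u v : Fin n} {c : Fin m → LayerConfig n}

theorem nodeDeg_le_sumDeg (c : Fin m → LayerConfig n) (u : Fin n) : nodeDeg c u ≤ sumDeg c u := by
  rw [nodeDeg, edgeUnion, Finset.filter_biUnion]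
  exact Finset.card_biUnion_le

theorem nodeDeg_eq_sumDeg {u : Fin n}
    (h : ∀ e, u ∈ e → ∀ i j, e ∈ configEdges (c i) → e ∈ configEdges (c j) → i = j) :
    nodeDeg c u = sumDeg c u := by
  rw [nodeDeg, edgeUnion, Finset.filter_biUnion]
  refine Finset.card_biUnion fun i _ j _ hij => Finset.disjoint_left.mpr fun e hi hj => hij ?_
  rw [Finset.mem_filter] at hi hj
  exact h e hi.2 i j hi.1 hj.1

theorem overlapCount_nonneg (u v : Fin n) (c : Fin m → LayerConfig n) : 0 ≤ overlapCount u v c :=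
  Finset.sum_nonneg fun _ _ => Finset.sum_nonneg fun _ _ => Finset.sum_nonneg fun _ _ =>
    mul_nonneg (edgeInd_nonneg _ _) (edgeInd_nonneg _ _)

theorem one_le_overlapCount {e : Sym2 (Fin n)} (he : u ∈ e ∨ v ∈ e) {i j : Fin m} (hij : i ≠ j)
    (hi : e ∈ configEdges (c i)) (hj : e ∈ configEdges (c j)) : 1 ≤ overlapCount u v c := by
  have hn : ∀ (e : Sym2 (Fin n)) (i j : Fin m), 0 ≤ edgeInd e (c i) * edgeInd e (c j) :=
    fun e i j => mul_nonneg (edgeInd_nonneg _ _) (edgeInd_nonneg _ _)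
  have he' : e ∈ incidentPairs u v := by simp [incidentPairs, he]
  calc (1 : ℝ) = edgeInd e (c i) * edgeInd e (c j) := by simp [edgeInd, hi, hj]
    _ ≤ ∑ j ∈ Finset.univ.erase i, edgeInd e (c i) * edgeInd e (c j) :=
        Finset.single_le_sum (f := fun j => edgeInd e (c i) * edgeInd e (c j))
          (fun j _ => hn e i j) (Finset.mem_erase.mpr ⟨hij.symm, Finset.mem_univ j⟩)
    _ ≤ ∑ i, ∑ j ∈ Finset.univ.erase i, edgeInd e (c i) * edgeInd e (c j) :=
        Finset.single_le_sum
          (f := fun i => ∑ j ∈ Finset.univ.erase i, edgeInd e (c i) * edgeInd e (c j))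
          (fun i _ => Finset.sum_nonneg fun j _ => hn e i j) (Finset.mem_univ i)
    _ ≤ overlapCount u v c :=
        Finset.single_le_sum (f := fun e => ∑ i, ∑ j ∈ Finset.univ.erase i,
          edgeInd e (c i) * edgeInd e (c j))
          (fun e _ => Finset.sum_nonneg fun i _ => Finset.sum_nonneg fun j _ => hn e i j) he'

theorem sum_edgeInd_nonneg (e : Sym2 (Fin n)) (c : Fin m → LayerConfig n) :
    0 ≤ ∑ k, edgeInd e (c k) := Finset.sum_nonneg fun _ _ => edgeInd_nonneg _ _

theorem linkSum_nonneg {φ : ℕ × ℕ → ℝ} (hφ : ∀ p, 0 ≤ φ p) (u v : Fin n)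
    (c : Fin m → LayerConfig n) : 0 ≤ linkSum φ u v c :=
  mul_nonneg (sum_edgeInd_nonneg _ _) (hφ _)

theorem abs_sub_linkSum_le {φ : ℕ × ℕ → ℝ} {C K : ℝ} (hC : 0 ≤ C) (hK : 0 ≤ K)
    (hφ : ∀ p, |φ p| ≤ C * quadW p) (u v : Fin n) (c : Fin m → LayerConfig n) :
    |(if s(u, v) ∈ edgeUnion c then φ (nodeDeg c u, nodeDeg c v) else 0) - linkSum φ u v c| ≤
      2 * C * (K * ((∑ k, edgeInd s(u, v) (c k)) * overlapCount u v c) +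
        linkSum (quadTail K) u v c) := by
  have hRHS : 0 ≤ 2 * C * (K * ((∑ k, edgeInd s(u, v) (c k)) * overlapCount u v c) +
        linkSum (quadTail K) u v c) :=
    mul_nonneg (by positivity) (add_nonneg (mul_nonneg hK
      (mul_nonneg (sum_edgeInd_nonneg _ _) (overlapCount_nonneg _ _ _)))
      (linkSum_nonneg (quadTail_nonneg K) u v c))
  by_cases hadj : s(u, v) ∈ edgeUnion c
  swap
  · have h0 : ∀ k, edgeInd s(u, v) (c k) = 0 := fun k => if_neg fun h =>
      hadj (Finset.mem_biUnion.mpr ⟨k, Finset.mem_univ k, h⟩)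
    have : linkSum φ u v c = 0 := by simp [linkSum, h0]
    rw [if_neg hadj, this, sub_zero, abs_zero]
    exact hRHS
  obtain ⟨k, -, hk⟩ := Finset.mem_biUnion.mp hadj
  rw [if_pos hadj]
  by_cases hover : ∀ e, (u ∈ e ∨ v ∈ e) → ∀ i j, e ∈ configEdges (c i) →
      e ∈ configEdges (c j) → i = j
  · have hu := nodeDeg_eq_sumDeg fun e he => hover e (Or.inl he)
    have hv := nodeDeg_eq_sumDeg fun e he => hover e (Or.inr he)
    have hS : ∑ k, edgeInd s(u, v) (c k) = 1 := by
      rw [Finset.sum_eq_single k]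
      · exact if_pos hk
      · exact fun j _ hj => if_neg fun h => hj (hover _ (Or.inl (Sym2.mem_mk_left u v)) j k h hk)
      · simp
    rw [linkSum, hS, hu, hv, one_mul, sub_self, abs_zero]
    rw [hS] at hRHS
    exact hRHS
  · push Not at hover
    obtain ⟨e, he, i, j, hi, hj, hij⟩ := hover
    have hN := one_le_overlapCount he hij hi hj
    have hS : 1 ≤ ∑ k, edgeInd s(u, v) (c k) :=
      calc (1 : ℝ) = edgeInd s(u, v) (c k) := (if_pos hk).symm
        _ ≤ _ := Finset.single_le_sum (f := fun k => edgeInd s(u, v) (c k))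
          (fun _ _ => edgeInd_nonneg _ _) (Finset.mem_univ k)
    set S := ∑ k, edgeInd s(u, v) (c k)
    set D := (sumDeg c u, sumDeg c v)
    have hw : quadW (nodeDeg c u, nodeDeg c v) ≤ quadW D :=
      quadW_mono (nodeDeg_le_sumDeg c u) (nodeDeg_le_sumDeg c v)
    have h1 : |φ (nodeDeg c u, nodeDeg c v)| ≤ S * (C * quadW D) :=
      ((hφ _).trans (mul_le_mul_of_nonneg_left hw hC)).trans
        (le_mul_of_one_le_left (mul_nonneg hC (quadW_pos D).le) hS)
    have h2 : |linkSum φ u v c| ≤ S * (C * quadW D) := by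
      rw [linkSum, abs_mul, abs_of_nonneg (zero_le_one.trans hS)]
      exact mul_le_mul_of_nonneg_left (hφ D) (zero_le_one.trans hS)
    have h3 : quadW D ≤ K * overlapCount u v c + quadTail K D := by
      unfold quadTail
      split_ifs with h
      · exact le_add_of_nonneg_left (mul_nonneg hK (overlapCount_nonneg _ _ _))
      · rw [add_zero]
        exact (not_lt.mp h).trans (le_mul_of_one_le_right hK hN)
    calc |φ (nodeDeg c u, nodeDeg c v) - linkSum φ u v c|
        ≤ |φ (nodeDeg c u, nodeDeg c v)| + |linkSum φ u v c| := abs_sub _ _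
      _ ≤ 2 * C * (S * quadW D) := by linarith
      _ ≤ 2 * C * (S * (K * overlapCount u v c + quadTail K D)) := by gcongr
      _ = _ := by rw [linkSum]; ring

theorem sum_incident_edgeInd_le (u v : Fin n) (c : Fin m → LayerConfig n) :
    ∑ e ∈ incidentPairs u v, ∑ i, edgeInd e (c i) ≤ (sumDeg c u + sumDeg c v : ℝ) := by
  rw [Finset.sum_comm]
  simp only [sumDeg, Nat.cast_sum]
  rw [← Finset.sum_add_distrib]
  refine Finset.sum_le_sum fun i _ => ?_
  simp only [edgeInd]
  rw [Finset.sum_boole, ← Nat.cast_add, Nat.cast_le]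
  refine (Finset.card_le_card fun e he => ?_).trans (Finset.card_union_le _ _)
  simp only [incidentPairs, Finset.mem_filter, Finset.mem_univ, true_and, Finset.mem_union] at he ⊢
  tauto

end Pointwise

section Moment

variable {Pn : ℕ → ProbabilityMeasure (ℕ × ℝ)} {P : ProbabilityMeasure (ℕ × ℝ)}

/-- The configuration of a layer is independent of the configurations of the others. -/
theorem integral_configLaw_mul {n m : ℕ} (Q : Measure (ℕ × ℝ)) [IsProbabilityMeasure Q]
    {k i j : Fin m} (hk : k ≠ j) (hi : i ≠ j) (f g h : LayerConfig n → ℝ) :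
    ∫ c, f (c k) * g (c i) * h (c j) ∂configLaw n m Q =
      (∫ c, f (c k) * g (c i) ∂configLaw n m Q) * ∫ c, h (c j) ∂configLaw n m Q := by
  let F : Fin m → LayerConfig n → ℝ := fun l x =>
    (if l = k then f x else 1) * (if l = i then g x else 1)
  let H : Fin m → LayerConfig n → ℝ := fun l x => if l = j then h x else 1
  have hF : ∀ c : Fin m → LayerConfig n, f (c k) * g (c i) = ∏ l, F l (c l) := fun c => by
    simp only [F]
    rw [Finset.prod_mul_distrib, Finset.prod_ite_eq', Finset.prod_ite_eq']
    simp
  have hH : ∀ c : Fin m → LayerConfig n, h (c j) = ∏ l, H l (c l) := fun c => by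
    simp only [H]
    rw [Finset.prod_ite_eq']
    simp
  have hFH : ∀ c : Fin m → LayerConfig n, f (c k) * g (c i) * h (c j) =
      ∏ l, (fun x => F l x * H l x) (c l) := fun c => by
    simp only
    rw [Finset.prod_mul_distrib, ← hF, ← hH]
  simp_rw [hFH]
  rw [integral_configLaw_prod Q fun l x => F l x * H l x]
  simp_rw [hF, hH]
  rw [integral_configLaw_prod Q F, integral_configLaw_prod Q H, ← Finset.prod_mul_distrib]
  refine Finset.prod_congr rfl fun l _ => ?_
  have hone : ∫ p, configExp n (fun _ : LayerConfig n => (1 : ℝ)) p ∂Q = 1 := by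
    rw [← integral_layerMeasure]; simp
  by_cases hl : l = j
  · have e1 : F l = fun _ => 1 := funext fun x => by simp [F, hl, hk.symm, hi.symm]
    rw [e1, hone, one_mul]
    simp only [one_mul]
  · have e1 : H l = fun _ => 1 := funext fun x => by simp [H, hl]
    rw [e1, hone, mul_one]
    simp only [mul_one]

theorem LayerLimit.integral_triple_le (hL : LayerLimit Pn P) {n m : ℕ} (e₀ e : Sym2 (Fin n))
    {k i j : Fin m} (hij : i ≠ j) :
    ∫ c, edgeInd e₀ (c k) * edgeInd e (c i) * edgeInd e (c j)
        ∂configLaw n m (Pn n : Measure (ℕ × ℝ)) ≤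
      (∫ c, edgeInd e₀ (c k) * edgeInd e (c (if j = k then k else i))
        ∂configLaw n m (Pn n : Measure (ℕ × ℝ))) *
        (mom (Pn n : Measure (ℕ × ℝ)) 2 1 / n.descFactorial 2) := by
  have hn : ∀ k i : Fin m, 0 ≤ ∫ c, edgeInd e₀ (c k) * edgeInd e (c i)
      ∂configLaw n m (Pn n : Measure (ℕ × ℝ)) := fun k i =>
    integral_nonneg fun c => mul_nonneg (edgeInd_nonneg _ _) (edgeInd_nonneg _ _)
  by_cases hj : j = k
  · subst hj
    rw [if_pos rfl]
    have : ∀ c : Fin m → LayerConfig n, edgeInd e₀ (c j) * edgeInd e (c i) * edgeInd e (c j) =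
        edgeInd e₀ (c j) * edgeInd e (c j) * edgeInd e (c i) := fun c => by ring
    simp_rw [this]
    rw [integral_configLaw_mul _ hij.symm hij.symm]
    exact mul_le_mul_of_nonneg_left (hL.integral_edgeInd_le e i) (hn j j)
  · rw [if_neg hj, integral_configLaw_mul _ (Ne.symm hj) hij]
    exact mul_le_mul_of_nonneg_left (hL.integral_edgeInd_le e j) (hn k i)

theorem LayerLimit.integral_overlap_le (hL : LayerLimit Pn P) {n m : ℕ} (u v : Fin n) :
    ∫ c, (∑ k, edgeInd s(u, v) (c k)) * overlapCount u v c
        ∂configLaw n m (Pn n : Measure (ℕ × ℝ)) ≤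
      2 * linkRate (Pn n : Measure (ℕ × ℝ)) n m *
        ∫ c, linkSum (fun p => (p.1 + p.2 : ℝ)) u v c
          ∂configLaw n m (Pn n : Measure (ℕ × ℝ)) := by
  set ν := configLaw n m (Pn n : Measure (ℕ × ℝ))
  set q := mom (Pn n : Measure (ℕ × ℝ)) 2 1 / n.descFactorial 2 with hq
  have hq0 : 0 ≤ q := div_nonneg (integral_nonneg_of_ae ((hL.strength n).mono fun p hp =>
    hL.bound21.nonneg p hp)) (Nat.cast_nonneg _)
  let T : Fin m → Sym2 (Fin n) → Fin m → ℝ := fun k e i =>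
    ∫ c, edgeInd s(u, v) (c k) * edgeInd e (c i) ∂ν
  have hT : ∀ k e i, 0 ≤ T k e i := fun k e i =>
    integral_nonneg fun c => mul_nonneg (edgeInd_nonneg _ _) (edgeInd_nonneg _ _)
  have hinner : ∀ k e i, ∑ j ∈ Finset.univ.erase i,
      ∫ c, edgeInd s(u, v) (c k) * edgeInd e (c i) * edgeInd e (c j) ∂ν ≤
      (m * T k e i + T k e k) * q := fun k e i => by
    calc _ ≤ ∑ j ∈ Finset.univ.erase i, (T k e i + if j = k then T k e k else 0) * q :=
          Finset.sum_le_sum fun j hj => by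
            refine (hL.integral_triple_le _ _ (Finset.ne_of_mem_erase hj).symm).trans ?_
            refine mul_le_mul_of_nonneg_right ?_ hq0
            split_ifs
            · exact le_add_of_nonneg_left (hT k e i)
            · exact le_add_of_nonneg_right le_rfl
      _ ≤ ∑ j, (T k e i + if j = k then T k e k else 0) * q := by
          refine Finset.sum_le_sum_of_subset_of_nonneg (Finset.subset_univ _) fun j _ _ =>
            mul_nonneg (add_nonneg (hT k e i) ?_) hq0
          split_ifs
          exacts [hT k e k, le_rfl]
      _ = _ := by
          rw [← Finset.sum_mul, Finset.sum_add_distrib, Finset.sum_ite_eq']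
          simp
  have hsum : ∀ k e, ∑ i, ∑ j ∈ Finset.univ.erase i,
      ∫ c, edgeInd s(u, v) (c k) * edgeInd e (c i) * edgeInd e (c j) ∂ν ≤
      2 * (m * q) * ∑ i, T k e i := fun k e => by
    calc _ ≤ ∑ i, (m * T k e i + T k e k) * q := Finset.sum_le_sum fun i _ => hinner k e i
      _ = m * q * (∑ i, T k e i + T k e k) := by
          rw [← Finset.sum_mul, Finset.sum_add_distrib, ← Finset.mul_sum]
          simp
          ring
      _ ≤ m * q * (∑ i, T k e i + ∑ i, T k e i) := by
          gcongr
          exact Finset.single_le_sum (f := fun i => T k e i) (fun i _ => hT k e i)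
            (Finset.mem_univ k)
      _ = _ := by ring
  have e1 : ∫ c, (∑ k, edgeInd s(u, v) (c k)) * overlapCount u v c ∂ν =
      ∑ k, ∑ e ∈ incidentPairs u v, ∑ i, ∑ j ∈ Finset.univ.erase i,
        ∫ c, edgeInd s(u, v) (c k) * edgeInd e (c i) * edgeInd e (c j) ∂ν := by
    simp_rw [Finset.sum_mul]
    rw [integral_finsetSum _ fun _ _ => integrable_configLaw _]
    refine Finset.sum_congr rfl fun k _ => ?_
    simp_rw [overlapCount, Finset.mul_sum, ← mul_assoc]
    rw [integral_finsetSum _ fun _ _ => integrable_configLaw _]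
    refine Finset.sum_congr rfl fun e _ => ?_
    rw [integral_finsetSum _ fun _ _ => integrable_configLaw _]
    refine Finset.sum_congr rfl fun i _ => ?_
    rw [integral_finsetSum _ fun _ _ => integrable_configLaw _]
  have e2 : ∫ c, (∑ k, edgeInd s(u, v) (c k)) * ∑ e ∈ incidentPairs u v, ∑ i, edgeInd e (c i) ∂ν =
      ∑ k, ∑ e ∈ incidentPairs u v, ∑ i, T k e i := by
    simp_rw [Finset.sum_mul]
    rw [integral_finsetSum _ fun _ _ => integrable_configLaw _]
    refine Finset.sum_congr rfl fun k _ => ?_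
    simp_rw [Finset.mul_sum]
    rw [integral_finsetSum _ fun _ _ => integrable_configLaw _]
    refine Finset.sum_congr rfl fun e _ => ?_
    rw [integral_finsetSum _ fun _ _ => integrable_configLaw _]
  have h3 : ∑ k, ∑ e ∈ incidentPairs u v, ∑ i, T k e i ≤
      ∫ c, linkSum (fun p => (p.1 + p.2 : ℝ)) u v c ∂ν := by
    rw [← e2]
    exact integral_mono (integrable_configLaw _) (integrable_configLaw _) fun c =>
      mul_le_mul_of_nonneg_left (sum_incident_edgeInd_le u v c) (sum_edgeInd_nonneg _ _)
  rw [e1]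
  calc _ ≤ ∑ k, ∑ e ∈ incidentPairs u v, 2 * (m * q) * ∑ i, T k e i :=
        Finset.sum_le_sum fun k _ => Finset.sum_le_sum fun e _ => hsum k e
    _ = 2 * (m * q) * ∑ k, ∑ e ∈ incidentPairs u v, ∑ i, T k e i := by
        simp only [Finset.mul_sum]
    _ ≤ _ := mul_le_mul_of_nonneg_left h3 (by positivity)

end Moment

/-! ### The limit of the bidegree distribution -/

section Limit

variable {Pn : ℕ → ProbabilityMeasure (ℕ × ℝ)} {P : ProbabilityMeasure (ℕ × ℝ)}

/-- The function `φ` of the degrees of two nodes, restricted to the event that they are linked. -/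
def adjValue {n m : ℕ} (φ : ℕ × ℕ → ℝ) (u v : Fin n) (c : Fin m → LayerConfig n) : ℝ :=
  if s(u, v) ∈ edgeUnion c then φ (nodeDeg c u, nodeDeg c v) else 0

theorem tendsto_tsum_quadTail {f : ℕ × ℕ → ℝ} (hf : ∀ p, 0 ≤ f p)
    (hs : Summable fun p => quadW p * f p) :
    Tendsto (fun K : ℕ => ∑' p, quadTail K p * f p) atTop (𝓝 0) := by
  have h := tendsto_tsum_of_dominated_convergence (𝓕 := (atTop : Filter ℕ))
    (f := fun (K : ℕ) p => quadTail K p * f p) (g := fun _ => (0 : ℝ)) hs (fun p => ?_)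
    (Eventually.of_forall fun K p => ?_)
  · simpa using h
  · refine tendsto_const_nhds.congr' ?_
    filter_upwards [tendsto_natCast_atTop_atTop.eventually_ge_atTop (quadW p)] with K hK
    rw [quadTail, if_neg (not_lt.mpr hK), zero_mul]
  · rw [Real.norm_of_nonneg (mul_nonneg (quadTail_nonneg _ p) (hf p))]
    exact mul_le_mul_of_nonneg_right (quadTail_le _ p) (hf p)

theorem LayerLimit.abs_integral_sub_le (hL : LayerLimit Pn P) {φ : ℕ × ℕ → ℝ} {C K : ℝ}
    (hC : 0 ≤ C) (hK : 0 ≤ K) (hφ : ∀ p, |φ p| ≤ C * quadW p) {n m : ℕ} (u v : Fin n) :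
    |∫ c, adjValue φ u v c ∂configLaw n m (Pn n : Measure (ℕ × ℝ)) -
        ∫ c, linkSum φ u v c ∂configLaw n m (Pn n : Measure (ℕ × ℝ))| ≤
      2 * C * (K * (2 * linkRate (Pn n : Measure (ℕ × ℝ)) n m *
        ∫ c, linkSum (fun p => (p.1 + p.2 : ℝ)) u v c
          ∂configLaw n m (Pn n : Measure (ℕ × ℝ))) +
        ∫ c, linkSum (quadTail K) u v c ∂configLaw n m (Pn n : Measure (ℕ × ℝ))) := by
  rw [← integral_sub (integrable_configLaw _) (integrable_configLaw _)]
  refine abs_integral_le_integral_abs.trans ?_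
  refine (integral_mono (integrable_configLaw _) (integrable_configLaw _) fun c =>
    abs_sub_linkSum_le hC hK hφ u v c).trans ?_
  rw [integral_const_mul, integral_add (integrable_configLaw _) (integrable_configLaw _),
    integral_const_mul]
  gcongr
  exact hL.integral_overlap_le u v

theorem LayerLimit.tendsto_integral_adjValue (hL : LayerLimit Pn P) {mu : ℝ} (hmu : 0 ≤ mu)
    {m : ℕ → ℕ} (hm : Tendsto m atTop atTop)
    (hratio : Tendsto (fun n : ℕ => (m n : ℝ) / n) atTop (𝓝 mu)) {φ : ℕ × ℕ → ℝ} {C : ℝ}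
    (hφ : ∀ p, |φ p| ≤ C * quadW p) :
    Tendsto (fun N : ℕ => (linkRate (Pn (N + 2) : Measure (ℕ × ℝ)) (N + 2) (m (N + 2)))⁻¹ *
        ∫ c, adjValue φ 0 1 c ∂configLaw (N + 2) (m (N + 2)) (Pn (N + 2) : Measure (ℕ × ℝ)))
      atTop (𝓝 (∑' p : ℕ × ℕ, φ p * barf2 mu P p.1 p.2)) := by
  have hC : 0 ≤ C := by
    have := (abs_nonneg _).trans (hφ (0, 0))
    exact nonneg_of_mul_nonneg_left this (quadW_pos _)
  obtain ⟨hnn, hsum, hlim⟩ := hL.tendsto_integral_linkSum hmu hm hratio hφ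
  have hlin := (hL.tendsto_integral_linkSum hmu hm hratio (C := 1)
    (φ := fun p => (p.1 + p.2 : ℝ)) fun p => by
      have h1 : (0 : ℝ) ≤ p.1 := Nat.cast_nonneg _
      have h2 : (0 : ℝ) ≤ p.2 := Nat.cast_nonneg _
      rw [abs_of_nonneg (by positivity), quadW]
      nlinarith).2.2
  have htail := fun K : ℕ => (hL.tendsto_integral_linkSum hmu hm hratio (C := 1)
    (φ := quadTail K) fun p => by
      rw [abs_of_nonneg (quadTail_nonneg _ p), one_mul]
      exact quadTail_le _ p).2.2
  have hrate := (hL.tendsto_linkRate hratio).comp (tendsto_add_atTop_nat 2)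
  have hpos := (tendsto_add_atTop_nat 2).eventually (hL.linkRate_pos hm)
  set r : ℕ → ℝ := fun N => linkRate (Pn (N + 2) : Measure (ℕ × ℝ)) (N + 2) (m (N + 2)) with hr
  set X : (ℕ × ℕ → ℝ) → ℕ → ℝ := fun φ N => ∫ c, linkSum φ 0 1 c
    ∂configLaw (N + 2) (m (N + 2)) (Pn (N + 2) : Measure (ℕ × ℝ)) with hX
  set Y : ℕ → ℝ := fun N => ∫ c, adjValue φ 0 1 c
    ∂configLaw (N + 2) (m (N + 2)) (Pn (N + 2) : Measure (ℕ × ℝ)) with hY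
  have hbound : ∀ K : ℕ, ∀ᶠ N in atTop, |(r N)⁻¹ * Y N - (r N)⁻¹ * X φ N| ≤
      2 * C * (K * (2 * r N * ((r N)⁻¹ * X (fun p => (p.1 + p.2 : ℝ)) N)) +
        (r N)⁻¹ * X (quadTail K) N) := fun K => by
    filter_upwards [hpos] with N hN
    have hN' : 0 < r N := hN
    rw [← mul_sub, abs_mul, abs_of_pos (inv_pos.mpr hN')]
    refine (mul_le_mul_of_nonneg_left (hL.abs_integral_sub_le hC (Nat.cast_nonneg K) hφ
      (m := m (N + 2)) (0 : Fin (N + 2)) 1) (inv_pos.mpr hN').le).trans (le_of_eq ?_)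
    simp only [hX]
    ring
  have hdiff : Tendsto (fun N => (r N)⁻¹ * Y N - (r N)⁻¹ * X φ N) atTop (𝓝 0) := by
    rw [Metric.tendsto_atTop']
    intro ε hε
    have hK := ((tendsto_tsum_quadTail hnn hsum).const_mul (2 * C)).eventually
      (gt_mem_nhds (show 2 * C * 0 < ε by rwa [mul_zero]))
    obtain ⟨K, hK⟩ := hK.exists
    have hR := ((((hrate.const_mul 2).mul hlin).const_mul (K : ℝ)).add (htail K)).const_mul (2 * C)
    rw [mul_zero, zero_mul, mul_zero, zero_add] at hR
    have := (hbound K).and (hR.eventually (gt_mem_nhds hK))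
    obtain ⟨N₀, hN₀⟩ := eventually_atTop.mp this
    refine ⟨N₀, fun N hN => ?_⟩
    rw [Real.dist_eq, sub_zero]
    exact (hN₀ N hN.le).1.trans_lt (hN₀ N hN.le).2
  have := hdiff.add hlim
  rw [zero_add] at this
  exact this.congr fun N => sub_add_cancel _ _

theorem LayerLimit.tsum_barf2 (hL : LayerLimit Pn P) {mu : ℝ} (hmu : 0 ≤ mu)
    {m : ℕ → ℕ} (hm : Tendsto m atTop atTop)
    (hratio : Tendsto (fun n : ℕ => (m n : ℝ) / n) atTop (𝓝 mu)) :
    ∑' p : ℕ × ℕ, 1 * barf2 mu P p.1 p.2 = 1 := by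
  have h := (hL.tendsto_integral_linkSum hmu hm hratio (C := 1) (φ := fun _ => 1) fun p => by
    rw [abs_one, one_mul]; exact one_le_quadW p).2.2
  refine tendsto_nhds_unique h (tendsto_const_nhds.congr' ?_)
  filter_upwards [(tendsto_add_atTop_nat 2).eventually (hL.linkRate_pos hm)] with N hN
  rw [hL.integral_linkSum_one (by simp), inv_mul_cancel₀ hN.ne']

/-- The conditional expectation given the adjacency of the first two nodes, as a ratio. -/
theorem integral_cond_adjEvent (N m : ℕ) (Q : Measure (ℕ × ℝ)) [IsProbabilityMeasure Q]
    (φ : ℕ × ℕ → ℝ) :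
    ∫ ω, φ (deg ω 0, deg ω 1) ∂((modelMeasure (N + 2) m Q)[|adjEvent (N + 2) m]) =
      (∫ c, adjValue (fun _ => 1) 0 1 c ∂configLaw (N + 2) m Q)⁻¹ *
        ∫ c, adjValue φ 0 1 c ∂configLaw (N + 2) m Q := by
  have h0 : ∀ (e : Sym2 (Fin (N + 2))), (∃ v : Fin (N + 2), v ∈ e ∧ (v : ℕ) = 0) ↔ 0 ∈ e :=
    fun e => ⟨fun ⟨v, hv, hv0⟩ => by rwa [← (Fin.ext hv0 : v = 0)], fun h => ⟨0, h, rfl⟩⟩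
  have h1 : ∀ (e : Sym2 (Fin (N + 2))), (∃ v : Fin (N + 2), v ∈ e ∧ (v : ℕ) = 1) ↔ 1 ∈ e :=
    fun e => ⟨fun ⟨v, hv, hv1⟩ => by
      rwa [← (Fin.ext (hv1.trans (Fin.val_one N).symm) : v = 1)], fun h => ⟨1, h, Fin.val_one N⟩⟩
  have hE : ∀ ω : Fin m → Layer (N + 2), graphEdges ω = edgeUnion fun i => (ω i).2 := fun _ => rfl
  have hd0 : ∀ ω : Fin m → Layer (N + 2), deg ω 0 = nodeDeg (fun i => (ω i).2) 0 := fun ω => by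
    simp only [deg, h0, hE, nodeDeg]
  have hd1 : ∀ ω : Fin m → Layer (N + 2), deg ω 1 = nodeDeg (fun i => (ω i).2) 1 := fun ω => by
    simp only [deg, h1, hE, nodeDeg]
  have hadj : adjEvent (N + 2) m = (fun (ω : Fin m → Layer (N + 2)) i => (ω i).2) ⁻¹'
      {c | s(0, 1) ∈ edgeUnion c} := by
    ext ω
    simp only [adjEvent, Set.mem_ofPred_eq, h0, h1, hE, Set.mem_preimage]
    constructor
    · rintro ⟨e, he, h⟩
      rwa [← (Sym2.mem_and_mem_iff (by simp)).mp h]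
    · exact fun h => ⟨_, h, by simp, by simp⟩
  have hmeas : MeasurableSet (adjEvent (N + 2) m) := by
    rw [hadj]
    exact measurable_config _ _ (Set.toFinite _).measurableSet
  have hind : ∀ ψ : ℕ × ℕ → ℝ, ∫ ω in adjEvent (N + 2) m, ψ (deg ω 0, deg ω 1)
      ∂modelMeasure (N + 2) m Q = ∫ c, adjValue ψ 0 1 c ∂configLaw (N + 2) m Q := fun ψ => by
    rw [← integral_indicator hmeas, integral_configLaw]
    refine integral_congr_ae (ae_of_all _ fun ω => ?_)
    simp only [Set.indicator, adjValue, hd0, hd1, hadj, Set.mem_preimage, Set.mem_ofPred_eq]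
  have hone := hind fun _ => 1
  rw [setIntegral_const, smul_eq_mul, mul_one] at hone
  rw [ProbabilityTheory.cond, integral_smul_measure, hind, ← hone, ENNReal.toReal_inv, smul_eq_mul,
    measureReal_def]

end Limit

/-- A moment convergence hypothesis as a moment bound. -/
theorem isMomentBound_momFun {Pn : ℕ → ProbabilityMeasure (ℕ × ℝ)} {P : ProbabilityMeasure (ℕ × ℝ)}
    (hsupp : ∀ n, ∀ᵐ p ∂(Pn n : Measure (ℕ × ℝ)), p.1 ≤ n ∧ p.2 ∈ Set.Icc (0 : ℝ) 1) {r s : ℕ}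
    (hint : Integrable (momFun r s) (P : Measure (ℕ × ℝ)))
    (hlim : Tendsto (fun n : ℕ => mom (Pn n : Measure (ℕ × ℝ)) r s) atTop
      (𝓝 (mom (P : Measure (ℕ × ℝ)) r s))) : IsMomentBound Pn P (momFun r s) where
  poly := polySlices_momFun r s
  nonneg p hp := mul_nonneg (Nat.cast_nonneg _) (pow_nonneg hp.1 _)
  integrable n := by
    refine Integrable.of_bound (C := (n.descFactorial r : ℝ))
      ((polySlices_momFun r s).aestronglyMeasurable _) ((hsupp n).mono fun p hp => ?_)
    rw [momFun, Real.norm_of_nonneg (mul_nonneg (Nat.cast_nonneg _) (pow_nonneg hp.2.1 _))]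
    refine (mul_le_of_le_one_right (Nat.cast_nonneg _) (pow_le_one₀ hp.2.1 hp.2.2)).trans ?_
    exact_mod_cast Nat.descFactorial_le r hp.1
  integrable_limit := hint
  tendsto := hlim

/-- **Theorem 1(ii)** (Bloznelis–Karjalainen–Leskelä).
If in addition `P⁽ⁿ⁾₃₂ → P₃₂ < ∞` and `P⁽ⁿ⁾₄₃ → P₄₃ < ∞`, then
`∫ φ d f_{2,n} → ∫ φ d \bar f₂` for every `φ : ℤ₊² → ℝ` with
`|φ(x,y)| ≤ c (1 + x² + y²)` for some constant `c < ∞`. -/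
theorem bidegree_tendsto_barf2_wasserstein
    (mu : ℝ) (hmu : 0 < mu)
    (m : ℕ → ℕ) (hm : Tendsto m atTop atTop)
    (hratio : Tendsto (fun n : ℕ => (m n : ℝ) / n) atTop (𝓝 mu))
    (Pn : ℕ → ProbabilityMeasure (ℕ × ℝ)) (P : ProbabilityMeasure (ℕ × ℝ))
    (hsupp : ∀ n, (Pn n : Measure (ℕ × ℝ)) {p : ℕ × ℝ | p.1 ≤ n ∧ p.2 ∈ Set.Icc (0:ℝ) 1} = 1)
    (hPsupp : (P : Measure (ℕ × ℝ)) {p : ℕ × ℝ | p.2 ∈ Set.Icc (0:ℝ) 1} = 1)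
    (hweak : Tendsto Pn atTop (𝓝 P))
    (hint10 : Integrable (fun p : ℕ × ℝ => (p.1.descFactorial 1 : ℝ) * p.2 ^ (0:ℕ))
      (P : Measure (ℕ × ℝ)))
    (hint21 : Integrable (fun p : ℕ × ℝ => (p.1.descFactorial 2 : ℝ) * p.2 ^ (1:ℕ))
      (P : Measure (ℕ × ℝ)))
    (hint32 : Integrable (fun p : ℕ × ℝ => (p.1.descFactorial 3 : ℝ) * p.2 ^ (2:ℕ))
      (P : Measure (ℕ × ℝ)))
    (hint43 : Integrable (fun p : ℕ × ℝ => (p.1.descFactorial 4 : ℝ) * p.2 ^ (3:ℕ))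
      (P : Measure (ℕ × ℝ)))
    (h10pos : 0 < mom (P : Measure (ℕ × ℝ)) 1 0)
    (h21pos : 0 < mom (P : Measure (ℕ × ℝ)) 2 1)
    (h10 : Tendsto (fun n : ℕ => mom (Pn n : Measure (ℕ × ℝ)) 1 0) atTop
      (𝓝 (mom (P : Measure (ℕ × ℝ)) 1 0)))
    (h21 : Tendsto (fun n : ℕ => mom (Pn n : Measure (ℕ × ℝ)) 2 1) atTop
      (𝓝 (mom (P : Measure (ℕ × ℝ)) 2 1)))
    (h32 : Tendsto (fun n : ℕ => mom (Pn n : Measure (ℕ × ℝ)) 3 2) atTop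
      (𝓝 (mom (P : Measure (ℕ × ℝ)) 3 2)))
    (h43 : Tendsto (fun n : ℕ => mom (Pn n : Measure (ℕ × ℝ)) 4 3) atTop
      (𝓝 (mom (P : Measure (ℕ × ℝ)) 4 3))) :
    ∀ φ : ℕ × ℕ → ℝ, (∃ c : ℝ, ∀ p : ℕ × ℕ, |φ p| ≤ c * (1 + (p.1 : ℝ) ^ 2 + (p.2 : ℝ) ^ 2)) →
      Tendsto (fun n : ℕ =>
          ∫ ω, φ (deg ω 0, deg ω 1)
            ∂((modelMeasure n (m n) (Pn n : Measure (ℕ × ℝ)))[|adjEvent n (m n)])) atTop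
        (𝓝 (∑' p : ℕ × ℕ, φ p * barf2 mu (P : Measure (ℕ × ℝ)) p.1 p.2)) := by
  rintro φ ⟨c, hc⟩
  have hs : ∀ n, ∀ᵐ p ∂(Pn n : Measure (ℕ × ℝ)), p.1 ≤ n ∧ p.2 ∈ Set.Icc (0 : ℝ) 1 := fun n => by
    refine (prob_compl_eq_zero_iff ?_).mpr (hsupp n)
    exact (measurable_fst measurableSet_Iic).inter (measurable_snd measurableSet_Icc)
  have hPs : ∀ᵐ p ∂(P : Measure (ℕ × ℝ)), p.2 ∈ Set.Icc (0 : ℝ) 1 :=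
    (prob_compl_eq_zero_iff (measurable_snd measurableSet_Icc)).mpr hPsupp
  have hL : LayerLimit Pn P :=
    { weak := hweak
      supp := hs
      supp_limit := hPs
      bound10 := isMomentBound_momFun hs hint10 h10
      bound21 := isMomentBound_momFun hs hint21 h21
      bound32 := isMomentBound_momFun hs hint32 h32
      bound43 := isMomentBound_momFun hs hint43 h43
      pos10 := h10pos
      pos21 := h21pos }
  have hc0 : 0 ≤ c := by simpa using (abs_nonneg _).trans (hc (0, 0))
  have hφ : ∀ p, |φ p| ≤ c * quadW p := fun p => (hc p).trans <| by
    refine mul_le_mul_of_nonneg_left ?_ hc0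
    have h1 : (0 : ℝ) ≤ p.1 := Nat.cast_nonneg _
    have h2 : (0 : ℝ) ≤ p.2 := Nat.cast_nonneg _
    rw [quadW]
    nlinarith [mul_nonneg h1 h2]
  have hnum := hL.tendsto_integral_adjValue hmu.le hm hratio hφ
  have hden := hL.tendsto_integral_adjValue hmu.le hm hratio (C := 1) (φ := fun _ => 1) fun p => by
    rw [abs_one, one_mul]; exact one_le_quadW p
  rw [hL.tsum_barf2 hmu.le hm hratio] at hden
  have h := (hden.inv₀ one_ne_zero).mul hnum
  rw [inv_one, one_mul] at h
  rw [← tendsto_add_atTop_iff_nat 2]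
  refine h.congr' ?_
  filter_upwards [(tendsto_add_atTop_nat 2).eventually (hL.linkRate_pos hm)] with N hN
  rw [integral_cond_adjEvent, mul_inv, inv_inv]
  have := hN.ne'
  field_simp
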